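/- Let α be a smooth 1-form defined on a neighborhood of the origin in ℝ^{2n+1} with α(0)=0. Assume: (a) (dα)^n(0) ≠ 0, so dα has rank 2n near 0 and its kernel is spanned near 0 by a nonvanishing smooth vector field Z; (b) the coefficient function f := α(Z) has df(0) ≠ 0; (c) N = {f = 0} is tangent to Z at 0 with a generic tangency of order 2, i.e. df(0)(Z(0)) = 0 but Z(Z(f))(0) ≠ 0. Then there exist a neighborhood V of 0 and a smooth diffeomorphism Φ : V → Φ(V) ⊆ ℝ^{2n+1} with Φ(0)=0 and coordinates (θ, x₁, …, x_{2n}) such that Φ*α = d(θ³ − x₁θ) + γ, where γ = Σ_{i=1}^{2n} g_i(x₁,…,x_{2n}) dx_i is a 1-form whose coefficients g_i do not depend on θ and which satisfies dγ = Σ_{i=1}^{n} dx_i ∧ dx_{n+i}. -/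

import Mathlib

open scoped Topology ContDiff
open Filter

/-- `f` is smooth on some neighbourhood of `x`. -/
def SmoothNear {E F : Type*} [NormedAddCommGroup E] [NormedSpace ℝ E]
    [NormedAddCommGroup F] [NormedSpace ℝ F] (f : E → F) (x : E) : Prop :=
  ∀ᶠ y in 𝓝 x, ContDiffAt ℝ ∞ f y

/-- The exterior derivative of a one-form, as a function of two vectors. -/
noncomputable def oneFormDeriv {E : Type*} [NormedAddCommGroup E] [NormedSpace ℝ E]
    (μ : E → E →L[ℝ] ℝ) (x u v : E) : ℝ :=
  fderiv ℝ μ x u v - fderiv ℝ μ x v u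

/-- The pullback of a one-form along a map. -/
noncomputable def oneFormPullback {E F : Type*} [NormedAddCommGroup E] [NormedSpace ℝ E]
    [NormedAddCommGroup F] [NormedSpace ℝ F] (G : E → F) (μ : F → F →L[ℝ] ℝ) (x : E) : E →L[ℝ] ℝ :=
  (μ (G x)).comp (fderiv ℝ G x)

theorem two_le_smooth : (2 : WithTop ℕ∞) ≤ ∞ := by
  have h : ((2 : ℕ∞) : WithTop ℕ∞) ≤ ((⊤ : ℕ∞) : WithTop ℕ∞) := WithTop.coe_le_coe.2 le_top
  exact h

section Basic

variable {E F G : Type*} [NormedAddCommGroup E] [NormedSpace ℝ E]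
  [NormedAddCommGroup F] [NormedSpace ℝ F] [NormedAddCommGroup G] [NormedSpace ℝ G]

theorem ContDiff.smoothNear {f : E → F} (hf : ContDiff ℝ ∞ f) (x : E) : SmoothNear f x :=
  Eventually.of_forall fun _ => hf.contDiffAt

theorem SmoothNear.contDiffAt {f : E → F} {x : E} (hf : SmoothNear f x) : ContDiffAt ℝ ∞ f x :=
  hf.self_of_nhds

theorem SmoothNear.continuousAt {f : E → F} {x : E} (hf : SmoothNear f x) : ContinuousAt f x :=
  hf.contDiffAt.continuousAt

theorem SmoothNear.differentiableAt {f : E → F} {x : E} (hf : SmoothNear f x) :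
    DifferentiableAt ℝ f x :=
  hf.contDiffAt.differentiableAt (by simp)

theorem SmoothNear.eventually {f : E → F} {x : E} (hf : SmoothNear f x) :
    ∀ᶠ y in 𝓝 x, SmoothNear f y :=
  eventually_eventually_nhds.2 hf

theorem SmoothNear.comp {g : F → G} {f : E → F} {x : E} (hg : SmoothNear g (f x))
    (hf : SmoothNear f x) : SmoothNear (fun y => g (f y)) x := by
  filter_upwards [hf, hf.continuousAt.eventually hg] with y hy hy2
  exact ContDiffAt.comp y hy2 hy

theorem SmoothNear.prodMk {f : E → F} {g : E → G} {x : E} (hf : SmoothNear f x)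
    (hg : SmoothNear g x) : SmoothNear (fun y => (f y, g y)) x := by
  filter_upwards [hf, hg] with y h1 h2
  exact h1.prodMk h2

theorem SmoothNear.add {f g : E → F} {x : E} (hf : SmoothNear f x)
    (hg : SmoothNear g x) : SmoothNear (fun y => f y + g y) x := by
  filter_upwards [hf, hg] with y h1 h2
  exact h1.add h2

theorem SmoothNear.sub {f g : E → F} {x : E} (hf : SmoothNear f x)
    (hg : SmoothNear g x) : SmoothNear (fun y => f y - g y) x := by
  filter_upwards [hf, hg] with y h1 h2
  exact h1.sub h2

theorem SmoothNear.fderiv_right {f : E → F} {x : E} (hf : SmoothNear f x) :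
    SmoothNear (fderiv ℝ f) x := by
  filter_upwards [hf] with y h1
  exact h1.fderiv_right (by simp)

theorem SmoothNear.clm_comp {g : E → F →L[ℝ] G} {H : Type*} [NormedAddCommGroup H]
    [NormedSpace ℝ H] {f : E → H →L[ℝ] F} {x : E} (hg : SmoothNear g x)
    (hf : SmoothNear f x) : SmoothNear (fun y => (g y).comp (f y)) x := by
  filter_upwards [hf, hg] with y h1 h2
  exact h2.clm_comp h1

theorem SmoothNear.clm_apply {g : E → F →L[ℝ] G} {f : E → F} {x : E} (hg : SmoothNear g x)
    (hf : SmoothNear f x) : SmoothNear (fun y => g y (f y)) x := by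
  filter_upwards [hf, hg] with y h1 h2
  exact h2.clm_apply h1

theorem SmoothNear.oneFormPullback {g : E → F} {μ : F → F →L[ℝ] ℝ} {x : E}
    (hμ : SmoothNear μ (g x)) (hg : SmoothNear g x) : SmoothNear (oneFormPullback g μ) x :=
  (hμ.comp hg).clm_comp hg.fderiv_right

theorem ContDiffOn.smoothNear {f : E → F} {s : Set E} {x : E} (hf : ContDiffOn ℝ ∞ f s)
    (hs : s ∈ 𝓝 x) : SmoothNear f x := by
  filter_upwards [eventually_eventually_nhds.2 hs] with y hy
  exact hf.contDiffAt hy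

/-- A function that is smooth near a point agrees near that point with a globally smooth,
compactly supported function. -/
theorem SmoothNear.exists_contDiff [FiniteDimensional ℝ E] {f : E → F} {x : E}
    (hf : SmoothNear f x) :
    ∃ g : E → F, ContDiff ℝ ∞ g ∧ HasCompactSupport g ∧ g =ᶠ[𝓝 x] f := by
  obtain ⟨r, hr, hball⟩ := Metric.eventually_nhds_iff_ball.1 hf
  let χ : ContDiffBump x := ⟨r / 4, r / 2, by positivity, by linarith⟩
  refine ⟨fun y => χ y • f y, ?_, ?_, ?_⟩
  · rw [contDiff_iff_contDiffAt]
    intro y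
    by_cases hy : y ∈ Metric.ball x r
    · exact χ.contDiff.contDiffAt.smul (hball y hy)
    · have h0 : (fun y => χ y • f y) =ᶠ[𝓝 y] fun _ => 0 := by
        have : y ∈ (Metric.closedBall x (r / 2))ᶜ := by
          simp only [Metric.mem_ball, not_lt, Set.mem_compl_iff, Metric.mem_closedBall, not_le] at hy ⊢
          linarith
        filter_upwards [Metric.isClosed_closedBall.isOpen_compl.mem_nhds this] with z hz
        have : χ z = 0 := χ.zero_of_le_dist (by
          simp only [Set.mem_compl_iff, Metric.mem_closedBall, not_le] at hz
          exact hz.le)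
        simp [this]
      exact contDiffAt_const.congr_of_eventuallyEq h0
  · exact χ.hasCompactSupport.smul_right
  · filter_upwards [χ.eventuallyEq_one] with y hy
    simp [hy]

/-- The inverse function theorem for maps smooth near a point. -/
theorem SmoothNear.exists_localInverse [CompleteSpace E] {f : E → F} {x : E}
    (hf : SmoothNear f x) (f' : E ≃L[ℝ] F) (hf' : fderiv ℝ f x = f') :
    ∃ g : F → E, SmoothNear g (f x) ∧ g (f x) = x ∧ (∀ᶠ y in 𝓝 (f x), f (g y) = y) ∧
      (∀ᶠ z in 𝓝 x, g (f z) = z) ∧ fderiv ℝ g (f x) = f'.symm := by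
  have hd : HasFDerivAt f (f' : E →L[ℝ] F) x := hf' ▸ hf.differentiableAt.hasFDerivAt
  have hs : HasStrictFDerivAt f (f' : E →L[ℝ] F) x := hf.contDiffAt.hasStrictFDerivAt' hd (by simp)
  let e := hs.toOpenPartialHomeomorph f
  have he : ∀ y, e y = f y := fun _ => rfl
  have hxs : x ∈ e.source := hs.mem_toOpenPartialHomeomorph_source
  have hxt : f x ∈ e.target := hs.image_mem_toOpenPartialHomeomorph_target
  have hgx : e.symm (f x) = x := e.left_inv hxs
  have hcont : ContinuousAt e.symm (f x) := e.continuousAt_symm hxt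
  have hinv : ∀ᶠ z in 𝓝 x, ∃ A : E ≃L[ℝ] F, (A : E →L[ℝ] F) = fderiv ℝ f z := by
    have hc : ContinuousAt (fderiv ℝ f) x := hf.fderiv_right.continuousAt
    have : ∀ᶠ L in 𝓝 (fderiv ℝ f x), ∃ A : E ≃L[ℝ] F, (A : E →L[ℝ] F) = L := by
      have := ContinuousLinearEquiv.nhds f'
      rw [hf']
      filter_upwards [this] with L hL
      exact hL
    exact hc.eventually this
  refine ⟨e.symm, ?_, hgx, ?_, ?_, ?_⟩
  · have h1 := hcont.eventually (by rw [hgx]; exact hf.and hinv)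
    filter_upwards [h1, e.open_target.mem_nhds hxt] with y ⟨hy1, A, hA⟩ hy2
    refine e.contDiffAt_symm (f₀' := A) hy2 ?_ hy1
    rw [hA]
    exact (hy1.differentiableAt (by simp)).hasFDerivAt
  · filter_upwards [e.open_target.mem_nhds hxt] with y hy
    exact e.right_inv hy
  · filter_upwards [e.open_source.mem_nhds hxs] with y hy
    exact e.left_inv hy
  · exact (hs.to_localInverse).hasFDerivAt.fderiv

theorem oneFormDeriv_congr {μ ν : E → E →L[ℝ] ℝ} {x : E} (h : μ =ᶠ[𝓝 x] ν) :
    oneFormDeriv μ x = oneFormDeriv ν x := by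
  funext u v
  simp [oneFormDeriv, h.fderiv_eq]

theorem oneFormDeriv_add {μ ν : E → E →L[ℝ] ℝ} {x : E} (hμ : DifferentiableAt ℝ μ x)
    (hν : DifferentiableAt ℝ ν x) (u v : E) :
    oneFormDeriv (fun y => μ y + ν y) x u v = oneFormDeriv μ x u v + oneFormDeriv ν x u v := by
  simp only [oneFormDeriv]
  rw [fderiv_fun_add hμ hν]
  simp only [add_apply]
  ring

theorem oneFormDeriv_sub {μ ν : E → E →L[ℝ] ℝ} {x : E} (hμ : DifferentiableAt ℝ μ x)
    (hν : DifferentiableAt ℝ ν x) (u v : E) :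
    oneFormDeriv (fun y => μ y - ν y) x u v = oneFormDeriv μ x u v - oneFormDeriv ν x u v := by
  simp only [oneFormDeriv]
  rw [fderiv_fun_sub hμ hν]
  simp only [sub_apply]
  ring

theorem oneFormDeriv_fderiv {h : E → ℝ} {x : E} (hh : SmoothNear h x) (u v : E) :
    oneFormDeriv (fderiv ℝ h) x u v = 0 := by
  have : IsSymmSndFDerivAt ℝ h x := hh.contDiffAt.isSymmSndFDerivAt (by simpa using two_le_smooth)
  exact sub_eq_zero.2 (this u v)

/-- The exterior derivative commutes with pullback. -/
theorem oneFormDeriv_pullback {g : E → F} {μ : F → F →L[ℝ] ℝ} {x : E}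
    (hμ : DifferentiableAt ℝ μ (g x)) (hg : SmoothNear g x) (u v : E) :
    oneFormDeriv (oneFormPullback g μ) x u v =
      oneFormDeriv μ (g x) (fderiv ℝ g x u) (fderiv ℝ g x v) := by
  have hsym : IsSymmSndFDerivAt ℝ g x := hg.contDiffAt.isSymmSndFDerivAt (by simpa using two_le_smooth)
  have hc : HasFDerivAt (fun y => μ (g y)) ((fderiv ℝ μ (g x)).comp (fderiv ℝ g x)) x :=
    hμ.hasFDerivAt.comp x hg.differentiableAt.hasFDerivAt
  have hp : HasFDerivAt (oneFormPullback g μ) _ x :=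
    hc.clm_comp hg.fderiv_right.differentiableAt.hasFDerivAt
  simp only [oneFormDeriv, hp.fderiv]
  simp
  rw [hsym u v]
  ring

theorem oneFormDeriv_self (μ : E → E →L[ℝ] ℝ) (x u : E) : oneFormDeriv μ x u u = 0 := by
  simp [oneFormDeriv]

theorem oneFormDeriv_swap (μ : E → E →L[ℝ] ℝ) (x u v : E) :
    oneFormDeriv μ x u v = -oneFormDeriv μ x v u := by
  simp [oneFormDeriv]

end Basic

section Integral

open MeasureTheory

/-- The linear map `T ↦ B ∘ T ∘ A`. -/
noncomputable def clmSandwich {V V' F G : Type*} [NormedAddCommGroup V] [NormedSpace ℝ V]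
    [NormedAddCommGroup V'] [NormedSpace ℝ V'] [NormedAddCommGroup F] [NormedSpace ℝ F]
    [NormedAddCommGroup G] [NormedSpace ℝ G] (B : F →L[ℝ] G) (A : V →L[ℝ] V') :
    (V' →L[ℝ] F) →L[ℝ] (V →L[ℝ] G) :=
  (ContinuousLinearMap.compL ℝ V F G B).comp ((ContinuousLinearMap.compL ℝ V V' F).flip A)

section Sandwich

variable {V V' F G : Type*} [NormedAddCommGroup V] [NormedSpace ℝ V]
    [NormedAddCommGroup V'] [NormedSpace ℝ V'] [NormedAddCommGroup F] [NormedSpace ℝ F]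
    [NormedAddCommGroup G] [NormedSpace ℝ G]

theorem clmSandwich_apply (B : F →L[ℝ] G) (A : V →L[ℝ] V') (T : V' →L[ℝ] F) :
    clmSandwich B A T = B.comp (T.comp A) := rfl

theorem norm_comp_comp_le (B : F →L[ℝ] G) (A : V →L[ℝ] V') (T : V' →L[ℝ] F) :
    ‖B.comp (T.comp A)‖ ≤ ‖B‖ * ‖A‖ * ‖T‖ :=
  calc ‖B.comp (T.comp A)‖ ≤ ‖B‖ * (‖T‖ * ‖A‖) :=
        (ContinuousLinearMap.opNorm_comp_le _ _).trans
          (by gcongr; exact ContinuousLinearMap.opNorm_comp_le _ _)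
    _ = ‖B‖ * ‖A‖ * ‖T‖ := by ring

theorem norm_clmSandwich_le (B : F →L[ℝ] G) (A : V →L[ℝ] V') :
    ‖clmSandwich B A‖ ≤ ‖B‖ * ‖A‖ :=
  ContinuousLinearMap.opNorm_le_bound _ (by positivity) (norm_comp_comp_le B A)

theorem continuous_clmSandwich :
    Continuous fun p : (F →L[ℝ] G) × (V →L[ℝ] V') => clmSandwich p.1 p.2 := by
  unfold clmSandwich
  fun_prop

end Sandwich

theorem aestronglyMeasurable_clm_apply {W : Type*} [MeasurableSpace W] {ν : Measure W}
    {F G : Type*} [NormedAddCommGroup F] [NormedSpace ℝ F] [NormedAddCommGroup G]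
    [NormedSpace ℝ G] {L : W → F →L[ℝ] G} {f : W → F} (hL : AEStronglyMeasurable L ν)
    (hf : AEStronglyMeasurable f ν) : AEStronglyMeasurable (fun ξ => L ξ (f ξ)) ν := by
  have hc : Continuous fun p : (F →L[ℝ] G) × F => p.1 p.2 := by fun_prop
  exact hc.comp_aestronglyMeasurable (hL.prodMk hf)

theorem hasFDerivAt_integral_clm_comp {W : Type*} [MeasurableSpace W] {ν : Measure W}
    {V V' F G : Type} [NormedAddCommGroup V] [NormedSpace ℝ V] [NormedAddCommGroup V']
    [NormedSpace ℝ V'] [NormedAddCommGroup F] [NormedSpace ℝ F] [NormedAddCommGroup G]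
    [NormedSpace ℝ G] {A : W → V →L[ℝ] V'} (hA : AEStronglyMeasurable A ν)
    {B : W → F →L[ℝ] G} {H : V' → F} (hB : AEStronglyMeasurable B ν)
    (hInt : ∀ N : ℕ, Integrable (fun ξ => ‖B ξ‖ * ‖A ξ‖ ^ N) ν)
    (hH : ContDiff ℝ ∞ H) (hbd : ∀ k : ℕ, ∃ C : ℝ, ∀ x, ‖iteratedFDeriv ℝ k H x‖ ≤ C) (x : V) :
    HasFDerivAt (fun x => ∫ ξ, B ξ (H (A ξ x)) ∂ν)
      (∫ ξ, clmSandwich (B ξ) (A ξ) (fderiv ℝ H (A ξ x)) ∂ν) x := by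
  have hHd : Differentiable ℝ H := hH.differentiable (by simp)
  obtain ⟨C0, hC0⟩ := hbd 0
  obtain ⟨C1, hC1⟩ := hbd 1
  have hC0' : ∀ x, ‖H x‖ ≤ C0 := fun x => by simpa using hC0 x
  have hC1' : ∀ x, ‖fderiv ℝ H x‖ ≤ C1 := fun x => by
    have h1 := norm_iteratedFDeriv_fderiv (𝕜 := ℝ) (f := H) (n := 0) (x := x)
    have h2 := hC1 x
    rw [norm_iteratedFDeriv_zero] at h1
    rw [h1]; simpa using h2
  have hmeas : ∀ y, AEStronglyMeasurable (fun ξ => B ξ (H (A ξ y))) ν := fun y => by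
    have hc : Continuous fun p : (F →L[ℝ] G) × (V →L[ℝ] V') => p.1 (H (p.2 y)) := by
      have := hH.continuous
      fun_prop
    exact hc.comp_aestronglyMeasurable (hB.prodMk hA)
  refine hasFDerivAt_integral_of_dominated_of_fderiv_le (𝕜 := ℝ) (x₀ := x)
    (F' := fun x ξ => clmSandwich (B ξ) (A ξ) (fderiv ℝ H (A ξ x))) (s := Set.univ)
    (bound := fun ξ => ‖B ξ‖ * ‖A ξ‖ ^ 1 * C1) Filter.univ_mem
    (Eventually.of_forall hmeas) ?_ ?_ ?_ ((hInt 1).mul_const _) ?_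
  · refine Integrable.mono' ((hInt 0).mul_const C0) (hmeas x) (Eventually.of_forall fun ξ => ?_)
    calc ‖B ξ (H (A ξ x))‖ ≤ ‖B ξ‖ * ‖H (A ξ x)‖ := (B ξ).le_opNorm _
      _ ≤ ‖B ξ‖ * ‖A ξ‖ ^ 0 * C0 := by
        rw [pow_zero, mul_one]; gcongr; exact hC0' _
  · have h1 : Continuous (fderiv ℝ H) := hH.continuous_fderiv (by simp)
    have h2 : Continuous fun T : V →L[ℝ] V' => fderiv ℝ H (T x) :=
      h1.comp (ContinuousLinearMap.apply ℝ V' x).continuous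
    have hm : AEStronglyMeasurable (fun ξ => clmSandwich (B ξ) (A ξ)) ν :=
      continuous_clmSandwich.comp_aestronglyMeasurable (hB.prodMk hA)
    have h3 : AEStronglyMeasurable (fun ξ => fderiv ℝ H (A ξ x)) ν :=
      h2.comp_aestronglyMeasurable hA
    exact aestronglyMeasurable_clm_apply hm h3
  · refine Eventually.of_forall fun ξ y _ => ?_
    rw [clmSandwich_apply]
    calc ‖(B ξ).comp ((fderiv ℝ H (A ξ y)).comp (A ξ))‖
        ≤ ‖B ξ‖ * ‖A ξ‖ * ‖fderiv ℝ H (A ξ y)‖ := norm_comp_comp_le _ _ _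
      _ ≤ ‖B ξ‖ * ‖A ξ‖ * C1 := by gcongr; exact hC1' _
      _ = ‖B ξ‖ * ‖A ξ‖ ^ 1 * C1 := by ring
  · refine Eventually.of_forall fun ξ y _ => ?_
    have h1 : HasFDerivAt (fun z => H (A ξ z)) ((fderiv ℝ H (A ξ y)).comp (A ξ)) y :=
      (hHd _).hasFDerivAt.comp y (A ξ).hasFDerivAt
    exact (B ξ).hasFDerivAt.comp y h1

/-- Differentiation under the integral sign: an integral of a function with bounded derivatives
precomposed with a family of linear maps is smooth, as soon as all moments are finite. -/
theorem contDiff_integral_clm_comp {W : Type*} [MeasurableSpace W] {ν : Measure W}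
    {V V' : Type} [NormedAddCommGroup V] [NormedSpace ℝ V] [NormedAddCommGroup V'] [NormedSpace ℝ V']
    {A : W → V →L[ℝ] V'} (hA : AEStronglyMeasurable A ν) (n : ℕ) :
    ∀ {F G : Type} [NormedAddCommGroup F] [NormedSpace ℝ F] [NormedAddCommGroup G]
      [NormedSpace ℝ G] {B : W → F →L[ℝ] G} {H : V' → F},
      AEStronglyMeasurable B ν → (∀ N : ℕ, Integrable (fun ξ => ‖B ξ‖ * ‖A ξ‖ ^ N) ν) →
      ContDiff ℝ ∞ H → (∀ k : ℕ, ∃ C : ℝ, ∀ x, ‖iteratedFDeriv ℝ k H x‖ ≤ C) →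
      ContDiff ℝ n (fun x => ∫ ξ, B ξ (H (A ξ x)) ∂ν) := by
  induction n with
  | zero =>
    intro F G _ _ _ _ B H hB hInt hH hbd
    have := hasFDerivAt_integral_clm_comp hA hB hInt hH hbd
    refine contDiff_zero.2 (continuous_iff_continuousAt.2 fun x => (this x).continuousAt)
  | succ n ih =>
    intro F G _ _ _ _ B H hB hInt hH hbd
    have hk := hasFDerivAt_integral_clm_comp hA hB hInt hH hbd
    have hfd : fderiv ℝ (fun x => ∫ ξ, B ξ (H (A ξ x)) ∂ν) = _ := funext fun x => (hk x).fderiv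
    rw [Nat.cast_add, Nat.cast_one, contDiff_succ_iff_fderiv]
    refine ⟨fun x => (hk x).differentiableAt, by simp, ?_⟩
    rw [hfd]
    refine ih ?_ ?_ (hH.fderiv_right (by simp)) ?_
    · exact continuous_clmSandwich.comp_aestronglyMeasurable (hB.prodMk hA)
    · intro N
      have hm : AEStronglyMeasurable (fun ξ => clmSandwich (B ξ) (A ξ)) ν :=
        continuous_clmSandwich.comp_aestronglyMeasurable (hB.prodMk hA)
      refine (hInt (N + 1)).mono' (hm.norm.mul (hA.norm.pow N))
        (Eventually.of_forall fun ξ => ?_)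
      rw [Real.norm_of_nonneg (by positivity)]
      calc _ ≤ ‖B ξ‖ * ‖A ξ‖ * ‖A ξ‖ ^ N := by gcongr; exact norm_clmSandwich_le _ _
        _ = _ := by ring
    · intro k
      obtain ⟨C, hC⟩ := hbd (k + 1)
      exact ⟨C, fun x => by rw [norm_iteratedFDeriv_fderiv]; exact hC x⟩

/-- Smoothness of an average over `[0, 1]` of a smooth function precomposed with a continuous
family of linear maps. -/
theorem contDiff_intervalIntegral_clm_comp {V V' F : Type} [NormedAddCommGroup V] [NormedSpace ℝ V]
    [FiniteDimensional ℝ V] [NormedAddCommGroup V'] [NormedSpace ℝ V'] [FiniteDimensional ℝ V']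
    [NormedAddCommGroup F] [NormedSpace ℝ F]
    {A : ℝ → V →L[ℝ] V'} (hA : Continuous A) {b : ℝ → ℝ} (hb : Continuous b)
    {H : V' → F} (hH : ContDiff ℝ ∞ H) :
    ContDiff ℝ ∞ (fun x => ∫ s in (0 : ℝ)..1, b s • H (A s x)) := by
  have main : ∀ K : V' → F, ContDiff ℝ ∞ K → HasCompactSupport K →
      ContDiff ℝ ∞ (fun x => ∫ s in (0 : ℝ)..1, b s • K (A s x)) := by
    intro K hK hKc
    simp_rw [intervalIntegral.integral_of_le zero_le_one]
    rw [contDiff_infty]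
    intro n
    have hB : Continuous fun s => b s • ContinuousLinearMap.id ℝ F := by fun_prop
    refine contDiff_integral_clm_comp (B := fun s => b s • ContinuousLinearMap.id ℝ F)
      hA.aestronglyMeasurable n hB.aestronglyMeasurable ?_ hK ?_
    · intro N
      have hc : Continuous fun s => ‖b s • ContinuousLinearMap.id ℝ F‖ * ‖A s‖ ^ N := by fun_prop
      exact (hc.integrableOn_Icc (a := 0) (b := 1)).mono_set Set.Ioc_subset_Icc_self
    · intro k
      have h1 : Continuous (iteratedFDeriv ℝ k K) :=
        hK.continuous_iteratedFDeriv (by exact_mod_cast le_top)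
      obtain ⟨C, hC⟩ := h1.bounded_above_of_compact_support (hKc.iteratedFDeriv k)
      exact ⟨C, hC⟩
  rw [contDiff_iff_contDiffAt]
  intro x
  have hcomp : IsCompact ((fun p : ℝ × V => A p.1 p.2) '' (Set.Icc 0 1 ×ˢ Metric.closedBall x 1)) := by
    refine (isCompact_Icc.prod (isCompact_closedBall x 1)).image ?_
    fun_prop
  obtain ⟨R, hR, hsub⟩ := hcomp.isBounded.subset_closedBall_lt 0 0
  let χ : ContDiffBump (0 : V') := ⟨R, R + 1, hR, by linarith⟩
  have h1 := main (fun y => χ y • H y) (χ.contDiff.smul hH) (χ.hasCompactSupport.smul_right)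
  refine h1.contDiffAt.congr_of_eventuallyEq ?_
  filter_upwards [Metric.closedBall_mem_nhds x one_pos] with z hz
  refine intervalIntegral.integral_congr fun s hs => ?_
  rw [Set.uIcc_of_le zero_le_one] at hs
  have : χ (A s z) = 1 := χ.one_of_mem_closedBall (hsub ⟨(s, z), ⟨hs, hz⟩, rfl⟩)
  simp [this]

end Integral

section CosSqrt

/-- The cosine is a smooth function of the square of its argument. -/
theorem exists_contDiff_cos_sq : ∃ C : ℝ → ℝ, ContDiff ℝ ∞ C ∧ ∀ s, C (s ^ 2) = Real.cos s := by
  let c : ℕ → ℝ := fun j => (-1) ^ j / (2 * j).factorial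
  have hc0 : ∀ j, c j ≠ 0 := fun j => by
    simp only [c]
    positivity
  have hrad : (FormalMultilinearSeries.ofScalars ℝ c).radius = ⊤ := by
    refine FormalMultilinearSeries.ofScalars_radius_eq_top_of_tendsto ℝ c
      (Eventually.of_forall hc0) ?_
    refine squeeze_zero (fun n => by positivity) (g := fun n : ℕ => 1 / ((n : ℝ) + 1)) ?_
      tendsto_one_div_add_atTop_nhds_zero_nat
    intro n
    have h1 : ‖c n.succ‖ / ‖c n‖ = ((2 * n).factorial : ℝ) / (2 * (n + 1)).factorial := by
      simp only [c, norm_div, norm_pow, norm_neg, norm_one, one_pow, Nat.succ_eq_add_one,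
        RCLike.norm_natCast]
      field_simp
    have h2 : ((2 * (n + 1)).factorial : ℝ) = (2 * n + 2) * (2 * n + 1) * (2 * n).factorial := by
      rw [show 2 * (n + 1) = (2 * n + 1) + 1 by ring, Nat.factorial_succ, Nat.factorial_succ]
      push_cast
      ring
    have h3 : ((2 * n).factorial : ℝ) ≠ 0 := by positivity
    rw [h1, h2, div_le_div_iff₀ (by positivity) (by positivity)]
    have : ((2 * n).factorial : ℝ) * (n + 1) * 1 ≤ ((2 * n).factorial : ℝ) * (n + 1) * (2 * (2 * n + 1)) := by
      gcongr
      nlinarith [(Nat.cast_nonneg n : (0 : ℝ) ≤ n)]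
    nlinarith
  have hps := (FormalMultilinearSeries.ofScalars ℝ c).hasFPowerSeriesOnBall (by simp [hrad])
  refine ⟨FormalMultilinearSeries.ofScalarsSum c, ?_, fun s => ?_⟩
  · have := hps.analyticOnNhd
    rw [hrad] at this
    refine contDiff_iff_contDiffAt.2 fun x => (this x (by simp)).contDiffAt
  · rw [FormalMultilinearSeries.ofScalars_sum_eq]
    refine HasSum.tsum_eq ?_
    have h : (fun j => c j • (s ^ 2) ^ j) =
        fun j => (-1) ^ j * s ^ (2 * j) / ((2 * j).factorial : ℝ) := by
      funext j
      simp only [c, pow_mul, smul_eq_mul]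
      ring
    rw [h]
    exact Real.hasSum_cos s

theorem iteratedDeriv_hasDerivAt {f : ℝ → ℝ} (hf : ContDiff ℝ ∞ f) (j : ℕ) (x : ℝ) :
    HasDerivAt (iteratedDeriv j f) (iteratedDeriv (j + 1) f x) x := by
  rw [iteratedDeriv_succ]
  exact (hf.differentiable_iteratedDeriv j (by exact_mod_cast WithTop.coe_lt_top j)).differentiableAt.hasDerivAt

section

variable {C : ℝ → ℝ} (hC : ContDiff ℝ ∞ C) (hcos : ∀ s, C (s ^ 2) = Real.cos s)
include hC hcos

theorem deriv_cos_sq (s : ℝ) : -(2 * deriv C (s ^ 2)) * s = Real.sin s := by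
  have h1 : HasDerivAt (fun s => C (s ^ 2)) (deriv C (s ^ 2) * (2 * s)) s := by
    have h2 : HasDerivAt (fun s : ℝ => s ^ 2) (2 * s) s := by simpa using hasDerivAt_pow 2 s
    exact (hC.differentiable (by simp)).differentiableAt.hasDerivAt.comp s h2
  have h3 : (fun s => C (s ^ 2)) = Real.cos := funext hcos
  rw [h3] at h1
  have := h1.unique (Real.hasDerivAt_cos s)
  linarith

theorem cos_sq_ode (j : ℕ) : ∀ x > 0, 4 * x * iteratedDeriv (j + 2) C x +
    (4 * j + 2) * iteratedDeriv (j + 1) C x + iteratedDeriv j C x = 0 := by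
  induction j with
  | zero =>
    intro x hx
    obtain ⟨s, hs, rfl⟩ : ∃ s : ℝ, 0 < s ∧ x = s ^ 2 :=
      ⟨√x, Real.sqrt_pos.2 hx, (Real.sq_sqrt hx.le).symm⟩
    have h1 := iteratedDeriv_hasDerivAt hC 1 (s ^ 2)
    have h2 : HasDerivAt (fun s : ℝ => s ^ 2) (2 * s) s := by simpa using hasDerivAt_pow 2 s
    have h3 := ((HasDerivAt.comp (h := fun s : ℝ => s ^ 2) s h1 h2).const_mul (-2)).mul (hasDerivAt_id s)
    have h4 : ((fun s => -2 * ((iteratedDeriv 1 C ∘ fun s => s ^ 2) s)) * id) = Real.sin := by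
      funext s
      rw [← deriv_cos_sq hC hcos s]
      simp [iteratedDeriv_one]
    rw [h4] at h3
    have h5 := h3.unique (Real.hasDerivAt_sin s)
    rw [← hcos s] at h5
    simp only [id, Function.comp] at h5
    simp
    simp at h5
    linarith
  | succ j ih =>
    intro x hx
    have h1 := (((hasDerivAt_id x).const_mul 4).mul (iteratedDeriv_hasDerivAt hC (j + 2) x)).add
      ((iteratedDeriv_hasDerivAt hC (j + 1) x).const_mul (4 * (j : ℝ) + 2)) |>.add
      (iteratedDeriv_hasDerivAt hC j x)
    have h2 := h1.congr_of_eventuallyEq (f₁ := fun _ => 0) (by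
      filter_upwards [lt_mem_nhds hx] with y hy
      simpa using (ih y hy).symm)
    have h3 := h2.unique (hasDerivAt_const x 0)
    simp only [id] at h3
    push_cast
    linarith

theorem iteratedDeriv_cos_sq_le (j : ℕ) :
    ∃ M : ℝ, ∀ x ≥ 0, |iteratedDeriv j C x| ≤ M := by
  let F : ℝ → ℝ := fun x => iteratedDeriv j C x ^ 2 + 4 * x * iteratedDeriv (j + 1) C x ^ 2
  have hF : ∀ x, HasDerivAt F (2 * iteratedDeriv j C x * iteratedDeriv (j + 1) C x +
      (4 * iteratedDeriv (j + 1) C x ^ 2 +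
      4 * x * (2 * iteratedDeriv (j + 1) C x * iteratedDeriv (j + 2) C x))) x := by
    intro x
    have h1 := (iteratedDeriv_hasDerivAt hC j x).pow 2
    have h2 := (iteratedDeriv_hasDerivAt hC (j + 1) x).pow 2
    have h3 := h1.add (((hasDerivAt_id x).const_mul 4).mul h2)
    refine h3.congr_deriv ?_
    simp
  have hanti : AntitoneOn F (Set.Ici 0) := by
    refine antitoneOn_of_deriv_nonpos (convex_Ici 0)
      (fun x _ => (hF x).continuousAt.continuousWithinAt)
      (fun x _ => (hF x).differentiableAt.differentiableWithinAt) fun x hx => ?_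
    rw [interior_Ici, Set.mem_Ioi] at hx
    rw [(hF x).deriv]
    have h1 := cos_sq_ode hC hcos j x hx
    have h2 : 2 * iteratedDeriv j C x * iteratedDeriv (j + 1) C x +
      (4 * iteratedDeriv (j + 1) C x ^ 2 +
      4 * x * (2 * iteratedDeriv (j + 1) C x * iteratedDeriv (j + 2) C x)) =
      -(8 * j * iteratedDeriv (j + 1) C x ^ 2) := by
      linear_combination 2 * iteratedDeriv (j + 1) C x * h1
    rw [h2]
    have : 0 ≤ 8 * (j : ℝ) * iteratedDeriv (j + 1) C x ^ 2 := by positivity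
    linarith
  refine ⟨√(F 0), fun x hx => Real.abs_le_sqrt ?_⟩
  have h1 := hanti (Set.mem_Ici.2 le_rfl) hx hx
  have h2 : 0 ≤ 4 * x * iteratedDeriv (j + 1) C x ^ 2 := by
    have : 0 ≤ x := hx
    positivity
  simp only [F] at h1 ⊢
  linarith

end

/-- There is a smooth function `C` with bounded derivatives such that `cos s = C (s ^ 2)`. -/
theorem exists_bounded_cos_sq : ∃ C : ℝ → ℝ, ContDiff ℝ ∞ C ∧ (∀ s, C (s ^ 2) = Real.cos s) ∧
    ∀ j, ∃ M : ℝ, ∀ x, |iteratedDeriv j C x| ≤ M := by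
  obtain ⟨C, hC, hcos⟩ := exists_contDiff_cos_sq
  let D : ℝ → ℝ := fun x => C x * Real.smoothTransition (x + 1)
  have hD : ContDiff ℝ ∞ D := by
    refine hC.mul ?_
    exact Real.smoothTransition.contDiff.comp (contDiff_id.add contDiff_const)
  have hDC : ∀ x, 0 ≤ x → D x = C x := fun x hx => by
    simp only [D]
    rw [Real.smoothTransition.one_of_one_le (by linarith), mul_one]
  refine ⟨D, hD, fun s => by rw [hDC _ (sq_nonneg s), hcos], fun j => ?_⟩
  obtain ⟨M1, hM1⟩ := iteratedDeriv_cos_sq_le hC hcos j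
  have hcont : Continuous (iteratedDeriv j D) :=
    hD.continuous_iteratedDeriv j (by exact_mod_cast le_top)
  obtain ⟨M2, hM2⟩ := (isCompact_Icc (a := (-1 : ℝ)) (b := 0)).exists_bound_of_continuousOn
    hcont.continuousOn
  refine ⟨max M1 M2, fun x => ?_⟩
  rcases lt_trichotomy x 0 with hx | hx | hx
  · by_cases hx1 : -1 ≤ x
    · exact (hM2 x ⟨hx1, hx.le⟩).trans (le_max_right _ _)
    · have : D =ᶠ[𝓝 x] fun _ => 0 := by
        filter_upwards [gt_mem_nhds (not_le.1 hx1)] with y hy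
        simp only [D]
        rw [Real.smoothTransition.zero_of_nonpos (by linarith), mul_zero]
      rw [this.iteratedDeriv_eq]
      have h0 := (abs_nonneg _).trans (hM1 0 le_rfl)
      simpa using Or.inl h0
  · exact (hM2 x ⟨by linarith, hx.le⟩).trans (le_max_right _ _)
  · have : D =ᶠ[𝓝 x] C := by
      filter_upwards [lt_mem_nhds hx] with y hy using hDC y hy.le
    rw [this.iteratedDeriv_eq]
    exact (hM1 x hx.le).trans (le_max_left _ _)

end CosSqrt

section EvenOdd

open MeasureTheory

theorem bounded_iteratedFDeriv_comp_clm {E F G : Type*} [NormedAddCommGroup E] [NormedSpace ℝ E]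
    [NormedAddCommGroup F] [NormedSpace ℝ F] [NormedAddCommGroup G] [NormedSpace ℝ G]
    {f : F → G} (hf : ContDiff ℝ ∞ f)
    (hb : ∀ k : ℕ, ∃ C : ℝ, ∀ x, ‖iteratedFDeriv ℝ k f x‖ ≤ C) (L : E →L[ℝ] F) (k : ℕ) :
    ∃ C : ℝ, ∀ x, ‖iteratedFDeriv ℝ k (fun x => f (L x)) x‖ ≤ C := by
  obtain ⟨C, hC⟩ := hb k
  refine ⟨C * ∏ _i : Fin k, ‖L‖, fun x => ?_⟩
  have := L.iteratedFDeriv_comp_right (f := f) hf x (i := k) (by exact_mod_cast le_top)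
  rw [show (fun x => f (L x)) = f ∘ L from rfl, this]
  refine (ContinuousMultilinearMap.norm_compContinuousLinearMap_le _ _).trans ?_
  gcongr
  exact hC _

theorem bounded_iteratedFDeriv_smul {E : Type*} [NormedAddCommGroup E] [NormedSpace ℝ E]
    {f : E → ℝ} {g : E → ℂ} (hf : ContDiff ℝ ∞ f) (hg : ContDiff ℝ ∞ g)
    (hfb : ∀ k : ℕ, ∃ C : ℝ, ∀ x, ‖iteratedFDeriv ℝ k f x‖ ≤ C)
    (hgb : ∀ k : ℕ, ∃ C : ℝ, ∀ x, ‖iteratedFDeriv ℝ k g x‖ ≤ C) (k : ℕ) :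
    ∃ C : ℝ, ∀ x, ‖iteratedFDeriv ℝ k (fun x => f x • g x) x‖ ≤ C := by
  choose Cf hCf using hfb
  choose Cg hCg using hgb
  refine ⟨∑ i ∈ Finset.range (k + 1), (k.choose i : ℝ) * Cf i * Cg (k - i), fun x => ?_⟩
  refine (norm_iteratedFDeriv_smul_le hf hg x (n := k) (by exact_mod_cast le_top)).trans ?_
  have h0 : ∀ i, 0 ≤ Cf i := fun i => (norm_nonneg _).trans (hCf i x)
  gcongr with i hi
  · exact mul_nonneg (by positivity) (h0 i)
  · exact hCf i x
  · exact hCg _ x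

theorem bounded_iteratedFDeriv_cexp (k : ℕ) :
    ∃ C : ℝ, ∀ x, ‖iteratedFDeriv ℝ k (fun x : ℝ => Complex.exp (x * Complex.I)) x‖ ≤ C := by
  refine ⟨1, fun x => ?_⟩
  rw [norm_iteratedFDeriv_eq_norm_iteratedDeriv]
  have h : ∀ k : ℕ, iteratedDeriv k (fun x : ℝ => Complex.exp (x * Complex.I)) =
      fun x : ℝ => Complex.I ^ k * Complex.exp (x * Complex.I) := by
    intro k
    induction k with
    | zero => simp
    | succ k ih =>
      rw [iteratedDeriv_succ, ih]
      funext x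
      have h1 : HasDerivAt (fun x : ℝ => (x : ℂ) * Complex.I) (1 * Complex.I) x :=
        (Complex.ofRealCLM.hasDerivAt (x := x)).mul_const _
      have h2 := (h1.cexp).const_mul (Complex.I ^ k)
      rw [h2.deriv]
      ring
  rw [h]
  simp [Complex.norm_exp_ofReal_mul_I]

theorem bounded_iteratedFDeriv_smul_cexp {C : ℝ → ℝ} (hC : ContDiff ℝ ∞ C)
    (hb : ∀ k : ℕ, ∃ M : ℝ, ∀ x, |iteratedDeriv k C x| ≤ M) (k : ℕ) :
    ∃ M : ℝ, ∀ x : ℝ × ℝ,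
      ‖iteratedFDeriv ℝ k (fun p : ℝ × ℝ => C p.1 • Complex.exp (p.2 * Complex.I)) x‖ ≤ M := by
  have h1 : ContDiff ℝ ∞ fun x : ℝ => Complex.exp (x * Complex.I) :=
    (Complex.ofRealCLM.contDiff.mul contDiff_const).cexp
  refine bounded_iteratedFDeriv_smul (hC.comp contDiff_fst) (h1.comp contDiff_snd) ?_ ?_ k
  · refine bounded_iteratedFDeriv_comp_clm hC (fun k => ?_) (ContinuousLinearMap.fst ℝ ℝ ℝ)
    obtain ⟨M, hM⟩ := hb k
    exact ⟨M, fun x => by rw [norm_iteratedFDeriv_eq_norm_iteratedDeriv]; exact hM x⟩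
  · exact bounded_iteratedFDeriv_comp_clm h1 bounded_iteratedFDeriv_cexp
      (ContinuousLinearMap.snd ℝ ℝ ℝ)

theorem integrable_of_le_schwartz {V : Type} [NormedAddCommGroup V] [InnerProductSpace ℝ V]
    [FiniteDimensional ℝ V] [MeasurableSpace V] [BorelSpace V] (f : SchwartzMap V ℂ)
    {D : V → ℝ} (hD : Continuous D) (hD0 : ∀ ξ, 0 ≤ D ξ) {K : ℝ} {m : ℕ}
    (hb : ∀ ξ, D ξ ≤ K * (1 + ‖ξ‖) ^ m * ‖f ξ‖) : Integrable D := by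
  have h0 := f.integrable_pow_mul volume 0
  have h1 := f.integrable_pow_mul volume m
  refine ((h0.add h1).const_mul (|K| * 2 ^ (m - 1))).mono' hD.aestronglyMeasurable
    (Eventually.of_forall fun ξ => ?_)
  rw [Real.norm_of_nonneg (hD0 ξ)]
  refine (hb ξ).trans ?_
  have h2 : (1 + ‖ξ‖) ^ m ≤ 2 ^ (m - 1) * (1 ^ m + ‖ξ‖ ^ m) :=
    add_pow_le zero_le_one (norm_nonneg _) m
  calc K * (1 + ‖ξ‖) ^ m * ‖f ξ‖ ≤ |K| * (2 ^ (m - 1) * (1 ^ m + ‖ξ‖ ^ m)) * ‖f ξ‖ := by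
        gcongr
        exact le_abs_self K
    _ = _ := by
        simp only [Pi.add_apply]
        ring

/-- Every compactly supported smooth function is of the form `u₀ + t u₁`, where `u₀` and `u₁`
depend smoothly on the square of the coordinate `t` and on the remaining coordinates. -/
theorem exists_even_odd_decomp {Y : Type} [NormedAddCommGroup Y] [NormedSpace ℝ Y]
    [FiniteDimensional ℝ Y] {E : ℝ × Y → ℝ} (hE : ContDiff ℝ ∞ E) (hEc : HasCompactSupport E) :
    ∃ E₀ E₁ : ℝ × Y → ℝ, ContDiff ℝ ∞ E₀ ∧ ContDiff ℝ ∞ E₁ ∧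
      ∀ t y, E (t, y) = E₀ (t ^ 2, y) + t * E₁ (t ^ 2, y) := by
  obtain ⟨C, hC, hcos, hCb⟩ := exists_bounded_cos_sq
  have hS : ContDiff ℝ ∞ fun x => -(2 * deriv C x) :=
    (contDiff_const.mul (contDiff_infty_iff_deriv.1 hC).2).neg
  have hSb : ∀ k : ℕ, ∃ M : ℝ, ∀ x, |iteratedDeriv k (fun x => -(2 * deriv C x)) x| ≤ M := by
    intro k
    obtain ⟨M, hM⟩ := hCb (k + 1)
    refine ⟨2 * M, fun x => ?_⟩
    have h1 : iteratedDeriv k (fun x => -(2 * deriv C x)) x =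
        -2 * iteratedDeriv (k + 1) C x := by
      rw [iteratedDeriv_succ']
      have := iteratedDeriv_const_mul_field (𝕜 := ℝ) (n := k) (-2) (deriv C) (x := x)
      rw [← this]
      congr 1
      funext z
      ring
    rw [h1, abs_mul]
    have := hM x
    norm_num
    linarith
  let Λ : (ℝ × Y) ≃L[ℝ] EuclideanSpace ℝ (Fin (Module.finrank ℝ (ℝ × Y))) := toEuclidean
  set V := EuclideanSpace ℝ (Fin (Module.finrank ℝ (ℝ × Y))) with hV
  let F : V → ℂ := fun x => (E (Λ.symm x) : ℂ)
  have hF : ContDiff ℝ ∞ F := Complex.ofRealCLM.contDiff.comp (hE.comp Λ.symm.contDiff)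
  have hFc : HasCompactSupport F :=
    (hEc.comp_homeomorph Λ.symm.toHomeomorph).comp_left (g := fun x : ℝ => (x : ℂ)) (by simp)
  let fS : SchwartzMap V ℂ := hFc.toSchwartzMap hF
  let fh : SchwartzMap V ℂ := FourierTransform.fourier fS
  have hinv : ∀ x : V, (F x) =
      ∫ v : V, Complex.exp (↑(2 * Real.pi * inner ℝ v x) * Complex.I) • fh v := by
    intro x
    rw [← Real.fourierInv_eq', ← SchwartzMap.fourierInv_coe, FourierTransform.fourierInv_fourier_eq]
    rfl
  let a : V →L[ℝ] ℝ := (2 * Real.pi) • innerSL ℝ (Λ (1, 0))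
  let Q : V →L[ℝ] (ℝ × Y →L[ℝ] ℝ × ℝ) :=
    (ContinuousLinearMap.compL ℝ (ℝ × Y) ℝ (ℝ × ℝ) (ContinuousLinearMap.inr ℝ ℝ ℝ)).comp
      (((ContinuousLinearMap.compL ℝ (ℝ × Y) V ℝ).flip ((Λ : (ℝ × Y) →L[ℝ] V).comp
        ((ContinuousLinearMap.inr ℝ ℝ Y).comp (ContinuousLinearMap.snd ℝ ℝ Y)))).comp
        ((2 * Real.pi) • innerSL ℝ))
  let P : ℝ × Y →L[ℝ] ℝ × ℝ :=
    (ContinuousLinearMap.inl ℝ ℝ ℝ).comp (ContinuousLinearMap.fst ℝ ℝ Y)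
  let A : V → (ℝ × Y →L[ℝ] ℝ × ℝ) := fun ξ => (a ξ) ^ 2 • P + Q ξ
  have hAapp : ∀ ξ s y, A ξ (s, y) = ((a ξ) ^ 2 * s, 2 * Real.pi * inner ℝ ξ (Λ (0, y))) := by
    intro ξ s y
    simp [A, P, Q]
  have hAc : Continuous A := by fun_prop
  obtain ⟨K, hK0, hK⟩ : ∃ K : ℝ, 0 ≤ K ∧ ∀ ξ, ‖A ξ‖ ≤ K * (1 + ‖ξ‖) ^ 2 := by
    refine ⟨‖a‖ ^ 2 * ‖P‖ + ‖Q‖, by positivity, fun ξ => ?_⟩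
    calc ‖A ξ‖ ≤ ‖(a ξ) ^ 2 • P‖ + ‖Q ξ‖ := norm_add_le _ _
      _ ≤ (‖a‖ * ‖ξ‖) ^ 2 * ‖P‖ + ‖Q‖ * ‖ξ‖ := by
          rw [norm_smul, norm_pow]
          gcongr
          · exact a.le_opNorm ξ
          · exact Q.le_opNorm ξ
      _ = ‖a‖ ^ 2 * ‖P‖ * ‖ξ‖ ^ 2 + ‖Q‖ * ‖ξ‖ := by ring
      _ ≤ ‖a‖ ^ 2 * ‖P‖ * (1 + ‖ξ‖) ^ 2 + ‖Q‖ * (1 + ‖ξ‖) ^ 2 := by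
          have := norm_nonneg ξ
          gcongr
          · linarith
          · nlinarith
      _ = _ := by ring
  let B : (V → ℂ) → V → (ℂ →L[ℝ] ℝ) := fun w ξ =>
    Complex.reCLM.comp (ContinuousLinearMap.mul ℝ ℂ (w ξ))
  have hBn : ∀ w ξ, ‖B w ξ‖ ≤ ‖w ξ‖ := by
    intro w ξ
    refine (ContinuousLinearMap.opNorm_comp_le _ _).trans ?_
    simp [Complex.reCLM_norm]
  have hBc : ∀ w : V → ℂ, Continuous w → Continuous (B w) := fun w hw => by
    simp only [B]
    fun_prop
  have main : ∀ (w : V → ℂ), Continuous w → (∃ L : ℝ, ∀ ξ, ‖w ξ‖ ≤ L * (1 + ‖ξ‖) ^ 1 * ‖fh ξ‖) →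
      ∀ c : ℝ → ℝ, ContDiff ℝ ∞ c → (∀ k : ℕ, ∃ M : ℝ, ∀ x, |iteratedDeriv k c x| ≤ M) →
      ContDiff ℝ ∞ (fun x => ∫ ξ, B w ξ (c (A ξ x).1 • Complex.exp ((A ξ x).2 * Complex.I))) ∧
      ∀ x, Integrable (fun ξ => B w ξ (c (A ξ x).1 • Complex.exp ((A ξ x).2 * Complex.I))) := by
    rintro w hw ⟨L, hL⟩ c hc hcb
    have hInt : ∀ N : ℕ, Integrable (fun ξ => ‖B w ξ‖ * ‖A ξ‖ ^ N) := by
      intro N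
      refine integrable_of_le_schwartz fh ((hBc w hw).norm.mul (hAc.norm.pow N))
        (fun ξ => by positivity) (K := |L| * K ^ N) (m := 1 + 2 * N) fun ξ => ?_
      calc ‖B w ξ‖ * ‖A ξ‖ ^ N ≤ (|L| * (1 + ‖ξ‖) ^ 1 * ‖fh ξ‖) * (K * (1 + ‖ξ‖) ^ 2) ^ N := by
            gcongr
            · refine (hBn w ξ).trans ((hL ξ).trans ?_)
              gcongr
              exact le_abs_self L
            · exact hK ξ
        _ = _ := by rw [mul_pow, ← pow_mul, pow_add]; ring
    have hH : ContDiff ℝ ∞ fun p : ℝ × ℝ => c p.1 • Complex.exp (p.2 * Complex.I) := by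
      refine (hc.comp contDiff_fst).smul ?_
      exact ((Complex.ofRealCLM.contDiff.comp contDiff_snd).mul contDiff_const).cexp
    constructor
    · rw [contDiff_infty]
      intro n
      exact contDiff_integral_clm_comp hAc.aestronglyMeasurable n
        (hBc w hw).aestronglyMeasurable hInt hH (bounded_iteratedFDeriv_smul_cexp hc hcb)
    · intro x
      obtain ⟨M, hM⟩ := hcb 0
      refine ((hInt 0).mul_const M).mono' (Continuous.aestronglyMeasurable ?_)
        (Eventually.of_forall fun ξ => ?_)
      · have h1 : Continuous fun ξ => A ξ x := by fun_prop
        exact (hBc w hw).clm_apply (hH.continuous.comp h1)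
      · refine ((B w ξ).le_opNorm _).trans ?_
        rw [pow_zero, mul_one, norm_smul, Complex.norm_exp_ofReal_mul_I, mul_one]
        gcongr
        simpa using hM (A ξ x).1
  have hw1 : Continuous fun ξ => ((a ξ : ℝ) : ℂ) * Complex.I * fh ξ := by
    have := fh.continuous
    fun_prop
  obtain ⟨h0, h0i⟩ := main fh fh.continuous ⟨1, fun ξ => by
    have := norm_nonneg (fh ξ)
    have := norm_nonneg ξ
    nlinarith⟩ C hC hCb
  obtain ⟨h1, h1i⟩ := main _ hw1 ⟨‖a‖, fun ξ => by
    rw [norm_mul, norm_mul, Complex.norm_I, mul_one, Complex.norm_real]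
    have h2 := a.le_opNorm ξ
    gcongr
    refine h2.trans ?_
    gcongr
    linarith⟩ _ hS hSb
  refine ⟨_, _, h0, h1, fun t y => ?_⟩
  rw [← integral_const_mul, ← integral_add (h0i _) ((h1i _).const_mul t)]
  have h2 := congrArg Complex.re (hinv (Λ (t, y)))
  have h3 : Integrable fun v : V =>
      Complex.exp (↑(2 * Real.pi * inner ℝ v (Λ (t, y))) * Complex.I) • fh v := by
    refine fh.integrable.norm.mono' (Continuous.aestronglyMeasurable ?_)
      (Eventually.of_forall fun ξ => ?_)
    · have := fh.continuous
      fun_prop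
    · rw [norm_smul, Complex.norm_exp_ofReal_mul_I, one_mul]
  rw [← Complex.reCLM_apply, ← Complex.reCLM_apply, ← Complex.reCLM.integral_comp_comm h3] at h2
  simp only [F, ContinuousLinearEquiv.symm_apply_apply, Complex.reCLM_apply, Complex.ofReal_re] at h2
  rw [h2]
  congr 1
  funext ξ
  have h4 : 2 * Real.pi * inner ℝ ξ (Λ (t, y)) =
      a ξ * t + 2 * Real.pi * inner ℝ ξ (Λ (0, y)) := by
    have h5 : ((t, y) : ℝ × Y) = t • ((1 : ℝ), (0 : Y)) + (0, y) := by simp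
    conv_lhs => rw [h5]
    rw [map_add, map_smul, inner_add_right, real_inner_smul_right]
    simp only [a, smul_apply, innerSL_apply_apply, smul_eq_mul]
    rw [real_inner_comm]
    ring
  have h5 : Complex.exp (↑(a ξ * t) * Complex.I) =
      (C (a ξ ^ 2 * t ^ 2) : ℂ) +
        ((-(2 * deriv C (a ξ ^ 2 * t ^ 2)) : ℝ) : ℂ) * (a ξ * t) * Complex.I := by
    rw [Complex.exp_mul_I, ← Complex.ofReal_cos, ← Complex.ofReal_sin, ← mul_pow, hcos,
      ← deriv_cos_sq hC hcos]
    push_cast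
    ring
  rw [h4, Complex.ofReal_add, add_mul, Complex.exp_add, h5]
  simp only [hAapp, B, ContinuousLinearMap.comp_apply, ContinuousLinearMap.mul_apply',
    Complex.reCLM_apply]
  rw [← Complex.re_ofReal_mul, ← Complex.add_re]
  congr 1
  simp only [Complex.real_smul, smul_eq_mul]
  ring

end EvenOdd

section Nemytskii

variable {K : Type} [TopologicalSpace K] [CompactSpace K]
  {E F : Type} [NormedAddCommGroup E] [NormedSpace ℝ E] [NormedAddCommGroup F] [NormedSpace ℝ F]

/-- Pointwise application, as a continuous bilinear map on spaces of continuous functions. -/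
noncomputable def continuousMapApplyL :
    C(K, E →L[ℝ] F) →L[ℝ] C(K, E) →L[ℝ] C(K, F) :=
  LinearMap.mkContinuous₂
    (LinearMap.mk₂ ℝ (fun (L : C(K, E →L[ℝ] F)) (h : C(K, E)) =>
        (⟨fun t => L t (h t), L.continuous.clm_apply h.continuous⟩ : C(K, F)))
      (fun _ _ _ => by ext; simp) (fun _ _ _ => by ext; simp)
      (fun _ _ _ => by ext; simp) (fun _ _ _ => by ext; simp)) 1
    (fun L h => by
      rw [one_mul]
      refine (ContinuousMap.norm_le _ (by positivity)).2 fun t => ?_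
      exact ((L t).le_opNorm _).trans
        (mul_le_mul (L.norm_coe_le_norm t) (h.norm_coe_le_norm t) (norm_nonneg (h t)) (norm_nonneg L)))

theorem hasFDerivAt_continuousMap_comp {f : E → F} (hf : ContDiff ℝ ∞ f)
    (hc : HasCompactSupport f) (γ : C(K, E)) :
    HasFDerivAt (fun γ : C(K, E) => (⟨f, hf.continuous⟩ : C(E, F)).comp γ)
      (continuousMapApplyL ((⟨fderiv ℝ f, hf.continuous_fderiv (by simp)⟩ :
        C(E, E →L[ℝ] F)).comp γ)) γ := by
  have huc : UniformContinuous (fderiv ℝ f) :=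
    (hc.fderiv ℝ).uniformContinuous_of_continuous (hf.continuous_fderiv (by simp))
  rw [hasFDerivAt_iff_isLittleO_nhds_zero, Asymptotics.isLittleO_iff]
  intro ε hε
  obtain ⟨δ, hδ, hδ'⟩ := Metric.uniformContinuous_iff.1 huc ε hε
  filter_upwards [Metric.ball_mem_nhds (0 : C(K, E)) hδ] with h hh
  refine (ContinuousMap.norm_le _ (by positivity)).2 fun t => ?_
  have h1 : ‖h t‖ < δ := (h.norm_coe_le_norm t).trans_lt (by simpa using hh)
  have h2 := (convex_ball (γ t) δ).norm_image_sub_le_of_norm_fderiv_le' (𝕜 := ℝ) (f := f)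
    (φ := fderiv ℝ f (γ t)) (C := ε) (x := γ t) (y := γ t + h t)
    (fun x _ => (hf.differentiable (by simp)).differentiableAt)
    (fun x hx => by
      rw [← dist_eq_norm]
      exact (hδ' hx).le)
    (Metric.mem_ball_self hδ) (by simpa using h1)
  rw [add_sub_cancel_left] at h2
  refine le_trans (le_of_eq ?_) (h2.trans (by gcongr; exact h.norm_coe_le_norm t))
  rfl

/-- Composition with a smooth compactly supported function is a smooth operator on the space of
continuous functions. -/
theorem contDiff_continuousMap_comp (n : ℕ) : ∀ {F : Type} [NormedAddCommGroup F]
    [NormedSpace ℝ F] {f : E → F} (hf : ContDiff ℝ ∞ f) (_ : HasCompactSupport f),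
    ContDiff ℝ n (fun γ : C(K, E) => (⟨f, hf.continuous⟩ : C(E, F)).comp γ) := by
  induction n with
  | zero =>
    intro F _ _ f hf hc
    exact contDiff_zero.2 (continuous_iff_continuousAt.2 fun γ =>
      (hasFDerivAt_continuousMap_comp hf hc γ).continuousAt)
  | succ n ih =>
    intro F _ _ f hf hc
    rw [Nat.cast_add, Nat.cast_one, contDiff_succ_iff_fderiv]
    refine ⟨fun γ => (hasFDerivAt_continuousMap_comp hf hc γ).differentiableAt, by simp, ?_⟩
    rw [show fderiv ℝ (fun γ : C(K, E) => (⟨f, hf.continuous⟩ : C(E, F)).comp γ) = _ from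
      funext fun γ => (hasFDerivAt_continuousMap_comp hf hc γ).fderiv]
    exact continuousMapApplyL.contDiff.comp (ih (hf.fderiv_right (by simp)) (hc.fderiv ℝ))

end Nemytskii

section Flow

variable {E : Type} [NormedAddCommGroup E] [NormedSpace ℝ E]

theorem intervalIntegrable_projIcc (γ : C(Set.Icc (0 : ℝ) 1, E)) (a b : ℝ) :
    IntervalIntegrable (fun s => γ (Set.projIcc 0 1 zero_le_one s)) MeasureTheory.volume a b :=
  (γ.continuous.comp continuous_projIcc).intervalIntegrable a b

/-- Integration from `0` as a continuous linear operator on the space of continuous paths. -/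
noncomputable def pathIntegralL : C(Set.Icc (0 : ℝ) 1, E) →L[ℝ] C(Set.Icc (0 : ℝ) 1, E) :=
  LinearMap.mkContinuous
    { toFun := fun γ => ⟨fun t => ∫ s in (0 : ℝ)..t, γ (Set.projIcc 0 1 zero_le_one s),
        (intervalIntegral.continuous_primitive
          (fun a b => intervalIntegrable_projIcc γ a b) 0).comp continuous_subtype_val⟩
      map_add' := fun γ₁ γ₂ => by
        ext t
        exact intervalIntegral.integral_add (intervalIntegrable_projIcc γ₁ _ _)
          (intervalIntegrable_projIcc γ₂ _ _)
      map_smul' := fun c γ => by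
        ext t
        exact intervalIntegral.integral_smul c _ } 1
    (fun γ => by
      rw [one_mul]
      refine (ContinuousMap.norm_le _ (norm_nonneg _)).2 fun t => ?_
      refine (intervalIntegral.norm_integral_le_of_norm_le_const (C := ‖γ‖)
        (fun s _ => γ.norm_coe_le_norm _)).trans ?_
      have h1 : |(t : ℝ) - 0| ≤ 1 := by
        rw [sub_zero, abs_of_nonneg t.2.1]
        exact t.2.2
      exact mul_le_of_le_one_right (norm_nonneg _) h1)

/-- Constant paths, as a continuous linear map. -/
noncomputable def constPathL : E →L[ℝ] C(Set.Icc (0 : ℝ) 1, E) :=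
  LinearMap.mkContinuous
    { toFun := fun x => ContinuousMap.const _ x
      map_add' := fun _ _ => rfl
      map_smul' := fun _ _ => rfl } 1
    (fun x => by
      rw [one_mul]
      exact (ContinuousMap.norm_le _ (norm_nonneg _)).2 fun t => le_rfl)

/-- Solutions of the integral equation of an autonomous differential equation depend smoothly on
the initial condition and on a time rescaling. -/
theorem exists_integralEquation_solution [CompleteSpace E] {X : E → E} (hX : ContDiff ℝ ∞ X)
    (hXc : HasCompactSupport X) :
    ∃ Γ : ℝ × E → C(Set.Icc (0 : ℝ) 1, E), SmoothNear Γ 0 ∧ Γ 0 = 0 ∧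
      (∀ᶠ p in 𝓝 (0 : ℝ × E), Γ p = p.1 • pathIntegralL
        ((⟨X, hX.continuous⟩ : C(E, E)).comp (constPathL p.2 + Γ p))) ∧
      ∃ ε > 0, ∀ (p : ℝ × E) (γ : C(Set.Icc (0 : ℝ) 1, E)), ‖p‖ < ε → ‖γ‖ < ε →
        γ = p.1 • pathIntegralL ((⟨X, hX.continuous⟩ : C(E, E)).comp (constPathL p.2 + γ)) →
        γ = Γ p := by
  set K := Set.Icc (0 : ℝ) 1
  let N : C(K, E) → C(K, E) := fun γ => (⟨X, hX.continuous⟩ : C(E, E)).comp γ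
  have hN : ContDiff ℝ ∞ N := contDiff_infty.2 fun n => contDiff_continuousMap_comp n hX hXc
  let G : (ℝ × E) × C(K, E) → C(K, E) := fun z => pathIntegralL (N (constPathL z.1.2 + z.2))
  have hG : ContDiff ℝ ∞ G := by
    have h1 : ContDiff ℝ ∞ fun z : (ℝ × E) × C(K, E) => constPathL (E := E) z.1.2 + z.2 :=
      ContDiff.add ((constPathL (E := E)).contDiff.comp (contDiff_snd.comp contDiff_fst))
        contDiff_snd
    exact pathIntegralL.contDiff.comp (hN.comp h1)
  let Ψ : (ℝ × E) × C(K, E) → (ℝ × E) × C(K, E) := fun z => (z.1, z.2 - z.1.1 • G z)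
  have hΨ : ContDiff ℝ ∞ Ψ := by
    have h1 : ContDiff ℝ ∞ fun z : (ℝ × E) × C(K, E) => z.1.1 :=
      contDiff_fst.comp contDiff_fst
    have h2 : ContDiff ℝ ∞ fun z : (ℝ × E) × C(K, E) => z.1.1 • G z := h1.smul hG
    exact contDiff_fst.prodMk (contDiff_snd.sub h2)
  let w := G 0
  let τ : (ℝ × E) × C(K, E) →L[ℝ] C(K, E) :=
    ((ContinuousLinearMap.fst ℝ ℝ E).comp (ContinuousLinearMap.fst ℝ (ℝ × E) C(K, E))).smulRight w
  let L₁ := (ContinuousLinearMap.fst ℝ (ℝ × E) C(K, E)).prod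
    (ContinuousLinearMap.snd ℝ (ℝ × E) C(K, E) - τ)
  let L₂ := (ContinuousLinearMap.fst ℝ (ℝ × E) C(K, E)).prod
    (ContinuousLinearMap.snd ℝ (ℝ × E) C(K, E) + τ)
  let L : ((ℝ × E) × C(K, E)) ≃L[ℝ] ((ℝ × E) × C(K, E)) :=
    ContinuousLinearEquiv.equivOfInverse L₁ L₂ (fun z => by simp [L₁, L₂, τ])
      (fun z => by simp [L₁, L₂, τ])
  have hd : fderiv ℝ Ψ 0 = L := by
    have h1 : HasFDerivAt (fun z : (ℝ × E) × C(K, E) => z.1.1)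
        ((ContinuousLinearMap.fst ℝ ℝ E).comp (ContinuousLinearMap.fst ℝ (ℝ × E) C(K, E))) 0 :=
      ((ContinuousLinearMap.fst ℝ ℝ E).comp
        (ContinuousLinearMap.fst ℝ (ℝ × E) C(K, E))).hasFDerivAt
    have h2 : HasFDerivAt G (fderiv ℝ G 0) 0 :=
      (hG.differentiable (by simp)).differentiableAt.hasFDerivAt
    have h3 := (hasFDerivAt_fst (𝕜 := ℝ) (p := (0 : (ℝ × E) × C(K, E)))).prodMk
      ((hasFDerivAt_snd (𝕜 := ℝ) (p := (0 : (ℝ × E) × C(K, E)))).sub (h1.smul h2))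
    rw [show fderiv ℝ Ψ 0 = _ from h3.fderiv]
    ext z <;> simp [L, L₁, τ, w]
  have hΨ0 : Ψ 0 = 0 := by simp [Ψ]
  obtain ⟨g, hg, hg0, hg1, hg2, -⟩ := (hΨ.smoothNear 0).exists_localInverse L hd
  rw [hΨ0] at hg hg0 hg1
  let ι : ℝ × E → (ℝ × E) × C(K, E) := fun p => (p, 0)
  have hι : ContDiff ℝ ∞ ι := by fun_prop
  have hι0 : ι 0 = 0 := rfl
  refine ⟨fun p => (g (ι p)).2, ?_, ?_, ?_, ?_⟩
  · exact ((contDiff_snd (𝕜 := ℝ) (E := ℝ × E) (F := C(K, E)) (n := ∞)).smoothNear _).comp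
      (SmoothNear.comp (by rw [hι0]; exact hg) (hι.smoothNear 0))
  · simp only [hι0, hg0]
    rfl
  · have h1 : Tendsto ι (𝓝 0) (𝓝 0) := hι0 ▸ hι.continuous.continuousAt
    filter_upwards [h1.eventually hg1] with p hp
    have h2 : (g (ι p)).1 = p := congrArg Prod.fst hp
    have h3 : (g (ι p)).2 - (g (ι p)).1.1 • G (g (ι p)) = 0 := congrArg Prod.snd hp
    rw [h2, sub_eq_zero] at h3
    have h4 : G (g (ι p)) = pathIntegralL (N (constPathL p.2 + (g (ι p)).2)) := by
      simp only [G, h2]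
    rw [h4] at h3
    exact h3
  · obtain ⟨ε, hε, hε'⟩ := Metric.eventually_nhds_iff_ball.1 hg2
    refine ⟨ε, hε, fun p γ hp hγ h => ?_⟩
    have h1 := hε' (p, γ) (by
      rw [mem_ball_zero_iff, Prod.norm_mk]
      exact max_lt hp hγ)
    have h2 : Ψ (p, γ) = ι p := by
      refine Prod.ext rfl ?_
      exact sub_eq_zero.2 h
    rw [h2] at h1
    change γ = (g (ι p)).2
    rw [h1]

/-- A smooth vector field has a smooth local flow. -/
theorem exists_flow [FiniteDimensional ℝ E] {X : E → E} (hX : SmoothNear X 0) :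
    ∃ φ : ℝ × E → E, SmoothNear φ 0 ∧ (∀ᶠ x in 𝓝 (0 : E), φ (0, x) = x) ∧
      ∀ᶠ p in 𝓝 (0 : ℝ × E), fderiv ℝ φ p (1, 0) = X (φ p) := by
  have : CompleteSpace E := FiniteDimensional.complete ℝ E
  obtain ⟨X', hX', hXc, hXX⟩ := hX.exists_contDiff
  obtain ⟨Γ, hΓ, hΓ0, heq, ε, hε, huniq⟩ := exists_integralEquation_solution hX' hXc
  let one : Set.Icc (0 : ℝ) 1 := ⟨1, by simp⟩
  let φ : ℝ × E → E := fun p => p.2 + Γ p one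
  have hφ : SmoothNear φ 0 :=
    (contDiff_snd.smoothNear _).add
      (((ContinuousMap.evalCLM ℝ one).contDiff.smoothNear _).comp hΓ)
  have hφ0 : φ 0 = 0 := by simp [φ, hΓ0]
  have hsmall : ∀ᶠ p in 𝓝 (0 : ℝ × E), ‖p‖ < ε ∧ ‖Γ p‖ < ε := by
    have h1 : ∀ᶠ p in 𝓝 (0 : ℝ × E), ‖p‖ < ε := by
      filter_upwards [Metric.ball_mem_nhds (0 : ℝ × E) hε] with p hp
      simpa using hp
    have h2 : ∀ᶠ γ in 𝓝 (Γ 0), ‖γ‖ < ε := by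
      rw [hΓ0]
      filter_upwards [Metric.ball_mem_nhds (0 : C(Set.Icc (0 : ℝ) 1, E)) hε] with p hp
      simpa using hp
    exact h1.and (hΓ.continuousAt.eventually h2)
  have hne : ∀ᶠ p in 𝓝 (0 : ℝ × E), p.1 ≠ 0 → fderiv ℝ φ p (1, 0) = X' (φ p) := by
    filter_upwards [hφ, heq, hsmall] with p hp1 hp2 ⟨hp3, hp4⟩ hp0
    obtain ⟨τ, x⟩ := p
    simp only at hp0 hp2
    set γ := Γ (τ, x) with hγ
    let c : ℝ → E := fun s => X' (x + γ (Set.projIcc 0 1 zero_le_one s))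
    have hcc : Continuous c := by
      have := hX'.continuous
      have := γ.continuous
      have := continuous_projIcc (a := (0 : ℝ)) (b := 1) (h := zero_le_one)
      fun_prop
    have hγr : ∀ r : Set.Icc (0 : ℝ) 1, γ r = τ • ∫ s in (0 : ℝ)..r, c s := fun r => by
      conv_lhs => rw [hp2]
      rfl
    have hresc : ∀ s₀ ∈ Set.Icc (0 : ℝ) 1, φ (s₀ * τ, x) = x + τ • ∫ s in (0 : ℝ)..s₀, c s := by
      intro s₀ hs₀
      let ρ : C(Set.Icc (0 : ℝ) 1, Set.Icc (0 : ℝ) 1) :=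
        ⟨fun r => ⟨s₀ * r, mul_nonneg hs₀.1 r.2.1, mul_le_one₀ hs₀.2 r.2.1 r.2.2⟩, by fun_prop⟩
      have h1 : γ.comp ρ = Γ (s₀ * τ, x) := by
        refine huniq _ _ ?_ ?_ ?_
        · refine lt_of_le_of_lt ?_ hp3
          rw [Prod.norm_mk, Prod.norm_mk]
          gcongr
          rw [norm_mul]
          refine mul_le_of_le_one_left (norm_nonneg _) ?_
          rw [Real.norm_of_nonneg hs₀.1]
          exact hs₀.2
        · refine lt_of_le_of_lt ?_ hp4
          exact (ContinuousMap.norm_le _ (norm_nonneg _)).2 fun t => γ.norm_coe_le_norm _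
        · ext r
          have h2 : (γ.comp ρ) r = τ • ∫ s in (0 : ℝ)..(s₀ * r), c s := hγr (ρ r)
          have h3 : ∀ s ∈ Set.uIcc (0 : ℝ) r, c (s₀ * s) =
              X' (x + (γ.comp ρ) (Set.projIcc 0 1 zero_le_one s)) := by
            intro s hs
            rw [Set.uIcc_of_le r.2.1] at hs
            have hs' : s ∈ Set.Icc (0 : ℝ) 1 := ⟨hs.1, hs.2.trans r.2.2⟩
            simp only [c, ContinuousMap.comp_apply]
            have h4 : Set.projIcc (0 : ℝ) 1 zero_le_one (s₀ * s) = ρ ⟨s, hs'⟩ :=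
              Set.projIcc_of_mem zero_le_one (ρ ⟨s, hs'⟩).2
            rw [Set.projIcc_of_mem _ hs', h4]
          rw [h2]
          change _ = (s₀ * τ) • ∫ s in (0 : ℝ)..r,
            X' (x + (γ.comp ρ) (Set.projIcc 0 1 zero_le_one s))
          rw [← intervalIntegral.integral_congr h3, mul_comm s₀ τ, mul_smul,
            intervalIntegral.smul_integral_comp_mul_left]
          simp
      simp only [φ]
      rw [← h1]
      change x + γ (ρ one) = _
      rw [hγr]
      simp [ρ, one]
    have h1 : HasDerivAt (fun s₀ : ℝ => φ (s₀ * τ, x)) (fderiv ℝ φ (τ, x) (τ, 0)) 1 := by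
      have h2 : HasDerivAt (fun s₀ : ℝ => ((s₀ * τ, x) : ℝ × E)) (1 * τ, 0) 1 :=
        ((hasDerivAt_id (1 : ℝ)).mul_const τ).prodMk (hasDerivAt_const _ _)
      have h3 : HasFDerivAt φ (fderiv ℝ φ (τ, x)) ((1 : ℝ) * τ, x) := by
        rw [one_mul]
        exact (hp1.differentiableAt (by simp)).hasFDerivAt
      have h4 := h3.comp_hasDerivAt (1 : ℝ) h2
      rw [one_mul] at h4
      exact h4
    have h2 : HasDerivAt (fun s₀ : ℝ => x + τ • ∫ s in (0 : ℝ)..s₀, c s) (τ • c 1) 1 := by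
      have h3 := intervalIntegral.integral_hasDerivAt_right (hcc.intervalIntegrable 0 1)
        hcc.aestronglyMeasurable.stronglyMeasurableAtFilter hcc.continuousAt
      exact (h3.const_smul τ).const_add x
    have h3 : HasDerivWithinAt (fun s₀ : ℝ => φ (s₀ * τ, x)) (τ • c 1) (Set.Icc 0 1) 1 :=
      h2.hasDerivWithinAt.congr hresc (hresc 1 (by simp))
    have h4 := (uniqueDiffOn_Icc (zero_lt_one' ℝ) 1 (by simp)).eq_deriv _ h1.hasDerivWithinAt h3
    have h5 : ((τ, 0) : ℝ × E) = τ • ((1 : ℝ), (0 : E)) := by simp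
    rw [h5, map_smul] at h4
    have h6 := smul_right_injective E hp0 h4
    rw [h6]
    simp only [c, φ]
    rw [Set.projIcc_of_mem zero_le_one one.2]
  refine ⟨φ, hφ, ?_, ?_⟩
  · have h1 : Tendsto (fun x : E => ((0 : ℝ), x)) (𝓝 0) (𝓝 0) :=
      (continuous_const.prodMk continuous_id).continuousAt
    filter_upwards [h1.eventually hsmall] with x ⟨hx1, hx2⟩
    have := huniq (0, x) 0 hx1 (by simpa using hε) (by simp)
    simp [φ, ← this]
  · have h1 : ∀ᶠ p in 𝓝 (0 : ℝ × E), X' (φ p) = X (φ p) := by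
      have : ∀ᶠ y in 𝓝 (φ 0), X' y = X y := by
        rw [hφ0]
        exact hXX
      exact hφ.continuousAt.eventually this
    have h2 : SmoothNear (fun p => fderiv ℝ φ p (1, 0)) 0 :=
      hφ.fderiv_right.clm_apply (contDiff_const.smoothNear _)
    filter_upwards [h1, hφ, h2, eventually_eventually_nhds.2 hne] with p hp1 hp2 hp3 hp4
    rw [← hp1]
    by_cases hp0 : p.1 = 0
    · obtain ⟨τ, x⟩ := p
      simp only at hp0
      subst hp0
      have hcurve : Tendsto (fun t : ℝ => (t, x)) (𝓝 0) (𝓝 (0, x)) :=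
        (continuous_id.prodMk continuous_const).continuousAt
      have h3 : Tendsto (fun t : ℝ => fderiv ℝ φ (t, x) (1, 0)) (𝓝[≠] 0)
          (𝓝 (fderiv ℝ φ (0, x) (1, 0))) :=
        (hp3.continuousAt.tendsto.comp hcurve).mono_left nhdsWithin_le_nhds
      have h4 : Tendsto (fun t : ℝ => X' (φ (t, x))) (𝓝[≠] 0) (𝓝 (X' (φ (0, x)))) :=
        ((hX'.continuous.continuousAt.comp hp2.continuousAt).tendsto.comp hcurve).mono_left
          nhdsWithin_le_nhds
      refine tendsto_nhds_unique_of_eventuallyEq h3 h4 ?_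
      filter_upwards [(hcurve.eventually hp4).filter_mono nhdsWithin_le_nhds,
        self_mem_nhdsWithin] with t ht ht0
      exact ht ht0
    · exact hp4.self_of_nhds hp0

end Flow

section Hadamard

variable {Y : Type} [NormedAddCommGroup Y] [NormedSpace ℝ Y]

theorem hasDerivAt_comp_fst {f : ℝ × Y → ℝ} (hf : ContDiff ℝ ∞ f) {g : ℝ → ℝ} {g' s : ℝ}
    (hg : HasDerivAt g g' s) (y : Y) :
    HasDerivAt (fun s => f (g s, y)) (g' * fderiv ℝ f (g s, y) (1, 0)) s := by
  have h1 : HasDerivAt (fun s => (g s, y)) (g', (0 : Y)) s := hg.prodMk (hasDerivAt_const _ _)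
  have h2 := ((hf.differentiable (by simp)).differentiableAt (x := (g s, y))).hasFDerivAt
  have h3 := h2.comp_hasDerivAt s h1
  have h4 : ((g', 0) : ℝ × Y) = g' • ((1 : ℝ), (0 : Y)) := by simp
  rw [h4, map_smul] at h3
  exact h3

variable [FiniteDimensional ℝ Y]

/-- Two-point Hadamard lemma. -/
theorem exists_hadamard {f : ℝ × Y → ℝ} (hf : ContDiff ℝ ∞ f) :
    ∃ e : ℝ × ℝ × Y → ℝ, ContDiff ℝ ∞ e ∧
      (∀ u v y, f (u, y) - f (v, y) = (u - v) * e (u, v, y)) ∧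
      ∀ u y, e (u, u, y) = fderiv ℝ f (u, y) (1, 0) := by
  let A₀ : ℝ × ℝ × Y →L[ℝ] ℝ × Y := ContinuousLinearMap.snd ℝ ℝ (ℝ × Y)
  let A₁ : ℝ × ℝ × Y →L[ℝ] ℝ × Y :=
    (ContinuousLinearMap.inl ℝ ℝ Y).comp (ContinuousLinearMap.fst ℝ ℝ (ℝ × Y) -
      (ContinuousLinearMap.fst ℝ ℝ Y).comp (ContinuousLinearMap.snd ℝ ℝ (ℝ × Y)))
  have hA : Continuous fun s : ℝ => A₀ + s • A₁ := by fun_prop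
  have hAe : ∀ s u v y, (A₀ + s • A₁) (u, v, y) = (v + s * (u - v), y) := fun s u v y => by
    simp [A₀, A₁]
  have hf' : ContDiff ℝ ∞ fun p => fderiv ℝ f p (1, 0) :=
    (hf.fderiv_right (by simp)).clm_apply contDiff_const
  refine ⟨_, contDiff_intervalIntegral_clm_comp hA (continuous_const (y := (1 : ℝ))) hf', ?_, ?_⟩
  · intro u v y
    simp only [hAe, one_smul]
    have h1 : ∀ s ∈ Set.uIcc (0 : ℝ) 1, HasDerivAt (fun s => f (v + s * (u - v), y))
        ((u - v) * fderiv ℝ f (v + s * (u - v), y) (1, 0)) s := fun s _ => by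
      have h2 : HasDerivAt (fun s : ℝ => v + s * (u - v)) (u - v) s := by
        simpa using ((hasDerivAt_id s).mul_const (u - v)).const_add v
      exact hasDerivAt_comp_fst hf h2 y
    rw [← intervalIntegral.integral_const_mul, intervalIntegral.integral_eq_sub_of_hasDerivAt h1]
    · simp
    · have := hf'.continuous
      exact Continuous.intervalIntegrable (by fun_prop) _ _
  · intro u y
    simp only [hAe, one_smul]
    simp

/-- Quadratic divisibility of the primitive of a function vanishing at the base point. -/
theorem exists_integral_mul_sub_eq {f : ℝ × Y → ℝ} (hf : ContDiff ℝ ∞ f) :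
    ∃ p : ℝ × ℝ × Y → ℝ, ContDiff ℝ ∞ p ∧
      ∀ u c y, ∫ s in c..u, f (s, y) * (s - c) = (u - c) ^ 2 * p (u, c, y) := by
  let A₀ : ℝ × ℝ × Y →L[ℝ] ℝ × Y := ContinuousLinearMap.snd ℝ ℝ (ℝ × Y)
  let A₁ : ℝ × ℝ × Y →L[ℝ] ℝ × Y :=
    (ContinuousLinearMap.inl ℝ ℝ Y).comp (ContinuousLinearMap.fst ℝ ℝ (ℝ × Y) -
      (ContinuousLinearMap.fst ℝ ℝ Y).comp (ContinuousLinearMap.snd ℝ ℝ (ℝ × Y)))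
  have hA : Continuous fun s : ℝ => A₀ + s • A₁ := by fun_prop
  have hAe : ∀ s u v y, (A₀ + s • A₁) (u, v, y) = (v + (u - v) * s, y) := fun s u v y => by
    simp [A₀, A₁, mul_comm]
  refine ⟨_, contDiff_intervalIntegral_clm_comp hA continuous_id hf, fun u c y => ?_⟩
  have h1 := intervalIntegral.mul_integral_comp_add_mul (a := 0) (b := 1)
    (f := fun s => f (s, y) * (s - c)) (u - c) c
  simp only [mul_zero, add_zero, mul_one, add_sub_cancel] at h1
  simp only [hAe, smul_eq_mul, id]
  rw [← h1, sq, mul_assoc]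
  congr 1
  rw [← intervalIntegral.integral_const_mul]
  refine intervalIntegral.integral_congr fun s _ => ?_
  ring

/-- The primitive of an even function times `u ^ 2 - c`, modulo the square of `u ^ 2 - c`. -/
theorem exists_integral_even_mul_eq {f : ℝ × Y → ℝ} (hf : ContDiff ℝ ∞ f) :
    ∃ (W : ℝ × Y → ℝ) (d : ℝ × ℝ × Y → ℝ), ContDiff ℝ ∞ W ∧ ContDiff ℝ ∞ d ∧
      (∀ t c y, ∫ s in (0 : ℝ)..t, f (s ^ 2, y) * (s ^ 2 - c) =
        W (c, y) * t * (t ^ 2 - 3 * c) + (t ^ 2 - c) ^ 2 * (t * d (t ^ 2, c, y))) ∧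
      W 0 = f 0 / 3 := by
  obtain ⟨e, he, he1, he2⟩ := exists_hadamard hf
  let B₀ : ℝ × Y →L[ℝ] ℝ × Y :=
    (ContinuousLinearMap.inl ℝ ℝ Y).comp (ContinuousLinearMap.fst ℝ ℝ Y)
  let B₁ : ℝ × Y →L[ℝ] ℝ × Y :=
    (ContinuousLinearMap.inr ℝ ℝ Y).comp (ContinuousLinearMap.snd ℝ ℝ Y)
  have hB : Continuous fun s : ℝ => B₁ + s ^ 2 • B₀ := by fun_prop
  have hBe : ∀ s c y, (B₁ + s ^ 2 • B₀) (c, y) = (s ^ 2 * c, y) := fun s c y => by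
    simp [B₀, B₁]
  let A₀ : ℝ × ℝ × Y →L[ℝ] ℝ × ℝ × Y :=
    (ContinuousLinearMap.inl ℝ ℝ (ℝ × Y)).comp (ContinuousLinearMap.fst ℝ ℝ (ℝ × Y)) +
    (ContinuousLinearMap.inr ℝ ℝ (ℝ × Y)).comp (B₀.comp (ContinuousLinearMap.snd ℝ ℝ (ℝ × Y)))
  let A₁ : ℝ × ℝ × Y →L[ℝ] ℝ × ℝ × Y :=
    (ContinuousLinearMap.inr ℝ ℝ (ℝ × Y)).comp (B₁.comp (ContinuousLinearMap.snd ℝ ℝ (ℝ × Y)))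
  have hA : Continuous fun s : ℝ => A₁ + s ^ 2 • A₀ := by fun_prop
  have hAe : ∀ s u c y, (A₁ + s ^ 2 • A₀) (u, c, y) = (s ^ 2 * u, s ^ 2 * c, y) :=
    fun s u c y => by simp [A₀, A₁, B₀, B₁]
  let W : ℝ × Y → ℝ := fun z => ∫ s in (0 : ℝ)..1, ((1 - s ^ 2) / 2) • f ((B₁ + s ^ 2 • B₀) z)
  have hW : ContDiff ℝ ∞ W := contDiff_intervalIntegral_clm_comp hB (by fun_prop) hf
  let W₂ : ℝ × Y → ℝ := fun z =>
    ∫ s in (0 : ℝ)..1, ((3 * s ^ 2 - 1) / 2) • f ((B₁ + s ^ 2 • B₀) z)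
  have hW₂ : ContDiff ℝ ∞ W₂ := contDiff_intervalIntegral_clm_comp hB (by fun_prop) hf
  let I₂ : ℝ × ℝ × Y → ℝ := fun z => ∫ s in (0 : ℝ)..1, (s ^ 2) • e ((A₁ + s ^ 2 • A₀) z)
  have hI₂ : ContDiff ℝ ∞ I₂ := contDiff_intervalIntegral_clm_comp hA (by fun_prop) he
  let I₄ : ℝ × ℝ × Y → ℝ := fun z => ∫ s in (0 : ℝ)..1, (s ^ 4) • e ((A₁ + s ^ 2 • A₀) z)
  have hI₄ : ContDiff ℝ ∞ I₄ := contDiff_intervalIntegral_clm_comp hA (by fun_prop) he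
  let D : ℝ × ℝ × Y → ℝ := fun z => W₂ z.2 + z.1 * I₄ z - z.2.1 * I₂ z
  have hD : ContDiff ℝ ∞ D := by
    have := hW₂.comp (contDiff_snd (𝕜 := ℝ) (E := ℝ) (F := ℝ × Y))
    exact (this.add (contDiff_fst.mul hI₄)).sub ((contDiff_fst.comp contDiff_snd).mul hI₂)
  have hfc := hf.continuous
  have hec := he.continuous
  have hDi : ∀ u c y, D (u, c, y) = ∫ s in (0 : ℝ)..1, ((3 * s ^ 2 - 1) / 2 * f (s ^ 2 * c, y) +
      s ^ 2 * e (s ^ 2 * u, s ^ 2 * c, y) * (s ^ 2 * u - c)) := by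
    intro u c y
    simp only [D, W₂, I₂, I₄, hAe, hBe, smul_eq_mul]
    rw [← intervalIntegral.integral_const_mul, ← intervalIntegral.integral_const_mul,
      ← intervalIntegral.integral_add, ← intervalIntegral.integral_sub]
    · refine intervalIntegral.integral_congr fun s _ => ?_
      ring
    all_goals exact Continuous.intervalIntegrable (by fun_prop) _ _
  have hD0 : ∀ c y, D (c, c, y) = 0 := by
    intro c y
    have h1 : ∀ s ∈ Set.uIcc (0 : ℝ) 1, HasDerivAt
        (fun s => f (s ^ 2 * c, y) * ((s ^ 3 - s) / 2))
        ((3 * s ^ 2 - 1) / 2 * f (s ^ 2 * c, y) +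
          s ^ 2 * e (s ^ 2 * c, s ^ 2 * c, y) * (s ^ 2 * c - c)) s := fun s _ => by
      have h2 : HasDerivAt (fun s : ℝ => s ^ 2 * c) (2 * s * c) s := by
        simpa using (hasDerivAt_pow 2 s).mul_const c
      have h3 : HasDerivAt (fun s : ℝ => (s ^ 3 - s) / 2) ((3 * s ^ 2 - 1) / 2) s := by
        simpa using ((hasDerivAt_pow 3 s).sub (hasDerivAt_id s)).div_const 2
      refine ((hasDerivAt_comp_fst hf h2 y).mul h3).congr_deriv ?_
      rw [he2]
      ring
    rw [hDi, intervalIntegral.integral_eq_sub_of_hasDerivAt h1]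
    · simp
    · exact Continuous.intervalIntegrable (by fun_prop) _ _
  obtain ⟨d, hd, hd1, -⟩ := exists_hadamard (Y := ℝ × Y) hD
  refine ⟨W, fun z => d (z.1, z.2.1, z.2), hW, ?_, ?_, ?_⟩
  · exact hd.comp (contDiff_fst.prodMk ((contDiff_fst.comp contDiff_snd).prodMk contDiff_snd))
  · intro t c y
    have h1 := hd1 (t ^ 2) c (c, y)
    rw [hD0, sub_zero] at h1
    have h2 := intervalIntegral.mul_integral_comp_mul_left (a := 0) (b := 1)
      (f := fun s => f (s ^ 2, y) * (s ^ 2 - c)) t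
    rw [mul_zero, mul_one] at h2
    have h3 : (t ^ 2 - c) ^ 2 * (t * d (t ^ 2, c, c, y)) =
        t * ((t ^ 2 - c) * D (t ^ 2, c, y)) := by
      rw [h1]
      ring
    have h4 : W (c, y) * t * (t ^ 2 - 3 * c) = t * ((t ^ 2 - 3 * c) * W (c, y)) := by ring
    rw [h3, h4, ← mul_add, ← h2, hDi]
    simp only [W, hBe, smul_eq_mul]
    congr 1
    rw [← intervalIntegral.integral_const_mul, ← intervalIntegral.integral_const_mul,
      ← intervalIntegral.integral_add]
    · refine intervalIntegral.integral_congr fun s _ => ?_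
      have h5 := he1 (s ^ 2 * t ^ 2) (s ^ 2 * c) y
      rw [mul_pow, mul_comm (t ^ 2), sub_eq_iff_eq_add.1 h5]
      ring
    all_goals exact Continuous.intervalIntegrable (by fun_prop) _ _
  · have h1 : ∀ s : ℝ, (B₁ + s ^ 2 • B₀) 0 = 0 := fun s => map_zero _
    have h2 : ∫ s in (0 : ℝ)..1, ((1 - s ^ 2) / 2 : ℝ) = 1 / 3 := by
      rw [intervalIntegral.integral_div, intervalIntegral.integral_sub (by simp) (by simp)]
      norm_num
    simp only [W, h1, smul_eq_mul]
    rw [intervalIntegral.integral_mul_const, h2]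
    ring

end Hadamard

section ImplicitFunction

variable {X : Type} [NormedAddCommGroup X] [NormedSpace ℝ X]

/-- A function with nonzero first partial derivative can be inverted in its first variable. -/
theorem SmoothNear.exists_partialInverse [CompleteSpace X] {F : ℝ × X → ℝ} {x₀ : ℝ × X}
    (hF : SmoothNear F x₀) (hF' : fderiv ℝ F x₀ (1, 0) ≠ 0) :
    ∃ g : ℝ × X → ℝ, SmoothNear g (F x₀, x₀.2) ∧ g (F x₀, x₀.2) = x₀.1 ∧
      (∀ᶠ q in 𝓝 (F x₀, x₀.2), F (g q, q.2) = q.1) ∧ ∀ᶠ p in 𝓝 x₀, g (F p, p.2) = p.1 := by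
  set L := fderiv ℝ F x₀
  set a := L (1, 0)
  have hL : ∀ u v, L (u, v) = u * a + L (0, v) := fun u v => by
    have : ((u, v) : ℝ × X) = u • ((1 : ℝ), (0 : X)) + (0, v) := by simp
    rw [this, map_add, map_smul]
    rfl
  let L₁ : ℝ × X →L[ℝ] ℝ × X := L.prod (ContinuousLinearMap.snd ℝ ℝ X)
  let L₂ : ℝ × X →L[ℝ] ℝ × X :=
    (a⁻¹ • (ContinuousLinearMap.fst ℝ ℝ X - L.comp ((ContinuousLinearMap.inr ℝ ℝ X).comp
      (ContinuousLinearMap.snd ℝ ℝ X)))).prod (ContinuousLinearMap.snd ℝ ℝ X)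
  let e : (ℝ × X) ≃L[ℝ] (ℝ × X) := ContinuousLinearEquiv.equivOfInverse L₁ L₂
    (fun z => by
      obtain ⟨u, v⟩ := z
      simp only [L₁, L₂, ContinuousLinearMap.prod_apply, smul_apply,
        sub_apply, ContinuousLinearMap.comp_apply,
        ContinuousLinearMap.inr_apply, ContinuousLinearMap.coe_fst', ContinuousLinearMap.coe_snd']
      rw [hL u v]
      refine Prod.ext ?_ rfl
      simp only [smul_eq_mul]
      field_simp
      ring)
    (fun z => by
      obtain ⟨u, v⟩ := z
      simp only [L₁, L₂, ContinuousLinearMap.prod_apply, smul_apply,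
        sub_apply, ContinuousLinearMap.comp_apply,
        ContinuousLinearMap.inr_apply, ContinuousLinearMap.coe_fst', ContinuousLinearMap.coe_snd']
      rw [hL]
      refine Prod.ext ?_ rfl
      simp only [smul_eq_mul]
      field_simp
      ring)
  have hsm : SmoothNear (fun p => (F p, p.2)) x₀ := hF.prodMk (contDiff_snd.smoothNear _)
  have hd : fderiv ℝ (fun p => (F p, p.2)) x₀ = e :=
    (hF.differentiableAt.hasFDerivAt.prodMk hasFDerivAt_snd).fderiv
  obtain ⟨g, hg, hg0, hg1, hg2, -⟩ := hsm.exists_localInverse e hd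
  refine ⟨fun q => (g q).1, (contDiff_fst.smoothNear _).comp hg, congrArg Prod.fst hg0, ?_, ?_⟩
  · filter_upwards [hg1] with q hq
    have h1 : (g q).2 = q.2 := (Prod.ext_iff.1 hq).2
    have h2 : F (g q) = q.1 := (Prod.ext_iff.1 hq).1
    rw [← h1]
    exact h2
  · filter_upwards [hg2] with p hp
    exact congrArg Prod.fst hp

end ImplicitFunction

section Cubic

variable {Y : Type} [NormedAddCommGroup Y] [NormedSpace ℝ Y] [FiniteDimensional ℝ Y]

theorem exists_integral_quadratic_eq {E : ℝ × Y → ℝ} (hE : ContDiff ℝ ∞ E)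
    (hEc : HasCompactSupport E) :
    ∃ (W B : ℝ × Y → ℝ) (D : ℝ × ℝ × Y → ℝ), ContDiff ℝ ∞ W ∧ ContDiff ℝ ∞ B ∧ ContDiff ℝ ∞ D ∧
      (∀ t c y, ∫ s in (0 : ℝ)..t, E (s, y) * (s ^ 2 - c) =
        W (c, y) * t * (t ^ 2 - 3 * c) + (t ^ 2 - c) ^ 2 * D (t, c, y) + B (c, y)) ∧
      W 0 = E 0 / 3 := by
  obtain ⟨E₀, E₁, hE₀, hE₁, hdec⟩ := exists_even_odd_decomp hE hEc
  obtain ⟨p, hp, hpe⟩ := exists_integral_mul_sub_eq hE₁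
  obtain ⟨W, d, hW, hd, hWd, hW0⟩ := exists_integral_even_mul_eq hE₀
  refine ⟨W, fun z => -(z.1 ^ 2 * p (0, z.1, z.2) / 2),
    fun z => z.1 * d (z.1 ^ 2, z.2.1, z.2.2) + p (z.1 ^ 2, z.2.1, z.2.2) / 2, hW, by fun_prop,
    by fun_prop, fun t c y => ?_, ?_⟩
  · have hc₀ := hE₀.continuous
    have hc₁ := hE₁.continuous
    have h1 : ∫ s in (0 : ℝ)..t, s * E₁ (s ^ 2, y) * (s ^ 2 - c) =
        (t ^ 2 - c) ^ 2 * (p (t ^ 2, c, y) / 2) - c ^ 2 * p (0, c, y) / 2 := by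
      have h2 := intervalIntegral.integral_comp_mul_deriv (a := 0) (b := t)
        (f := fun s : ℝ => s ^ 2) (f' := fun s => 2 * s) (g := fun u => E₁ (u, y) * (u - c))
        (fun s _ => by simpa using hasDerivAt_pow 2 s) (by fun_prop) (by fun_prop)
      have h3 := intervalIntegral.integral_add_adjacent_intervals (a := 0) (b := c) (c := t ^ 2)
        (f := fun u => E₁ (u, y) * (u - c)) (μ := MeasureTheory.volume)
        (Continuous.intervalIntegrable (by fun_prop) _ _)
        (Continuous.intervalIntegrable (by fun_prop) _ _)
      rw [intervalIntegral.integral_symm, hpe, hpe] at h3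
      have h4 : ∫ s in (0 : ℝ)..t, s * E₁ (s ^ 2, y) * (s ^ 2 - c) =
          (1 / 2) * ∫ s in (0 : ℝ)..t, ((fun u => E₁ (u, y) * (u - c)) ∘ fun s => s ^ 2) s *
            (2 * s) := by
        rw [← intervalIntegral.integral_const_mul]
        refine intervalIntegral.integral_congr fun s _ => ?_
        simp only [Function.comp]
        ring
      rw [h4, h2, zero_pow two_ne_zero, ← h3]
      ring
    have h2 : ∫ s in (0 : ℝ)..t, E (s, y) * (s ^ 2 - c) =
        (∫ s in (0 : ℝ)..t, E₀ (s ^ 2, y) * (s ^ 2 - c)) +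
          ∫ s in (0 : ℝ)..t, s * E₁ (s ^ 2, y) * (s ^ 2 - c) := by
      rw [← intervalIntegral.integral_add (Continuous.intervalIntegrable (by fun_prop) _ _)
        (Continuous.intervalIntegrable (by fun_prop) _ _)]
      refine intervalIntegral.integral_congr fun s _ => ?_
      simp only [hdec]
      ring
    rw [h2, h1, hWd]
    ring
  · have := hdec 0 0
    rw [zero_pow two_ne_zero, zero_mul, add_zero] at this
    rw [hW0]
    exact congrArg (· / 3) this.symm

/-- Cubic normal form of the primitive of a unit times `s ^ 2 - c`. -/
theorem exists_cubic_integral {E : ℝ × Y → ℝ} (hE : ContDiff ℝ ∞ E)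
    (hEc : HasCompactSupport E) (hE0 : 0 < E 0) :
    ∃ (θ : ℝ × ℝ × Y → ℝ) (a b : ℝ × Y → ℝ), SmoothNear θ 0 ∧ SmoothNear a 0 ∧ SmoothNear b 0 ∧
      θ 0 = 0 ∧ a 0 = 0 ∧ ∀ᶠ z in 𝓝 (0 : ℝ × ℝ × Y),
        ∫ s in (0 : ℝ)..z.1, E (s, z.2.2) * (s ^ 2 - z.2.1) =
          θ z ^ 3 - a z.2 * θ z + b z.2 := by
  obtain ⟨W, B, D, hW, hB, hD, hWD, hW0⟩ := exists_integral_quadratic_eq hE hEc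
  have hWpos : ∀ᶠ z in 𝓝 (0 : ℝ × Y), 0 < W z :=
    hW.continuous.continuousAt.eventually_const_lt (by rw [hW0]; positivity)
  have hm : SmoothNear (fun z => W z ^ ((3 : ℝ)⁻¹)) 0 := by
    filter_upwards [hWpos] with z hz
    exact hW.contDiffAt.rpow_const_of_ne hz.ne'
  obtain ⟨M, hM, -, hMm⟩ := hm.exists_contDiff
  have hM3 : ∀ᶠ z in 𝓝 (0 : ℝ × Y), M z ^ 3 = W z := by
    filter_upwards [hWpos, hMm] with z hz hz'
    rw [hz', ← Real.rpow_natCast, ← Real.rpow_mul hz.le]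
    norm_num
  have hM0 : M 0 ≠ 0 := fun h => by
    have h1 := hM3.self_of_nhds
    have h2 := hWpos.self_of_nhds
    rw [h] at h1
    norm_num at h1
    exact h2.ne h1
  let F : ℝ × ℝ × ℝ × Y → ℝ := fun x => 3 * M x.2.2 ^ 2 * x.1 + 3 * M x.2.2 * x.2.1 * x.1 ^ 2 +
    (x.2.1 ^ 2 - x.2.2.1) * x.1 ^ 3 - D x.2
  have hF : ContDiff ℝ ∞ F := by fun_prop
  let x₀ : ℝ × ℝ × ℝ × Y := (D 0 / (3 * M 0 ^ 2), 0)
  have hF0 : F x₀ = 0 := by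
    simp [F, x₀]
    field_simp
    ring
  have hF' : fderiv ℝ F x₀ (1, 0) ≠ 0 := by
    have h1 := hasDerivAt_comp_fst hF (hasDerivAt_id x₀.1) x₀.2
    have h2 : HasDerivAt (fun s : ℝ => 3 * M 0 ^ 2 * s - D 0) (3 * M 0 ^ 2 * 1) x₀.1 :=
      ((hasDerivAt_id x₀.1).const_mul _).sub_const _
    have h3 : (fun s => F (id s, x₀.2)) = fun s : ℝ => 3 * M 0 ^ 2 * s - D 0 := by
      funext s
      simp [F, x₀]
    rw [h3] at h1
    have h4 := h1.unique h2
    rw [one_mul] at h4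
    change fderiv ℝ F x₀ (1, 0) = _ at h4
    rw [h4]
    positivity
  obtain ⟨g, hg, -, hg1, -⟩ := (hF.smoothNear x₀).exists_partialInverse hF'
  rw [hF0] at hg hg1
  let ζ : ℝ × ℝ × Y → ℝ := fun z => g (0, z)
  have hι : ContDiff ℝ ∞ fun z : ℝ × ℝ × Y => ((0 : ℝ), z) := by fun_prop
  have hζ : SmoothNear ζ 0 := SmoothNear.comp (g := g) (f := fun z => ((0 : ℝ), z)) hg
    (hι.smoothNear 0)
  have hζF : ∀ᶠ z in 𝓝 (0 : ℝ × ℝ × Y), F (ζ z, z) = 0 :=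
    (hι.continuous.tendsto 0).eventually hg1
  refine ⟨fun z => M z.2 * z.1 + (z.1 ^ 2 - z.2.1) * ζ z, fun z => 3 * M z ^ 2 * z.1, B, ?_,
    ContDiff.smoothNear (by fun_prop) _, hB.smoothNear _, by simp, by simp, ?_⟩
  · filter_upwards [hζ] with z hz
    fun_prop
  · have h1 : ∀ᶠ z in 𝓝 (0 : ℝ × ℝ × Y), M z.2 ^ 3 = W z.2 :=
      ((continuous_snd (X := ℝ) (Y := ℝ × Y)).tendsto 0).eventually hM3
    filter_upwards [h1, hζF] with z hz1 hz2
    have h2 := hWD z.1 z.2.1 z.2.2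
    rw [h2]
    change W z.2 * z.1 * _ + _ * D z + B z.2 = _
    simp only [F, sub_eq_zero] at hz2
    rw [← hz2, ← hz1]
    ring

end Cubic

theorem Continuous.tendsto_zero {A B : Type*} [TopologicalSpace A] [Zero A] [TopologicalSpace B]
    [Zero B] {f : A → B} (hf : Continuous f) (h0 : f 0 = 0) : Tendsto f (𝓝 0) (𝓝 0) := by
  simpa only [h0] using hf.tendsto 0

section CubicUnfolding

variable {Y : Type} [NormedAddCommGroup Y] [NormedSpace ℝ Y]

theorem ContDiff.fderiv_fst {f : ℝ × Y → ℝ} (hf : ContDiff ℝ ∞ f) :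
    ContDiff ℝ ∞ fun p => fderiv ℝ f p (1, 0) :=
  (hf.fderiv_right (by simp)).clm_apply contDiff_const

theorem fderiv_fst_shift {f : ℝ × Y → ℝ} (hf : ContDiff ℝ ∞ f) {T : Y → ℝ}
    (hT : ContDiff ℝ ∞ T) (t : ℝ) (y : Y) :
    fderiv ℝ (fun p : ℝ × Y => f (p.1 + T p.2, p.2)) (t, y) (1, 0) =
      fderiv ℝ f (t + T y, y) (1, 0) := by
  have hf' : ContDiff ℝ ∞ fun p : ℝ × Y => f (p.1 + T p.2, p.2) := by fun_prop
  have h1 := hasDerivAt_comp_fst hf' (hasDerivAt_id t) y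
  have h2 := hasDerivAt_comp_fst hf ((hasDerivAt_id t).add_const (T y)) y
  simpa using h1.unique h2

variable [FiniteDimensional ℝ Y]

theorem exists_quadratic_remainder {k : ℝ × Y → ℝ} (hk : ContDiff ℝ ∞ k)
    (hk1 : ∀ᶠ y in 𝓝 (0 : Y), fderiv ℝ k (0, y) (1, 0) = 0) :
    ∃ r : ℝ × Y → ℝ, ContDiff ℝ ∞ r ∧
      (∀ᶠ y in 𝓝 (0 : Y), ∀ t, k (t, y) = k (0, y) + t ^ 2 * r (t, y)) ∧
      fderiv ℝ (fun p => fderiv ℝ k p (1, 0)) 0 (1, 0) = 2 * r 0 := by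
  obtain ⟨e, he, he1, he2⟩ := exists_hadamard hk
  let e₁ : ℝ × Y → ℝ := fun p => e (p.1, 0, p.2)
  have he₁ : ContDiff ℝ ∞ e₁ := by fun_prop
  have hke : ∀ t y, k (t, y) = k (0, y) + t * e₁ (t, y) := fun t y => by
    have := he1 t 0 y
    rw [sub_zero] at this
    exact sub_eq_iff_eq_add'.1 this
  obtain ⟨e', he', he'1, he'2⟩ := exists_hadamard he₁
  refine ⟨fun p => e' (p.1, 0, p.2), by fun_prop, ?_, ?_⟩
  · filter_upwards [hk1] with y hy t
    have h1 := he'1 t 0 y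
    have h2 : e₁ (0, y) = 0 := (he2 0 y).trans hy
    rw [h2, sub_zero, sub_zero] at h1
    rw [hke, h1]
    ring
  · have h1 : ∀ t, fderiv ℝ k (t, 0) (1, 0) =
        e₁ (t, 0) + t * fderiv ℝ e₁ (t, 0) (1, 0) := fun t => by
      have h2 := hasDerivAt_comp_fst hk (hasDerivAt_id t) 0
      have h3 := ((hasDerivAt_id t).mul
        (hasDerivAt_comp_fst he₁ (hasDerivAt_id t) 0)).const_add (k (0, 0))
      have h4 : (fun s => k (id s, (0 : Y))) = fun s => k (0, 0) + id s * e₁ (id s, 0) :=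
        funext fun s => hke _ _
      rw [h4] at h2
      simpa using h2.unique h3
    have h2 := hasDerivAt_comp_fst hk.fderiv_fst (hasDerivAt_id 0) 0
    have h3 := (hasDerivAt_comp_fst he₁ (hasDerivAt_id 0) 0).add ((hasDerivAt_id 0).mul
        (hasDerivAt_comp_fst he₁.fderiv_fst (hasDerivAt_id 0) 0))
    have h4 : (fun s => fderiv ℝ k (id s, (0 : Y)) (1, 0)) = fun s =>
        e₁ (id s, 0) + id s * fderiv ℝ e₁ (id s, 0) (1, 0) := funext fun s => h1 _
    rw [h4] at h2
    have h5 := h2.unique h3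
    have h6 := he'2 0 0
    simp only [id, one_mul, zero_mul, add_zero] at h5
    change _ = 2 * e' (0, 0, 0)
    rw [h6]
    exact h5.trans (two_mul _).symm

theorem exists_cubic_unfolding_of_pos {h : ℝ × Y → ℝ} (hh : ContDiff ℝ ∞ h)
    (h1 : fderiv ℝ h 0 (1, 0) = 0)
    (h2 : fderiv ℝ (fun p => fderiv ℝ h p (1, 0)) 0 (1, 0) = 0)
    (h3 : 0 < fderiv ℝ (fun p => fderiv ℝ (fun q => fderiv ℝ h q (1, 0)) p (1, 0)) 0 (1, 0)) :
    ∃ (θ : ℝ × Y → ℝ) (a b : Y → ℝ), SmoothNear θ 0 ∧ SmoothNear a 0 ∧ SmoothNear b 0 ∧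
      θ 0 = 0 ∧ a 0 = 0 ∧
      ∀ᶠ p in 𝓝 (0 : ℝ × Y), h p = θ p ^ 3 - a p.2 * θ p + b p.2 := by
  have : CompleteSpace Y := FiniteDimensional.complete ℝ Y
  let k : ℝ × Y → ℝ := fun p => fderiv ℝ h p (1, 0)
  have hk : ContDiff ℝ ∞ k := hh.fderiv_fst
  let l : ℝ × Y → ℝ := fun p => fderiv ℝ k p (1, 0)
  have hl : ContDiff ℝ ∞ l := hk.fderiv_fst
  have hl0 : l 0 = 0 := h2
  obtain ⟨g, hg, hg0, hg1, -⟩ := (hl.smoothNear 0).exists_partialInverse h3.ne'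
  rw [hl0] at hg hg0 hg1
  have hι : ContDiff ℝ ∞ fun y : Y => ((0 : ℝ), y) := by fun_prop
  have ht : SmoothNear (fun y => g (0, y)) (0 : Y) :=
    SmoothNear.comp (g := g) (f := fun y : Y => ((0 : ℝ), y)) hg (hι.smoothNear 0)
  obtain ⟨T, hT, -, hTg⟩ := ht.exists_contDiff
  have hT0 : T 0 = 0 := hTg.self_of_nhds.trans hg0
  have hTl : ∀ᶠ y in 𝓝 (0 : Y), l (T y, y) = 0 := by
    filter_upwards [hTg, (hι.continuous.tendsto 0).eventually hg1] with y hy1 hy2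
    rw [hy1]
    exact hy2
  let k₂ : ℝ × Y → ℝ := fun p => k (p.1 + T p.2, p.2)
  have hk₂ : ContDiff ℝ ∞ k₂ := by fun_prop
  have hk₂l : ∀ t y, fderiv ℝ k₂ (t, y) (1, 0) = l (t + T y, y) := fderiv_fst_shift hk hT
  obtain ⟨r, hr, hkr, hr0⟩ := exists_quadratic_remainder hk₂ (by
    filter_upwards [hTl] with y hy
    rw [hk₂l, zero_add, hy])
  have hrpos : 0 < r 0 := by
    have h4 : fderiv ℝ (fun p => fderiv ℝ k₂ p (1, 0)) 0 (1, 0) = fderiv ℝ l 0 (1, 0) := by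
      have h5 : (fun p => fderiv ℝ k₂ p (1, 0)) = fun p : ℝ × Y => l (p.1 + T p.2, p.2) :=
        funext fun p => hk₂l p.1 p.2
      rw [h5]
      refine (fderiv_fst_shift hl hT 0 0).trans ?_
      rw [hT0, zero_add]
      rfl
    rw [h4] at hr0
    have h5 : 0 < fderiv ℝ l 0 (1, 0) := h3
    linarith
  have hs : SmoothNear (fun p => √(r p)) (0 : ℝ × Y) := by
    filter_upwards [hr.continuous.continuousAt.eventually_const_lt hrpos] with p hp
    exact hr.contDiffAt.sqrt hp.ne'
  obtain ⟨S, hS, -, hSr⟩ := hs.exists_contDiff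
  have hS0 : 0 < S 0 := by
    rw [hSr.self_of_nhds]
    exact Real.sqrt_pos.2 hrpos
  let τ : ℝ × Y → ℝ := fun p => p.1 * S p
  have hτ : ContDiff ℝ ∞ τ := by fun_prop
  have hτ0 : τ 0 = 0 := zero_mul _
  have hτ' : fderiv ℝ τ 0 (1, 0) = S 0 := by
    have h4 := hasDerivAt_comp_fst hτ (hasDerivAt_id 0) 0
    have h5 := (hasDerivAt_id 0).mul (hasDerivAt_comp_fst hS (hasDerivAt_id 0) 0)
    have h6 := h4.unique h5
    simp only [id, one_mul, zero_mul, add_zero] at h6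
    exact h6
  have hkτ : ∀ᶠ p in 𝓝 (0 : ℝ × Y), k₂ p = k₂ (0, p.2) + τ p ^ 2 := by
    filter_upwards [hSr, (continuous_snd.tendsto (0 : ℝ × Y)).eventually hkr,
      hr.continuous.continuousAt.eventually_const_lt hrpos] with p hp1 hp2 hp3
    have h4 : τ p ^ 2 = p.1 ^ 2 * r p := by
      simp only [τ, hp1, mul_pow]
      rw [Real.sq_sqrt hp3.le]
    rw [h4]
    exact hp2 p.1
  obtain ⟨G₀, hG₀, hG₀0, hG₀1, hG₀2⟩ :=
    (hτ.smoothNear 0).exists_partialInverse (by rw [hτ']; exact hS0.ne')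
  rw [hτ0] at hG₀ hG₀0 hG₀1
  obtain ⟨G, hG, -, hGG⟩ := SmoothNear.exists_contDiff (x := (0 : ℝ × Y)) hG₀
  have hG0 : G 0 = 0 := hGG.self_of_nhds.trans hG₀0
  have hτG : ∀ᶠ q in 𝓝 (0 : ℝ × Y), τ (G q, q.2) = q.1 := by
    filter_upwards [hGG, show ∀ᶠ q in 𝓝 (0 : ℝ × Y), τ (G₀ q, q.2) = q.1 from hG₀1]
      with q hq1 hq2
    rw [hq1, hq2]
  have hτc : Continuous fun p : ℝ × Y => (τ p, p.2) := hτ.continuous.prodMk continuous_snd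
  have hGτ : ∀ᶠ p in 𝓝 (0 : ℝ × Y), G (τ p, p.2) = p.1 := by
    have h4 : Tendsto (fun p : ℝ × Y => (τ p, p.2)) (𝓝 0) (𝓝 0) :=
      hτc.tendsto_zero (Prod.ext hτ0 rfl)
    filter_upwards [h4.eventually hGG, hG₀2] with p hp1 hp2
    rw [hp1, hp2]
  obtain ⟨E, hE, hEc, hEG⟩ := (hG.fderiv_fst.smoothNear 0).exists_contDiff
  have hE0 : 0 < E 0 := by
    rw [hEG.self_of_nhds]
    have h4 : HasDerivAt (fun s : ℝ => τ (s, (0 : Y))) (1 * S 0) 0 := by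
      rw [← hτ']
      exact hasDerivAt_comp_fst hτ (hasDerivAt_id 0) 0
    have h5 : HasDerivAt (fun s : ℝ => G (τ (s, 0), (0 : Y))) _ 0 := hasDerivAt_comp_fst hG h4 0
    have h6 : (fun s : ℝ => G (τ (s, 0), (0 : Y))) =ᶠ[𝓝 0] id :=
      ((by fun_prop : Continuous fun s : ℝ => (s, (0 : Y))).tendsto 0).eventually hGτ
    have h7 := (h5.congr_of_eventuallyEq h6.symm).unique (hasDerivAt_id 0)
    rw [show (τ (0, 0), (0 : Y)) = 0 by rw [show τ (0, 0) = 0 from hτ0]; rfl, one_mul] at h7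
    by_contra! h8
    nlinarith
  obtain ⟨θ, a, b, hθ, ha, hb, hθ0, ha0, hθab⟩ := exists_cubic_integral hE hEc hE0
  let c : Y → ℝ := fun y => -k₂ (0, y)
  have hc : ContDiff ℝ ∞ c := by fun_prop
  have hc0 : c 0 = 0 := by
    simp only [c, k₂, hT0, zero_add, neg_eq_zero]
    exact h1
  let h₂ : ℝ × Y → ℝ := fun p => h (p.1 + T p.2, p.2)
  have hh₂ : ContDiff ℝ ∞ h₂ := by fun_prop
  have hInt : ∀ᶠ q in 𝓝 (0 : ℝ × Y), h₂ (G q, q.2) =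
      (∫ s in (0 : ℝ)..q.1, E (s, q.2) * (s ^ 2 - c q.2)) + h₂ (G (0, q.2), q.2) := by
    have h4 : Tendsto (fun q : ℝ × Y => (G q, q.2)) (𝓝 0) (𝓝 0) := by
      have : Continuous fun q : ℝ × Y => (G q, q.2) := hG.continuous.prodMk continuous_snd
      exact this.tendsto_zero (Prod.ext hG0 rfl)
    obtain ⟨ρ, hρ, hball⟩ := Metric.eventually_nhds_iff_ball.1
      ((h4.eventually hkτ).and (hτG.and hEG))
    filter_upwards [Metric.ball_mem_nhds _ hρ] with ⟨t, y⟩ hq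
    rw [mem_ball_zero_iff, Prod.norm_mk, max_lt_iff] at hq
    have h5 : ∀ s ∈ Set.uIcc 0 t, HasDerivAt (fun s => h₂ (G (s, y), y))
        (E (s, y) * (s ^ 2 - c y)) s := by
      intro s hs
      have h6 : ‖s‖ < ρ := by
        refine lt_of_le_of_lt ?_ hq.1
        rw [Real.norm_eq_abs, Real.norm_eq_abs]
        simpa using Set.abs_sub_left_of_mem_uIcc hs
      obtain ⟨h7, h8, h9⟩ := hball (s, y) (by
        rw [mem_ball_zero_iff, Prod.norm_mk, max_lt_iff]
        exact ⟨h6, hq.2⟩)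
      have h10 := hasDerivAt_comp_fst hh₂ (hasDerivAt_comp_fst hG (hasDerivAt_id s) y) y
      refine h10.congr_deriv ?_
      have h11 : fderiv ℝ h₂ (G (s, y), y) (1, 0) = k₂ (G (s, y), y) :=
        fderiv_fst_shift hh hT _ _
      simp only at h7 h8
      simp only [id, one_mul, h9]
      rw [h11, h7, h8]
      simp only [c]
      ring
    have hEcont := hE.continuous
    rw [intervalIntegral.integral_eq_sub_of_hasDerivAt h5
      (Continuous.intervalIntegrable (by fun_prop) _ _)]
    ring
  let σ : ℝ × Y → ℝ := fun p => τ (p.1 - T p.2, p.2)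
  have hσ : ContDiff ℝ ∞ σ := by fun_prop
  have hσ0 : σ 0 = 0 := by simp [σ, hT0, τ]
  let Q : ℝ × Y → ℝ × ℝ × Y := fun p => (σ p, c p.2, p.2)
  have hQ : ContDiff ℝ ∞ Q := by fun_prop
  have hQ0 : Q 0 = 0 := by simp [Q, hσ0, hc0]
  let R : Y → ℝ × Y := fun y => (c y, y)
  have hR : ContDiff ℝ ∞ R := by fun_prop
  have hR0 : R 0 = 0 := by simp [R, hc0]
  refine ⟨fun p => θ (Q p), fun y => a (R y), fun y => b (R y) + h₂ (G (0, y), y), ?_, ?_, ?_, ?_,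
    ?_, ?_⟩
  · exact SmoothNear.comp (by rwa [hQ0]) (hQ.smoothNear 0)
  · exact SmoothNear.comp (by rwa [hR0]) (hR.smoothNear 0)
  · refine SmoothNear.add (SmoothNear.comp (by rwa [hR0]) (hR.smoothNear 0)) ?_
    exact ContDiff.smoothNear (by fun_prop) _
  · simp only [hQ0, hθ0]
  · simp only [hR0, ha0]
  · have h4 : Tendsto Q (𝓝 0) (𝓝 0) := hQ.continuous.tendsto_zero hQ0
    have h5 : Tendsto (fun p : ℝ × Y => (σ p, p.2)) (𝓝 0) (𝓝 0) := by
      have : Continuous fun p : ℝ × Y => (σ p, p.2) := hσ.continuous.prodMk continuous_snd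
      exact this.tendsto_zero (Prod.ext hσ0 rfl)
    have h6 : Tendsto (fun p : ℝ × Y => (p.1 - T p.2, p.2)) (𝓝 0) (𝓝 0) := by
      have hTc := hT.continuous
      have : Continuous fun p : ℝ × Y => (p.1 - T p.2, p.2) := by fun_prop
      exact this.tendsto_zero (by simp [hT0])
    filter_upwards [h4.eventually hθab, h5.eventually hInt, h6.eventually hGτ] with p hp1 hp2 hp3
    have h7 : h p = h₂ (p.1 - T p.2, p.2) := by simp [h₂]
    have h8 : G (σ p, p.2) = p.1 - T p.2 := hp3
    rw [h8] at hp2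
    rw [h7, hp2]
    simp only [Q] at hp1
    rw [hp1]
    simp only [Q, R]
    ring

/-- Normal form of a family of functions of one variable near a degenerate critical point of
cubic type. -/
theorem exists_cubic_unfolding {h : ℝ × Y → ℝ} (hh : SmoothNear h 0)
    (h1 : fderiv ℝ h 0 (1, 0) = 0)
    (h2 : fderiv ℝ (fun p => fderiv ℝ h p (1, 0)) 0 (1, 0) = 0)
    (h3 : fderiv ℝ (fun p => fderiv ℝ (fun q => fderiv ℝ h q (1, 0)) p (1, 0)) 0 (1, 0) ≠ 0) :
    ∃ (θ : ℝ × Y → ℝ) (a b : Y → ℝ), SmoothNear θ 0 ∧ SmoothNear a 0 ∧ SmoothNear b 0 ∧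
      θ 0 = 0 ∧ a 0 = 0 ∧
      ∀ᶠ p in 𝓝 (0 : ℝ × Y), h p = θ p ^ 3 - a p.2 * θ p + b p.2 := by
  obtain ⟨g, hg, -, hgh⟩ := hh.exists_contDiff
  have e1 : (fun p => fderiv ℝ g p (1, 0)) =ᶠ[𝓝 0] fun p => fderiv ℝ h p (1, 0) := by
    filter_upwards [eventually_eventually_nhds.2 hgh] with p hp
    rw [Filter.EventuallyEq.fderiv_eq hp]
  have e2 : (fun p => fderiv ℝ (fun q => fderiv ℝ g q (1, 0)) p (1, 0)) =ᶠ[𝓝 0]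
      fun p => fderiv ℝ (fun q => fderiv ℝ h q (1, 0)) p (1, 0) := by
    filter_upwards [eventually_eventually_nhds.2 e1] with p hp
    rw [Filter.EventuallyEq.fderiv_eq hp]
  rw [← hgh.fderiv_eq] at h1
  rw [← e1.fderiv_eq] at h2
  rw [← e2.fderiv_eq] at h3
  rcases h3.lt_or_gt with h3 | h3
  · obtain ⟨θ, a, b, hθ, ha, hb, hθ0, ha0, h⟩ := exists_cubic_unfolding_of_pos (h := fun p => -g p)
      hg.neg (by simpa using h1) (by simpa using h2) (by simpa using h3)
    refine ⟨fun p => -θ p, a, fun y => -b y, ?_, ha, ?_, by simp [hθ0], ha0, ?_⟩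
    · filter_upwards [hθ] with p hp using hp.neg
    · filter_upwards [hb] with p hp using hp.neg
    · filter_upwards [h, hgh] with p hp hp'
      rw [← hp', ← neg_neg (g p), hp]
      ring
  · obtain ⟨θ, a, b, hθ, ha, hb, hθ0, ha0, h⟩ := exists_cubic_unfolding_of_pos hg h1 h2 h3
    refine ⟨θ, a, b, hθ, ha, hb, hθ0, ha0, ?_⟩
    filter_upwards [h, hgh] with p hp hp'
    rw [← hp', hp]

end CubicUnfolding

section Projection

variable {E F : Type} [NormedAddCommGroup E] [NormedSpace ℝ E]
  [NormedAddCommGroup F] [NormedSpace ℝ F]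

/-- The projection onto the kernel of a functional along a vector. -/
noncomputable def projAlong (ξ : E →L[ℝ] ℝ) (e : E) : E →L[ℝ] E :=
  ContinuousLinearMap.id ℝ E - ξ.smulRight e

theorem projAlong_apply (ξ : E →L[ℝ] ℝ) (e x : E) : projAlong ξ e x = x - ξ x • e := rfl

theorem projAlong_self {ξ : E →L[ℝ] ℝ} {e : E} (hξ : ξ e = 1) : projAlong ξ e e = 0 := by
  rw [projAlong_apply, hξ, one_smul, sub_self]

theorem apply_projAlong {ξ : E →L[ℝ] ℝ} {e : E} (hξ : ξ e = 1) (x : E) :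
    ξ (projAlong ξ e x) = 0 := by
  simp [projAlong_apply, hξ]

theorem projAlong_eq_self {ξ : E →L[ℝ] ℝ} {e x : E} (hx : ξ x = 0) : projAlong ξ e x = x := by
  simp [projAlong_apply, hx]

theorem projAlong_add (ξ : E →L[ℝ] ℝ) (e x : E) : projAlong ξ e x + ξ x • e = x := by
  simp [projAlong_apply]

theorem tendsto_projAlong (ξ : E →L[ℝ] ℝ) (e : E) : Tendsto (projAlong ξ e) (𝓝 0) (𝓝 0) :=
  (projAlong ξ e).continuous.tendsto_zero (map_zero _)

/-- A property holding near zero holds along the segment from the projection of a point to it. -/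
theorem eventually_forall_segment {P : E → Prop} (hP : ∀ᶠ x in 𝓝 (0 : E), P x)
    (ξ : E →L[ℝ] ℝ) (e : E) :
    ∀ᶠ x in 𝓝 (0 : E), ∀ s ∈ Set.Icc (0 : ℝ) 1, P (projAlong ξ e x + (s * ξ x) • e) := by
  obtain ⟨r, hr, hball⟩ := Metric.eventually_nhds_iff_ball.1 hP
  have h1 : Continuous fun x : E => ‖projAlong ξ e x‖ + ‖ξ x • e‖ := by fun_prop
  filter_upwards [(h1.tendsto_zero (by simp)).eventually_lt_const hr] with x hx s hs
  refine hball _ ?_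
  rw [mem_ball_zero_iff]
  refine (norm_add_le _ _).trans_lt (lt_of_le_of_lt ?_ hx)
  gcongr
  rw [mul_smul, norm_smul]
  refine mul_le_of_le_one_left (norm_nonneg _) ?_
  rw [Real.norm_of_nonneg hs.1]
  exact hs.2

/-- A function whose derivative vanishes in one direction is constant in that direction. -/
theorem SmoothNear.eventually_eq_projAlong {f : E → F} (hf : SmoothNear f 0) (ξ : E →L[ℝ] ℝ)
    {e : E} (h : ∀ᶠ x in 𝓝 (0 : E), fderiv ℝ f x e = 0) :
    ∀ᶠ x in 𝓝 (0 : E), f x = f (projAlong ξ e x) := by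
  filter_upwards [eventually_forall_segment (hf.and h) ξ e] with x hx
  have h1 : ∀ s ∈ Set.Icc (0 : ℝ) 1,
      HasDerivAt (fun s => f (projAlong ξ e x + (s * ξ x) • e)) 0 s := by
    intro s hs
    obtain ⟨h2, h3⟩ := hx s hs
    have h4 : HasDerivAt (fun s : ℝ => projAlong ξ e x + (s * ξ x) • e) (ξ x • e) s := by
      simpa using (((hasDerivAt_id s).mul_const (ξ x)).smul_const e).const_add (projAlong ξ e x)
    have h5 := (h2.differentiableAt (by simp)).hasFDerivAt.comp_hasDerivAt s h4
    rw [map_smul, h3, smul_zero] at h5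
    exact h5
  have h2 := constant_of_has_deriv_right_zero
    (fun s hs => (h1 s hs).continuousAt.continuousWithinAt)
    (fun s hs => (h1 s ⟨hs.1, hs.2.le⟩).hasDerivWithinAt) 1 (by simp)
  simpa [projAlong_add] using h2

variable [FiniteDimensional ℝ E]

/-- A one-form whose exterior derivative is annihilated by a constant vector is, up to an exact
form, pulled back from a hyperplane transverse to that vector. -/
theorem SmoothNear.exists_fderiv_add_basic {μ : E → E →L[ℝ] ℝ} (hμ : SmoothNear μ 0)
    {ξ : E →L[ℝ] ℝ} {e : E} (hξ : ξ e = 1)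
    (h : ∀ᶠ x in 𝓝 (0 : E), ∀ v, oneFormDeriv μ x e v = 0) :
    ∃ f : E → ℝ, ContDiff ℝ ∞ f ∧ ∀ᶠ x in 𝓝 (0 : E), ∀ v,
      μ x v = fderiv ℝ f x v + μ (projAlong ξ e x) (projAlong ξ e v) := by
  obtain ⟨M, hM, -, hMμ⟩ := hμ.exists_contDiff
  set π := projAlong ξ e with hπ
  have hA : Continuous fun s : ℝ => π + s • ξ.smulRight e := by fun_prop
  have hH : ContDiff ℝ ∞ fun x => M x e := hM.clm_apply contDiff_const
  let I : E → ℝ := fun x => ∫ s in (0 : ℝ)..1, (1 : ℝ) • M ((π + s • ξ.smulRight e) x) e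
  have hI : ContDiff ℝ ∞ I := contDiff_intervalIntegral_clm_comp hA continuous_const hH
  let f : E → ℝ := fun x => ξ x * I x
  have hf : ContDiff ℝ ∞ f := ξ.contDiff.mul hI
  have hfi : ∀ x, f x = ∫ r in (0 : ℝ)..ξ x, M (π x + r • e) e := by
    intro x
    have h1 := intervalIntegral.mul_integral_comp_mul_left (a := 0) (b := 1)
      (f := fun r => M (π x + r • e) e) (ξ x)
    rw [mul_zero, mul_one] at h1
    rw [← h1]
    simp only [f, I, one_smul]
    congr 1
    refine intervalIntegral.integral_congr fun s _ => ?_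
    simp [mul_smul, smul_comm s]
  have hfe : ∀ x, fderiv ℝ f x e = M x e := by
    intro x
    have hcont : Continuous fun r : ℝ => M (π x + r • e) e := by
      have := hH.continuous
      fun_prop
    have h1 : HasDerivAt (fun u : ℝ => f (x + u • e)) (M x e) 0 := by
      have h2 : (fun u : ℝ => f (x + u • e)) =
          fun u => ∫ r in (0 : ℝ)..(ξ x + u), M (π x + r • e) e := by
        funext u
        rw [hfi, map_add, map_add, map_smul, map_smul, hξ, hπ, projAlong_self hξ]
        simp
      have h3 := (intervalIntegral.integral_hasDerivAt_right
        (hcont.intervalIntegrable 0 (ξ x + 0))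
        hcont.aestronglyMeasurable.stronglyMeasurableAtFilter hcont.continuousAt)
      have h4 := h3.comp (0 : ℝ) ((hasDerivAt_id (0 : ℝ)).const_add (ξ x))
      rw [h2]
      refine h4.congr_deriv ?_
      rw [mul_one, add_zero, hπ, projAlong_add]
    have h5 : HasDerivAt (fun u : ℝ => x + u • e) e 0 := by
      simpa using ((hasDerivAt_id (0 : ℝ)).smul_const e).const_add x
    have h6 : HasFDerivAt f (fderiv ℝ f x) x :=
      ((hf.differentiable (by simp)).differentiableAt).hasFDerivAt
    exact (h6.comp_hasDerivAt_of_eq (0 : ℝ) h5 (by simp)).unique h1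
  have hfπ : ∀ x v, fderiv ℝ f (π x) (π v) = 0 := by
    intro x v
    have h1 : HasFDerivAt (fun x => f (π x)) ((fderiv ℝ f (π x)).comp π) x :=
      ((hf.differentiable (by simp)).differentiableAt).hasFDerivAt.comp x π.hasFDerivAt
    have h2 : (fun x => f (π x)) = fun _ => 0 := by
      funext x
      simp only [f, hπ, apply_projAlong hξ, zero_mul]
    rw [h2] at h1
    exact (DFunLike.congr_fun (h1.unique (hasFDerivAt_const _ _)) v)
  let ν : E → E →L[ℝ] ℝ := fun x => M x - fderiv ℝ f x
  have hν : ContDiff ℝ ∞ ν := hM.sub (hf.fderiv_right (by simp))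
  have hνe : ∀ x, ν x e = 0 := fun x => by simp [ν, hfe]
  have hν' : ∀ᶠ x in 𝓝 (0 : E), fderiv ℝ ν x e = 0 := by
    filter_upwards [h, eventually_eventually_nhds.2 hMμ] with x hx hx'
    ext v
    have h1 : fderiv ℝ ν x v e = 0 := by
      have h2 : HasFDerivAt (fun y => ν y e) ((fderiv ℝ ν x).flip e) x := by
        have h3 := (hν.differentiable (by simp)).differentiableAt (x := x)
        simpa using h3.hasFDerivAt.clm_apply (hasFDerivAt_const e x)
      simp only [hνe] at h2
      exact DFunLike.congr_fun (h2.unique (hasFDerivAt_const _ _)) v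
    have h2 := oneFormDeriv_sub ((hM.differentiable (by simp)).differentiableAt (x := x))
      (((hf.fderiv_right (by simp : ∞ + 1 ≤ ∞)).differentiable (by simp)).differentiableAt (x := x))
      e v
    rw [oneFormDeriv_fderiv (hf.smoothNear x), oneFormDeriv_congr hx', hx, sub_zero] at h2
    change fderiv ℝ ν x e v - fderiv ℝ ν x v e = 0 at h2
    rw [h1, sub_zero] at h2
    exact h2
  refine ⟨f, hf, ?_⟩
  filter_upwards [hMμ, (tendsto_projAlong ξ e).eventually hMμ,
    (hν.smoothNear 0).eventually_eq_projAlong ξ hν'] with x h1 h2 h3 v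
  have h4 : ν x v = ν (π x) (π v) := by
    rw [h3]
    conv_lhs => rw [← projAlong_add ξ e v]
    rw [map_add, map_smul, hνe, smul_zero, add_zero]
  simp only [ν, sub_apply, hfπ, sub_zero] at h4
  rw [← h1, ← h2]
  linarith

/-- Straightening a vector field along a prescribed transversal. -/
theorem exists_flowBox {V : Type} [NormedAddCommGroup V] [NormedSpace ℝ V]
    {ξ : V →L[ℝ] ℝ} {e : V} (hξ : ξ e = 1) {X : E → E} (hX : SmoothNear X 0)
    {σ : V → E} (hσ : SmoothNear σ 0) (hσ0 : σ 0 = 0) :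
    ∃ Φ : V → E, SmoothNear Φ 0 ∧ (∀ᶠ x in 𝓝 0, ξ x = 0 → Φ x = σ x) ∧
      (∀ᶠ x in 𝓝 0, fderiv ℝ Φ x e = X (Φ x)) ∧
      ∀ v, fderiv ℝ Φ 0 v = ξ v • X 0 + fderiv ℝ σ 0 (projAlong ξ e v) := by
  obtain ⟨φ, hφ, hφ0, hφX⟩ := exists_flow hX
  set π := projAlong ξ e with hπ
  have hσπ : SmoothNear (fun x => σ (π x)) 0 :=
    SmoothNear.comp (by rwa [map_zero]) (π.contDiff.smoothNear 0)
  have hj : SmoothNear (fun x => (ξ x, σ (π x))) 0 := (ξ.contDiff.smoothNear 0).prodMk hσπ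
  have hj0 : (ξ 0, σ (π 0)) = 0 := by simp [hσ0]
  have hjt : Tendsto (fun x => (ξ x, σ (π x))) (𝓝 0) (𝓝 0) := by
    have := hj.continuousAt.tendsto
    rwa [hj0] at this
  have hπt : Tendsto π (𝓝 0) (𝓝 0) := tendsto_projAlong ξ e
  have hΦ : SmoothNear (fun x => φ (ξ x, σ (π x))) 0 := SmoothNear.comp (by rwa [hj0]) hj
  have hder : ∀ᶠ x in 𝓝 (0 : V), ∀ v, fderiv ℝ (fun x => φ (ξ x, σ (π x))) x v =
      fderiv ℝ φ (ξ x, σ (π x)) (ξ v, fderiv ℝ σ (π x) (π v)) := by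
    filter_upwards [hjt.eventually hφ, hπt.eventually hσ] with x h1 h2 v
    have h3 : HasFDerivAt (fun x => (ξ x, σ (π x))) (ξ.prod ((fderiv ℝ σ (π x)).comp π)) x :=
      ξ.hasFDerivAt.prodMk ((h2.differentiableAt (by simp)).hasFDerivAt.comp x π.hasFDerivAt)
    have h4 : HasFDerivAt (fun x => φ (ξ x, σ (π x))) _ x :=
      (h1.differentiableAt (by simp)).hasFDerivAt.comp x h3
    rw [h4.fderiv]
    rfl
  refine ⟨fun x => φ (ξ x, σ (π x)), hΦ, ?_, ?_, ?_⟩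
  · have h1 : Tendsto (fun x => σ (π x)) (𝓝 0) (𝓝 0) := by
      have := hσπ.continuousAt.tendsto
      rwa [map_zero, hσ0] at this
    filter_upwards [h1.eventually hφ0] with x hx hx0
    rw [hx0, hx, hπ, projAlong_eq_self hx0]
  · filter_upwards [hder, hjt.eventually hφX] with x h1 h2
    rw [h1, hξ, hπ, projAlong_self hξ, map_zero, ← hπ, h2]
  · intro v
    have hι : Tendsto (fun x : E => ((0 : ℝ), x)) (𝓝 0) (𝓝 0) :=
      Continuous.tendsto_zero (by fun_prop) rfl
    have h0 : φ 0 = 0 := hφ0.self_of_nhds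
    have h1 : ∀ w, fderiv ℝ φ 0 (0, w) = w := by
      intro w
      have h2 : HasFDerivAt (fun x : E => φ (0, x))
          ((fderiv ℝ φ 0).comp (ContinuousLinearMap.inr ℝ ℝ E)) 0 :=
        HasFDerivAt.comp (g := φ) (0 : E) hφ.differentiableAt.hasFDerivAt
          (ContinuousLinearMap.inr ℝ ℝ E).hasFDerivAt
      have h3 : (fun x : E => φ (0, x)) =ᶠ[𝓝 0] id := hφ0
      exact DFunLike.congr_fun
        ((h2.congr_of_eventuallyEq h3.symm).unique (hasFDerivAt_id 0)) w
    have h2 : fderiv ℝ φ 0 (1, 0) = X 0 := by rw [hφX.self_of_nhds, h0]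
    rw [hder.self_of_nhds, hj0, map_zero]
    have h3 : (ξ v, fderiv ℝ σ 0 (π v)) = ξ v • ((1 : ℝ), (0 : E)) + (0, fderiv ℝ σ 0 (π v)) := by
      simp
    rw [h3, map_add, map_smul, h1, h2]

end Projection

section CubicNondegenerate

variable {Y : Type} [NormedAddCommGroup Y] [NormedSpace ℝ Y]

theorem cubic_unfolding_nondegenerate {h θ : ℝ × Y → ℝ} {a b : Y → ℝ} (hθ : SmoothNear θ 0)
    (ha : SmoothNear a 0) (hb : SmoothNear b 0) (hθ0 : θ 0 = 0) (ha0 : a 0 = 0)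
    (hh : ∀ᶠ p in 𝓝 (0 : ℝ × Y), h p = θ p ^ 3 - a p.2 * θ p + b p.2)
    (hd : fderiv ℝ (fun p => fderiv ℝ h p (1, 0)) 0 ≠ 0) :
    fderiv ℝ θ 0 (1, 0) ≠ 0 ∧ fderiv ℝ a 0 ≠ 0 := by
  have hsnd : Tendsto (Prod.snd : ℝ × Y → Y) (𝓝 0) (𝓝 0) := continuous_snd.tendsto _
  have h1 : (fun p => fderiv ℝ h p (1, 0)) =ᶠ[𝓝 0]
      fun p => (3 * θ p ^ 2 - a p.2) * fderiv ℝ θ p (1, 0) := by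
    filter_upwards [eventually_eventually_nhds.2 hh, hθ, hsnd.eventually ha, hsnd.eventually hb]
      with p h1 h2 h3 h4
    have h5 := (h2.differentiableAt (by simp)).hasFDerivAt
    have h6 : HasFDerivAt (fun p : ℝ × Y => a p.2) _ p :=
      (h3.differentiableAt (by simp)).hasFDerivAt.comp p hasFDerivAt_snd
    have h7 : HasFDerivAt (fun p : ℝ × Y => b p.2) _ p :=
      (h4.differentiableAt (by simp)).hasFDerivAt.comp p hasFDerivAt_snd
    have h8 := ((h5.pow 3).sub (h6.mul h5)).add h7
    have h9 : HasFDerivAt (fun x => θ x ^ 3 - a x.2 * θ x + b x.2) _ p := h8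
    rw [Filter.EventuallyEq.fderiv_eq h1, h9.fderiv]
    simp
    ring
  have h5 := hθ.differentiableAt.hasFDerivAt
  have h6 : HasFDerivAt (fun p : ℝ × Y => a p.2)
      ((fderiv ℝ a 0).comp (ContinuousLinearMap.snd ℝ ℝ Y)) 0 :=
    HasFDerivAt.comp (g := a) (0 : ℝ × Y) ha.differentiableAt.hasFDerivAt hasFDerivAt_snd
  have h7 : DifferentiableAt ℝ (fun p => fderiv ℝ θ p (1, 0)) 0 :=
    (hθ.fderiv_right.clm_apply (contDiff_const.smoothNear _)).differentiableAt
  have h8 := (((h5.pow 2).const_mul 3).sub h6).mul h7.hasFDerivAt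
  have h8' : HasFDerivAt (fun p => (3 * θ p ^ 2 - a p.2) * fderiv ℝ θ p (1, 0)) _ 0 := h8
  have h9 : fderiv ℝ (fun p => fderiv ℝ h p (1, 0)) 0 =
      -(fderiv ℝ θ 0 (1, 0) • (fderiv ℝ a 0).comp (ContinuousLinearMap.snd ℝ ℝ Y)) := by
    rw [h1.fderiv_eq, h8'.fderiv]
    simp [hθ0, ha0]
  rw [h9] at hd
  constructor
  · rintro h
    simp [h] at hd
  · rintro h
    simp [h] at hd

end CubicNondegenerate

section FlowBoxForms

variable {E F V : Type} [NormedAddCommGroup E] [NormedSpace ℝ E]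
  [NormedAddCommGroup F] [NormedSpace ℝ F] [NormedAddCommGroup V] [NormedSpace ℝ V]

theorem SmoothNear.tendsto_zero {f : E → F} (hf : SmoothNear f 0) (h0 : f 0 = 0) :
    Tendsto f (𝓝 0) (𝓝 0) := by
  have := hf.continuousAt.tendsto
  rwa [h0] at this

/-- The flow of a vector field in the kernel of `dμ` preserves `dμ`. -/
theorem oneFormDeriv_flowBox [FiniteDimensional ℝ V] {μ : E → E →L[ℝ] ℝ}
    (hμ : SmoothNear μ 0) {X : E → E}
    (hX : ∀ᶠ x in 𝓝 (0 : E), ∀ v, oneFormDeriv μ x (X x) v = 0) {Φ : V → E}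
    (hΦ : SmoothNear Φ 0) (hΦ0 : Φ 0 = 0) {ξ : V →L[ℝ] ℝ} {e : V} (hξ : ξ e = 1)
    (hΦX : ∀ᶠ x in 𝓝 (0 : V), fderiv ℝ Φ x e = X (Φ x)) :
    ∀ᶠ x in 𝓝 (0 : V), ∀ u v,
      oneFormDeriv μ (Φ x) (fderiv ℝ Φ x u) (fderiv ℝ Φ x v) =
        oneFormDeriv μ (Φ (projAlong ξ e x)) (fderiv ℝ Φ (projAlong ξ e x) (projAlong ξ e u))
          (fderiv ℝ Φ (projAlong ξ e x) (projAlong ξ e v)) := by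
  have hΦt := hΦ.tendsto_zero hΦ0
  have hν : SmoothNear (oneFormPullback Φ μ) 0 := SmoothNear.oneFormPullback (by rwa [hΦ0]) hΦ
  have h1 : ∀ᶠ x in 𝓝 (0 : V), ∀ u v, oneFormDeriv (oneFormPullback Φ μ) x u v =
      oneFormDeriv μ (Φ x) (fderiv ℝ Φ x u) (fderiv ℝ Φ x v) := by
    filter_upwards [hΦt.eventually hμ, hΦ.eventually] with x h1 h2 u v
    exact oneFormDeriv_pullback (h1.differentiableAt (by simp)) h2 u v
  obtain ⟨f, hf, hfν⟩ := hν.exists_fderiv_add_basic hξ (by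
    filter_upwards [h1, hΦX, hΦt.eventually hX] with x h1 h2 h3 v
    rw [h1, h2, h3])
  have hπ := tendsto_projAlong ξ e
  filter_upwards [h1, hπ.eventually h1, eventually_eventually_nhds.2 hfν,
    hπ.eventually hν.eventually] with x h2 h3 h4 h5 u v
  rw [← h2, ← h3]
  have h6 : oneFormPullback Φ μ =ᶠ[𝓝 x] fun x => fderiv ℝ f x +
      oneFormPullback (projAlong ξ e) (oneFormPullback Φ μ) x := by
    filter_upwards [h4] with y hy
    ext v
    rw [hy, add_apply]
    simp [oneFormPullback]
  have hπs := (projAlong ξ e).contDiff.smoothNear x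
  rw [oneFormDeriv_congr h6, oneFormDeriv_add
    ((hf.fderiv_right (by simp : ∞ + 1 ≤ ∞)).differentiable (by simp)).differentiableAt
    (SmoothNear.oneFormPullback h5 hπs).differentiableAt,
    oneFormDeriv_fderiv (hf.smoothNear x), zero_add,
    oneFormDeriv_pullback h5.differentiableAt hπs]
  simp

end FlowBoxForms

section Solve

variable {E F F' Y : Type} [NormedAddCommGroup E] [NormedSpace ℝ E]
  [NormedAddCommGroup F] [NormedSpace ℝ F] [NormedAddCommGroup F'] [NormedSpace ℝ F']
  [NormedAddCommGroup Y] [NormedSpace ℝ Y]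

theorem SmoothNear.exists_solution [CompleteSpace F] {B : E → F →L[ℝ] F'} {g : E → F'} {x : E}
    (hB : SmoothNear B x) (hg : SmoothNear g x) (B₀ : F ≃L[ℝ] F')
    (hB₀ : (B₀ : F →L[ℝ] F') = B x) :
    ∃ W : E → F, SmoothNear W x ∧ ∀ᶠ y in 𝓝 x, B y (W y) = g y := by
  have h1 : ∀ᶠ y in 𝓝 x, B y ∈ Set.range ((↑) : (F ≃L[ℝ] F') → F →L[ℝ] F') := by
    refine hB.continuousAt.eventually ?_
    rw [← hB₀]
    exact ContinuousLinearEquiv.nhds B₀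
  refine ⟨fun y => (B y).inverse (g y), ?_, ?_⟩
  · have h2 : SmoothNear (fun y => (B y).inverse) x := by
      filter_upwards [hB, h1] with y hy ⟨e, he⟩
      have h3 : ContDiffAt ℝ ∞ ContinuousLinearMap.inverse (B y) := by
        rw [← he]
        exact contDiffAt_map_inverse e
      exact h3.comp y hy
    exact h2.clm_apply hg
  · filter_upwards [h1] with y ⟨e, he⟩
    rw [← he, ContinuousLinearMap.inverse_equiv]
    simp

theorem SmoothNear.sub_flip {A : E → Y →L[ℝ] Y →L[ℝ] ℝ} {x : E} (hA : SmoothNear A x) :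
    SmoothNear (fun y => A y - (A y).flip) x := by
  refine hA.sub ?_
  exact SmoothNear.comp (g := ContinuousLinearMap.flipₗᵢ ℝ Y Y ℝ)
    ((LinearIsometryEquiv.contDiff _).smoothNear _) hA

theorem exists_equiv_of_nondegenerate [FiniteDimensional ℝ Y] (Ω : Y →L[ℝ] Y →L[ℝ] ℝ)
    (h : ∀ u, (∀ v, Ω u v = 0) → u = 0) :
    ∃ B : Y ≃L[ℝ] (Y →L[ℝ] ℝ), (B : Y →L[ℝ] Y →L[ℝ] ℝ) = Ω := by
  have h1 : Function.Injective Ω.toLinearMap := by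
    rw [injective_iff_map_eq_zero]
    intro u hu
    exact h u fun v => DFunLike.congr_fun hu v
  have h2 : Module.finrank ℝ Y = Module.finrank ℝ (Y →L[ℝ] ℝ) := by
    rw [← LinearEquiv.finrank_eq (LinearMap.toContinuousLinearMap (𝕜 := ℝ) (E := Y) (F' := ℝ))]
    exact Subspace.dual_finrank_eq.symm
  refine ⟨(Ω.toLinearMap.linearEquivOfInjective h1 h2).toContinuousLinearEquiv, ?_⟩
  ext u v
  rfl

end Solve

section Isotopy

variable {Y : Type} [NormedAddCommGroup Y] [NormedSpace ℝ Y] [FiniteDimensional ℝ Y]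

/-- Moser's method: a family of one-forms on `Y` with nondegenerate exterior derivative is
rectified, up to exact forms, by an isotopy. -/
theorem exists_isotopy {N : ℝ × Y → Y →L[ℝ] ℝ} (hN : SmoothNear N 0)
    (hnd : ∀ u, (∀ v, fderiv ℝ N 0 (0, u) v - fderiv ℝ N 0 (0, v) u = 0) → u = 0)
    (hN0 : ∀ᶠ t in 𝓝 (0 : ℝ), N (t, 0) = 0) {ℓ : Y →L[ℝ] ℝ}
    (hℓ : ∀ᶠ p in 𝓝 (0 : ℝ × Y), ∀ u,
      (∀ v, fderiv ℝ N p (0, u) v - fderiv ℝ N p (0, v) u = -fderiv ℝ N p (1, 0) v) → ℓ u = 0) :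
    ∃ φ : ℝ × Y → Y, SmoothNear φ 0 ∧ (∀ᶠ t in 𝓝 (0 : ℝ), φ (t, 0) = 0) ∧
      (∀ᶠ p in 𝓝 (0 : ℝ × Y), ℓ (φ p) = ℓ p.2) ∧
      ∀ᶠ p in 𝓝 (0 : ℝ × Y), ∀ u v,
        fderiv ℝ N (p.1, φ p) (0, fderiv ℝ φ p (0, u)) (fderiv ℝ φ p (0, v)) -
          fderiv ℝ N (p.1, φ p) (0, fderiv ℝ φ p (0, v)) (fderiv ℝ φ p (0, u)) =
        fderiv ℝ N (0, p.2) (0, u) v - fderiv ℝ N (0, p.2) (0, v) u := by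
  have hslice : Tendsto (fun t : ℝ => (t, (0 : Y))) (𝓝 0) (𝓝 0) :=
    Continuous.tendsto_zero (by fun_prop) rfl
  have hN' : SmoothNear (fun p => (fderiv ℝ N p).comp (ContinuousLinearMap.inr ℝ ℝ Y)) 0 :=
    hN.fderiv_right.clm_comp (contDiff_const.smoothNear _)
  obtain ⟨B, hB⟩ := exists_equiv_of_nondegenerate _ (fun u hu => hnd u hu :
    ∀ u, (∀ v, ((fun A : Y →L[ℝ] Y →L[ℝ] ℝ => A - A.flip)
      ((fderiv ℝ N 0).comp (ContinuousLinearMap.inr ℝ ℝ Y))) u v = 0) → u = 0)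
  have hg : SmoothNear (fun p => -fderiv ℝ N p (1, 0)) 0 := by
    have := hN.fderiv_right.clm_apply (contDiff_const (c := ((1 : ℝ), (0 : Y))).smoothNear _)
    simpa using (contDiff_const (c := (0 : Y →L[ℝ] ℝ)).smoothNear _).sub this
  obtain ⟨X, hX, hXs⟩ := hN'.sub_flip.exists_solution hg B hB
  replace hXs : ∀ᶠ p in 𝓝 (0 : ℝ × Y), ∀ v,
      fderiv ℝ N p (0, X p) v - fderiv ℝ N p (0, v) (X p) = -fderiv ℝ N p (1, 0) v := by
    filter_upwards [hXs] with p hp v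
    exact DFunLike.congr_fun hp v
  have hX0 : ∀ᶠ t in 𝓝 (0 : ℝ), X (t, 0) = 0 := by
    have h1 : ∀ᶠ t in 𝓝 (0 : ℝ), ∀ u, (∀ v, fderiv ℝ N (t, 0) (0, u) v -
        fderiv ℝ N (t, 0) (0, v) u = 0) → u = 0 := by
      have h2 := hslice.eventually (hN'.sub_flip.continuousAt.eventually
        (by rw [← hB]; exact ContinuousLinearEquiv.nhds B))
      filter_upwards [h2] with t ⟨e, he⟩ u hu
      have h3 : e u = 0 := by
        have h4 : (e : Y →L[ℝ] Y →L[ℝ] ℝ) u = 0 := by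
          rw [he]
          ext v
          exact hu v
        exact h4
      exact e.map_eq_zero_iff.1 h3
    filter_upwards [h1, hslice.eventually hXs, hslice.eventually hN,
      eventually_eventually_nhds.2 hN0] with t h1 h2 h3 h4
    refine h1 _ fun v => ?_
    rw [h2]
    have h5 : HasDerivAt (fun s : ℝ => N (s, 0)) (fderiv ℝ N (t, 0) (1, 0)) t :=
      HasFDerivAt.comp_hasDerivAt (l := N) t (h3.differentiableAt (by simp)).hasFDerivAt
        ((hasDerivAt_id t).prodMk (hasDerivAt_const t (0 : Y)))
    have h6 : (fun s : ℝ => N (s, 0)) =ᶠ[𝓝 t] fun _ => 0 := h4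
    rw [(h5.congr_of_eventuallyEq h6.symm).unique (hasDerivAt_const t _)]
    simp
  have hX00 : X 0 = 0 := hX0.self_of_nhds
  let Λ : ℝ × Y → (ℝ × Y) →L[ℝ] ℝ := fun p => (N p).comp (ContinuousLinearMap.snd ℝ ℝ Y)
  have hΛ : SmoothNear Λ 0 := hN.clm_comp (contDiff_const.smoothNear _)
  have hΛd : ∀ᶠ p in 𝓝 (0 : ℝ × Y), ∀ u v, oneFormDeriv Λ p u v =
      fderiv ℝ N p u v.2 - fderiv ℝ N p v u.2 := by
    filter_upwards [hN] with p hp u v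
    have h1 := (hp.differentiableAt (by simp)).hasFDerivAt.clm_comp
      (hasFDerivAt_const (ContinuousLinearMap.snd ℝ ℝ Y) p)
    have h2 : HasFDerivAt Λ _ p := h1
    rw [oneFormDeriv, h2.fderiv]
    simp
  have hsplit : ∀ p (s : ℝ) (u : Y), fderiv ℝ N p (s, u) =
      s • fderiv ℝ N p (1, 0) + fderiv ℝ N p (0, u) := by
    intro p s u
    rw [← map_smul, ← map_add]
    simp
  let Xh : ℝ × Y → ℝ × Y := fun p => (1, X p)
  have hXh : SmoothNear Xh 0 := (contDiff_const.smoothNear _).prodMk hX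
  have hker : ∀ᶠ p in 𝓝 (0 : ℝ × Y), ∀ v, oneFormDeriv Λ p (Xh p) v = 0 := by
    filter_upwards [hΛd, hXs] with p h1 h2 v
    have h3 := h2 (X p)
    have h4 := h2 v.2
    rw [sub_self] at h3
    rw [h1, hsplit p 1 (X p), ← Prod.mk.eta (p := v), hsplit p v.1 v.2]
    simp only [add_apply, smul_apply, smul_eq_mul, Xh]
    linear_combination h4 - v.1 * h3
  have hξ : ContinuousLinearMap.fst ℝ ℝ Y ((1 : ℝ), (0 : Y)) = 1 := rfl
  obtain ⟨Φ, hΦ, hΦσ, hΦX, hΦd⟩ := exists_flowBox hξ hXh (σ := id) (contDiff_id.smoothNear 0) rfl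
  set π := projAlong (ContinuousLinearMap.fst ℝ ℝ Y) ((1 : ℝ), (0 : Y)) with hπ
  have hπp : ∀ p : ℝ × Y, π p = (0, p.2) := by
    rintro ⟨t, y⟩
    simp [hπ, projAlong_apply]
  have hπt : Tendsto π (𝓝 0) (𝓝 0) := tendsto_projAlong _ _
  have hΦπ : ∀ᶠ p in 𝓝 (0 : ℝ × Y), Φ (π p) = π p := by
    filter_upwards [hπt.eventually hΦσ] with p hp
    exact hp (by rw [hπp]; rfl)
  have hΦ0 : Φ 0 = 0 := by
    have := hΦπ.self_of_nhds
    rwa [map_zero] at this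
  have hΦt := hΦ.tendsto_zero hΦ0
  have hinv : ∀ L : ℝ × Y →L[ℝ] ℝ, ∀ c : ℝ, (∀ᶠ p in 𝓝 0, L (Xh p) = c) → L (1, 0) = c →
      ∀ᶠ p in 𝓝 0, L (Φ p) = L p := by
    intro L c hc hc'
    have h1 : SmoothNear (fun p => L (Φ p - p)) 0 :=
      SmoothNear.comp (g := L) (L.contDiff.smoothNear _) (hΦ.sub (contDiff_id.smoothNear _))
    have h2 := h1.eventually_eq_projAlong (e := ((1 : ℝ), (0 : Y)))
      (ContinuousLinearMap.fst ℝ ℝ Y) (by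
        filter_upwards [hΦ, hΦX, hΦt.eventually hc] with p h1 h2 h3
        have h4 : HasFDerivAt (fun p => L (Φ p - p)) _ p :=
          L.hasFDerivAt.comp p ((h1.differentiableAt (by simp)).hasFDerivAt.sub (hasFDerivAt_id p))
        rw [h4.fderiv]
        simp [h2, h3, hc'])
    filter_upwards [h2, hΦπ] with p h2 h3
    rw [← hπ, h3, sub_self, map_zero, map_sub] at h2
    linarith
  have hΦ1 : ∀ᶠ p in 𝓝 (0 : ℝ × Y), (Φ p).1 = p.1 :=
    hinv (ContinuousLinearMap.fst ℝ ℝ Y) 1 (Eventually.of_forall fun _ => rfl) rfl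
  have hφ : SmoothNear (fun p => (Φ p).2) 0 :=
    SmoothNear.comp (g := Prod.snd) (contDiff_snd.smoothNear _) hΦ
  have hΦder : ∀ᶠ p in 𝓝 (0 : ℝ × Y), ∀ u,
      fderiv ℝ Φ p (0, u) = (0, fderiv ℝ (fun p => (Φ p).2) p (0, u)) := by
    filter_upwards [hΦ, eventually_eventually_nhds.2 hΦ1] with p h1 h2 u
    have h3 := (h1.differentiableAt (by simp)).hasFDerivAt
    have h4 : HasFDerivAt (fun p => (Φ p).2) ((ContinuousLinearMap.snd ℝ ℝ Y).comp _) p :=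
      hasFDerivAt_snd.comp p h3
    have h5 : HasFDerivAt (fun p => (Φ p).1) ((ContinuousLinearMap.fst ℝ ℝ Y).comp _) p :=
      hasFDerivAt_fst.comp p h3
    have h6 : (fun p => (Φ p).1) =ᶠ[𝓝 p] fun p => p.1 := h2
    have h7 := (h5.congr_of_eventuallyEq h6.symm).unique hasFDerivAt_fst
    rw [h4.fderiv]
    exact Prod.ext (DFunLike.congr_fun h7 (0, u)) rfl
  have hΦder0 : ∀ᶠ p in 𝓝 (0 : ℝ × Y), ∀ u, fderiv ℝ Φ (π p) (0, u) = (0, u) := by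
    filter_upwards [eventually_eventually_nhds.2 hΦπ, hπt.eventually hΦ] with p h1 h2 u
    have h3 : HasFDerivAt (fun p => Φ (π p)) _ p :=
      (h2.differentiableAt (by simp)).hasFDerivAt.comp p π.hasFDerivAt
    have h4 : (fun p => Φ (π p)) =ᶠ[𝓝 p] π := h1
    have h5 := DFunLike.congr_fun
      ((h3.congr_of_eventuallyEq h4.symm).unique π.hasFDerivAt) (0, u)
    simpa [hπp] using h5
  refine ⟨fun p => (Φ p).2, hφ, ?_, ?_, ?_⟩
  · obtain ⟨K, s, hs, hK⟩ := (hXh.contDiffAt.of_le (by simp)).exists_lipschitzOnWith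
    have h1 : (fun t : ℝ => Φ (t, 0)) =ᶠ[𝓝 0] fun t => (t, 0) := by
      refine ODE_solution_unique_of_eventually (v := fun _ => Xh) (s := fun _ => s) (K := K)
        (Eventually.of_forall fun _ => hK) ?_ ?_ (by exact hΦ0)
      · filter_upwards [hslice.eventually hΦ, hslice.eventually hΦX,
          (hΦt.comp hslice).eventually hs] with t h1 h2 h3
        refine ⟨?_, h3⟩
        rw [← h2]
        exact HasFDerivAt.comp_hasDerivAt (l := Φ) t (h1.differentiableAt (by simp)).hasFDerivAt
          ((hasDerivAt_id t).prodMk (hasDerivAt_const t (0 : Y)))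
      · filter_upwards [hX0, hslice.eventually hs] with t h1 h2
        refine ⟨?_, h2⟩
        simp only [Xh, h1]
        exact (hasDerivAt_id t).prodMk (hasDerivAt_const t (0 : Y))
    filter_upwards [h1] with t ht
    rw [ht]
  · refine hinv (ℓ.comp (ContinuousLinearMap.snd ℝ ℝ Y)) 0 ?_ (by simp)
    filter_upwards [hXs, hℓ] with p h1 h2
    exact h2 _ h1
  · filter_upwards [oneFormDeriv_flowBox hΛ hker hΦ hΦ0 hξ hΦX, hΦ1, hΦder, hΦder0, hΦπ,
      hΦt.eventually hΛd, hπt.eventually hΛd] with p h1 h2 h3 h4 h5 h6 h7 u v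
    have h8 := h1 (0, u) (0, v)
    rw [← hπ, hπp (0, u), hπp (0, v), h4, h4, h5, h6, h7, h3, h3, hπp] at h8
    have h9 : (p.1, (Φ p).2) = Φ p := Prod.ext h2.symm rfl
    rw [h9]
    exact h8

end Isotopy

section Moser

variable {Y : Type} [NormedAddCommGroup Y] [NormedSpace ℝ Y] [FiniteDimensional ℝ Y]

theorem exists_hadamard_oneForm {M : Y → Y →L[ℝ] ℝ} (hM : ContDiff ℝ ∞ M) :
    ∃ K : Y → Y →L[ℝ] Y →L[ℝ] ℝ, ContDiff ℝ ∞ K ∧ (∀ x, K x x = M x - M 0) ∧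
      K 0 = fderiv ℝ M 0 := by
  have hA : Continuous fun s : ℝ => s • ContinuousLinearMap.id ℝ Y := by fun_prop
  have hM' : ContDiff ℝ ∞ (fderiv ℝ M) := hM.fderiv_right (by simp)
  refine ⟨fun x => ∫ s in (0 : ℝ)..1, (1 : ℝ) • fderiv ℝ M ((s • ContinuousLinearMap.id ℝ Y) x),
    contDiff_intervalIntegral_clm_comp hA continuous_const hM', fun x => ?_, by simp⟩
  have hc : Continuous fun s : ℝ => fderiv ℝ M (s • x) := by
    have := hM'.continuous
    fun_prop
  simp only [one_smul, smul_apply, ContinuousLinearMap.id_apply]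
  rw [ContinuousLinearMap.intervalIntegral_apply (hc.intervalIntegrable _ _)]
  have h1 : ∀ s : ℝ, HasDerivAt (fun s : ℝ => M (s • x)) (fderiv ℝ M (s • x) x) s := by
    intro s
    refine HasFDerivAt.comp_hasDerivAt (l := M) s
      (hM.differentiable (by simp)).differentiableAt.hasFDerivAt ?_
    simpa using (hasDerivAt_id s).smul_const x
  have hc' : Continuous fun s : ℝ => fderiv ℝ M (s • x) x := by fun_prop
  rw [intervalIntegral.integral_eq_sub_of_hasDerivAt (fun s _ => h1 s)
    (hc'.intervalIntegrable _ _)]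
  simp

/-- Darboux's theorem for a two-form that agrees with a constant one at the origin and along
a constant vector `e`, relative to the functional dual to `e`. -/
theorem exists_darboux_of_eq_const {Ω : Y →L[ℝ] Y →L[ℝ] ℝ} (halt : ∀ u v, Ω u v = -Ω v u)
    (hnd : ∀ u, (∀ v, Ω u v = 0) → u = 0) {ξ : Y →L[ℝ] ℝ} {e : Y} (hξ : ξ e = 1)
    {lam : Y → Y →L[ℝ] ℝ} (hlam : SmoothNear lam 0)
    (h0 : ∀ u v, oneFormDeriv lam 0 u v = Ω u v)
    (he : ∀ᶠ x in 𝓝 (0 : Y), ∀ v, oneFormDeriv lam x e v = Ω e v) :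
    ∃ G : Y → Y, SmoothNear G 0 ∧ G 0 = 0 ∧ (∀ᶠ x in 𝓝 (0 : Y), Ω (G x) e = Ω x e) ∧
      ∀ᶠ x in 𝓝 (0 : Y), ∀ u v,
        oneFormDeriv lam (G x) (fderiv ℝ G x u) (fderiv ℝ G x v) = Ω u v := by
  let L : Y →L[ℝ] Y →L[ℝ] ℝ := (1 / 2 : ℝ) • Ω
  have hLΩ : ∀ u v, L u v - L v u = Ω u v := by
    intro u v
    simp only [L, smul_apply, smul_eq_mul, halt v u]
    ring
  have hLd : ∀ x u v, oneFormDeriv L x u v = Ω u v := by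
    intro x u v
    rw [oneFormDeriv, L.fderiv, hLΩ]
  have hμ : SmoothNear (fun x => lam x - L x) 0 := hlam.sub (L.contDiff.smoothNear 0)
  have hμd : ∀ᶠ x in 𝓝 (0 : Y), ∀ u v,
      oneFormDeriv (fun x => lam x - L x) x u v = oneFormDeriv lam x u v - Ω u v := by
    filter_upwards [hlam] with x hx u v
    rw [oneFormDeriv_sub (hx.differentiableAt (by simp)) L.differentiableAt, hLd]
  obtain ⟨M, hM, -, hMμ⟩ := hμ.exists_contDiff
  have hMd : ∀ᶠ x in 𝓝 (0 : Y), ∀ u v,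
      oneFormDeriv M x u v = oneFormDeriv lam x u v - Ω u v := by
    filter_upwards [hμd, eventually_eventually_nhds.2 hMμ] with x h1 h2 u v
    rw [oneFormDeriv_congr h2, h1]
  obtain ⟨f, hf, hfM⟩ := (hM.smoothNear 0).exists_fderiv_add_basic hξ (by
    filter_upwards [hMd, he] with x h1 h2 v
    rw [h1, h2, sub_self])
  set π := projAlong ξ e with hπ
  have hπe : π e = 0 := projAlong_self hξ
  have hMπ : ∀ᶠ x in 𝓝 (0 : Y), ∀ u v,
      oneFormDeriv M (π x) (π u) (π v) = oneFormDeriv lam x u v - Ω u v := by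
    filter_upwards [hMd, eventually_eventually_nhds.2 hfM] with x h1 h2 u v
    rw [← h1]
    have h3 : M =ᶠ[𝓝 x] fun x => fderiv ℝ f x + oneFormPullback π M x := by
      filter_upwards [h2] with y hy
      ext v
      rw [hy, add_apply]
      simp [oneFormPullback]
    have hπs := π.contDiff.smoothNear x
    rw [oneFormDeriv_congr h3, oneFormDeriv_add
      ((hf.fderiv_right (by simp : ∞ + 1 ≤ ∞)).differentiable (by simp)).differentiableAt
      (SmoothNear.oneFormPullback (hM.smoothNear _) hπs).differentiableAt,
      oneFormDeriv_fderiv (hf.smoothNear x), zero_add,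
      oneFormDeriv_pullback (hM.differentiable (by simp)).differentiableAt hπs]
    simp
  obtain ⟨K, hK, hKM, hK0⟩ := exists_hadamard_oneForm hM
  let N : ℝ × Y → Y →L[ℝ] ℝ := fun p => L p.2 + (K (p.1 • π p.2) (π p.2)).comp π
  have hN : ContDiff ℝ ∞ N := by
    have h1 : ContDiff ℝ ∞ fun p : ℝ × Y => π p.2 := π.contDiff.comp contDiff_snd
    exact (L.contDiff.comp contDiff_snd).add
      (((hK.comp (contDiff_fst.smul h1)).clm_apply h1).clm_comp contDiff_const)
  have hNd : ∀ p, HasFDerivAt N (fderiv ℝ N p) p := fun p =>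
    (hN.differentiable (by simp)).differentiableAt.hasFDerivAt
  have hNv : ∀ (t : ℝ) x u v (D : Y →L[ℝ] ℝ), HasFDerivAt (fun x => N (t, x) v) D x →
      fderiv ℝ N (t, x) (0, u) v = D u := by
    intro t x u v D hD
    have h1 : HasFDerivAt (fun x => N (t, x))
        ((fderiv ℝ N (t, x)).comp (ContinuousLinearMap.inr ℝ ℝ Y)) x := by
      refine HasFDerivAt.comp (g := N) x (hNd (t, x)) ?_
      exact hasFDerivAt_prodMk_right t x
    have h2 := h1.clm_apply (hasFDerivAt_const v x)
    have h3 := DFunLike.congr_fun (h2.unique hD) u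
    simpa using h3
  have hLv : ∀ v x, HasFDerivAt (fun x => L x v) (L.flip v) x := fun v x =>
    (L.flip v).hasFDerivAt
  have hN1 : ∀ x u v, fderiv ℝ N (0, x) (0, u) v - fderiv ℝ N (0, x) (0, v) u = Ω u v := by
    have h1 : ∀ x u v, fderiv ℝ N (0, x) (0, u) v = L u v + fderiv ℝ M 0 (π u) (π v) := by
      intro x u v
      have h2 : (fun x => N (0, x) v) = ⇑(L.flip v + ((fderiv ℝ M 0).flip (π v)).comp π) := by
        funext x
        simp [N, hK0]
      have h3 := (L.flip v + ((fderiv ℝ M 0).flip (π v)).comp π).hasFDerivAt (x := x)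
      rw [← h2] at h3
      rw [hNv 0 x u v _ h3]
      rfl
    intro x u v
    have h2 := hMπ.self_of_nhds u v
    rw [h0, sub_self, map_zero, oneFormDeriv] at h2
    rw [h1, h1, ← hLΩ]
    linear_combination h2
  have hN2 : ∀ t : ℝ, t ≠ 0 → ∀ x u v,
      fderiv ℝ N (t, x) (0, u) v - fderiv ℝ N (t, x) (0, v) u =
        Ω u v + oneFormDeriv M (π (t • x)) (π u) (π v) := by
    intro t ht
    have h1 : ∀ x u v, fderiv ℝ N (t, x) (0, u) v =
        L u v + fderiv ℝ M (π (t • x)) (π u) (π v) := by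
      intro x u v
      have h2 : (fun x => N (t, x) v) =
          fun x => L x v + t⁻¹ * (M (π (t • x)) (π v) - M 0 (π v)) := by
        funext x
        have h3 := DFunLike.congr_fun (hKM (t • π x)) (π v)
        simp only [map_smul, smul_apply, smul_eq_mul, sub_apply] at h3
        simp only [N, add_apply, ContinuousLinearMap.comp_apply, map_smul]
        rw [← h3, inv_mul_cancel_left₀ ht]
      have h4 : HasFDerivAt (fun x : Y => π (t • x)) (π.comp (t • ContinuousLinearMap.id ℝ Y)) x :=
        (π.comp (t • ContinuousLinearMap.id ℝ Y)).hasFDerivAt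
      have h5 : HasFDerivAt (fun x : Y => M (π (t • x)))
          ((fderiv ℝ M (π (t • x))).comp (π.comp (t • ContinuousLinearMap.id ℝ Y))) x :=
        HasFDerivAt.comp (g := M) x (hM.differentiable (by simp)).differentiableAt.hasFDerivAt h4
      have h6 : HasFDerivAt (fun x => t⁻¹ * (M (π (t • x)) (π v) - M 0 (π v))) _ x :=
        ((h5.clm_apply (hasFDerivAt_const (π v) x)).sub_const (M 0 (π v))).const_mul t⁻¹
      have h7 := (hLv v x).add h6
      have h8 : HasFDerivAt (fun x : Y => N (t, x) v) _ x := h7.congr_of_eventuallyEq (by rw [h2]; rfl)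
      rw [hNv t x u v _ h8]
      simp [inv_mul_cancel_left₀ ht]
    intro x u v
    rw [h1, h1, ← hLΩ, oneFormDeriv]
    ring
  obtain ⟨φ, hφ, hφ0, hφℓ, hφN⟩ := exists_isotopy (hN.smoothNear 0)
    (fun u hu => hnd u fun v => by rw [← hN1 0 u v]; exact hu v)
    (Eventually.of_forall fun t => by simp [N]) (ℓ := Ω.flip e) (by
      refine Eventually.of_forall fun p u hu => ?_
      have h1 : ∀ w, fderiv ℝ N p w e = L w.2 e := by
        intro w
        have h2 := (hNd p).clm_apply (hasFDerivAt_const e p)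
        have h3 : (fun p => N p e) = (L.flip e).comp (ContinuousLinearMap.snd ℝ ℝ Y) := by
          funext p
          simp [N, hπe]
        rw [h3] at h2
        have h4 := DFunLike.congr_fun (h2.unique (ContinuousLinearMap.hasFDerivAt _)) w
        simpa using h4
      have h5 : fderiv ℝ N p (0, e) = L e := by
        have h6 : HasDerivAt (fun s : ℝ => (p.1, p.2 + s • e)) ((0 : ℝ), e) 0 := by
          refine (hasDerivAt_const _ _).prodMk ?_
          simpa using ((hasDerivAt_id (0 : ℝ)).smul_const e).const_add p.2
        have h7 := (hNd p).comp_hasDerivAt_of_eq (0 : ℝ) h6 (by simp)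
        have h8 : (N ∘ fun s : ℝ => (p.1, p.2 + s • e)) = fun s => N p + s • L e := by
          funext s
          simp only [N, Function.comp, map_add, map_smul, hπe, smul_zero, add_zero]
          abel
        rw [h8] at h7
        refine h7.unique ?_
        simpa using ((hasDerivAt_id (0 : ℝ)).smul_const (L e)).const_add (N p)
      have h9 := hu e
      rw [h1, h1, h5] at h9
      simpa [hLΩ] using h9)
  have hslice : Tendsto (fun t : ℝ => (t, (0 : Y))) (𝓝 0) (𝓝 0) :=
    Continuous.tendsto_zero (by fun_prop) rfl
  obtain ⟨t, ⟨ht0, htφ, htℓ, htN, hts⟩, ht : t ≠ 0⟩ :=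
    (((hφ0.and ((hslice.eventually (eventually_eventually_nhds.2 hφ)).and
      ((hslice.eventually (eventually_eventually_nhds.2 hφℓ)).and
      ((hslice.eventually (eventually_eventually_nhds.2 hφN)).and
      (hslice.eventually hφ))))).filter_mono nhdsWithin_le_nhds).and
      (self_mem_nhdsWithin : {(0 : ℝ)}ᶜ ∈ 𝓝[≠] (0 : ℝ))).exists
  have hj : ContDiff ℝ ∞ fun x : Y => (t, t⁻¹ • x) :=
    contDiff_const.prodMk (contDiff_id.const_smul t⁻¹)
  have hjt : Tendsto (fun x : Y => (t, t⁻¹ • x)) (𝓝 0) (𝓝 (t, 0)) := by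
    have := hj.continuous.tendsto 0
    rwa [smul_zero] at this
  have hφj : SmoothNear (fun x : Y => φ (t, t⁻¹ • x)) 0 :=
    SmoothNear.comp (by rw [smul_zero]; exact htφ) (hj.smoothNear 0)
  have hG : SmoothNear (fun x : Y => t • φ (t, t⁻¹ • x)) 0 := by
    filter_upwards [hφj] with x hx
    exact hx.const_smul t
  have hG0 : t • φ (t, t⁻¹ • (0 : Y)) = 0 := by rw [smul_zero, ht0, smul_zero]
  refine ⟨fun x => t • φ (t, t⁻¹ • x), hG, hG0, ?_, ?_⟩
  · filter_upwards [hjt.eventually htℓ] with x hx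
    have h1 : Ω (φ (t, t⁻¹ • x)) e = Ω (t⁻¹ • x) e := hx
    rw [map_smul, smul_apply, h1]
    simp [mul_inv_cancel_left₀ ht]
  · filter_upwards [hjt.eventually htN, hjt.eventually htφ,
      (hG.tendsto_zero hG0).eventually hMπ] with x h1 h2 h3 u v
    have h4 : HasFDerivAt (fun x : Y => (t, t⁻¹ • x))
        ((0 : Y →L[ℝ] ℝ).prod (t⁻¹ • ContinuousLinearMap.id ℝ Y)) x :=
      (hasFDerivAt_const t x).prodMk ((hasFDerivAt_id x).const_smul t⁻¹)
    have h5 : HasFDerivAt (fun x : Y => t • φ (t, t⁻¹ • x)) _ x :=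
      (HasFDerivAt.comp (g := φ) x (h2.differentiableAt (by simp)).hasFDerivAt h4).const_smul t
    have h6 : ∀ w, fderiv ℝ (fun x : Y => t • φ (t, t⁻¹ • x)) x w =
        fderiv ℝ φ (t, t⁻¹ • x) (0, w) := by
      intro w
      rw [h5.fderiv]
      simp only [smul_apply, ContinuousLinearMap.comp_apply, ContinuousLinearMap.prod_apply,
        zero_apply, ContinuousLinearMap.id_apply]
      rw [← map_smul, Prod.smul_mk, smul_zero, smul_inv_smul₀ ht]
    rw [h6, h6]
    have h7 := h1 u v
    rw [hN1, hN2 t ht, h3] at h7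
    rw [← h7]
    ring

end Moser

section Darboux

variable {Y Y' : Type} [NormedAddCommGroup Y] [NormedSpace ℝ Y] [FiniteDimensional ℝ Y]
  [NormedAddCommGroup Y'] [NormedSpace ℝ Y']

theorem exists_darboux_of_eq_at_zero {Ω : Y →L[ℝ] Y →L[ℝ] ℝ} (halt : ∀ u v, Ω u v = -Ω v u)
    (hnd : ∀ u, (∀ v, Ω u v = 0) → u = 0) {e : Y} (he : e ≠ 0)
    {lam : Y → Y →L[ℝ] ℝ} (hlam : SmoothNear lam 0) (h0 : ∀ u v, oneFormDeriv lam 0 u v = Ω u v)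
    {a : Y → ℝ} (ha : SmoothNear a 0) (ha0 : a 0 = 0) (hda : ∀ v, fderiv ℝ a 0 v = Ω v e) :
    ∃ G : Y → Y, SmoothNear G 0 ∧ G 0 = 0 ∧ (∀ᶠ x in 𝓝 (0 : Y), a (G x) = Ω x e) ∧
      ∀ᶠ x in 𝓝 (0 : Y), ∀ u v,
        oneFormDeriv lam (G x) (fderiv ℝ G x u) (fderiv ℝ G x v) = Ω u v := by
  have hself : ∀ u, Ω u u = 0 := fun u => by linarith [halt u u]
  obtain ⟨ξ, hξ⟩ := SeparatingDual.exists_eq_one (R := ℝ) he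
  obtain ⟨e', he'⟩ : ∃ e', Ω e' e = 1 := by
    obtain ⟨v, hv⟩ : ∃ v, Ω e v ≠ 0 := by
      by_contra! h
      exact he (hnd e h)
    have hv' : Ω v e ≠ 0 := by rwa [halt, neg_ne_zero]
    exact ⟨(Ω v e)⁻¹ • v, by simp [hv']⟩
  obtain ⟨σ, hσ, hσ0, hσa, hσd⟩ : ∃ σ : Y → Y, SmoothNear σ 0 ∧ σ 0 = 0 ∧
      (∀ᶠ x in 𝓝 0, a (σ x) = Ω x e) ∧ ∀ v, fderiv ℝ σ 0 v = v := by
    let A : Y → Y := fun z => z + (a z - Ω z e) • e'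
    have hA : SmoothNear A 0 := by
      filter_upwards [ha] with x hx
      have h1 : ContDiffAt ℝ ∞ (fun z => Ω z e) x := (Ω.flip e).contDiff.contDiffAt
      exact contDiffAt_id.add ((hx.sub h1).smul contDiffAt_const)
    have hA0 : A 0 = 0 := by simp [A, ha0]
    have hAd : fderiv ℝ A 0 = ContinuousLinearEquiv.refl ℝ Y := by
      have h1 : HasFDerivAt (fun z => Ω z e) (Ω.flip e) 0 := (Ω.flip e).hasFDerivAt
      have h2 : HasFDerivAt A _ 0 :=
        (hasFDerivAt_id 0).add ((ha.differentiableAt.hasFDerivAt.sub h1).smul_const e')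
      rw [h2.fderiv]
      ext v
      simp [hda]
    obtain ⟨σ, h1, h2, h3, -, h5⟩ := hA.exists_localInverse _ hAd
    rw [hA0] at h1 h2 h3 h5
    refine ⟨σ, h1, h2, ?_, fun v => by rw [h5]; rfl⟩
    filter_upwards [h3] with x hx
    have h6 : Ω (A (σ x)) e = a (σ x) := by simp [A, he']
    rw [← h6, hx]
  obtain ⟨B, hB⟩ := exists_equiv_of_nondegenerate Ω hnd
  have hBlam : (B : Y →L[ℝ] Y →L[ℝ] ℝ) = fderiv ℝ lam 0 - (fderiv ℝ lam 0).flip := by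
    rw [hB]
    ext u v
    exact (h0 u v).symm
  have hda' : SmoothNear (fun x => -fderiv ℝ a x) 0 := by
    filter_upwards [ha.fderiv_right] with x hx using hx.neg
  obtain ⟨W, hW, hWs⟩ := hlam.fderiv_right.sub_flip.exists_solution hda' B hBlam
  replace hWs : ∀ᶠ x in 𝓝 (0 : Y), ∀ v, oneFormDeriv lam x (W x) v = -fderiv ℝ a x v := by
    filter_upwards [hWs] with x hx v
    exact DFunLike.congr_fun hx v
  have hW0 : W 0 = e := by
    refine sub_eq_zero.1 (hnd _ fun v => ?_)
    rw [map_sub, sub_apply, ← h0, hWs.self_of_nhds, hda, halt e v]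
    ring
  obtain ⟨Φ, hΦ, hΦσ, hΦW, hΦd⟩ := exists_flowBox hξ hW hσ hσ0
  set π := projAlong ξ e with hπ
  have hπt : Tendsto π (𝓝 0) (𝓝 0) := tendsto_projAlong ξ e
  have hΦ0 : Φ 0 = 0 := by rw [hΦσ.self_of_nhds (map_zero _), hσ0]
  have hΦt := hΦ.tendsto_zero hΦ0
  have hΦd' : ∀ v, fderiv ℝ Φ 0 v = v := by
    intro v
    rw [hΦd, hW0, hσd, add_comm, hπ, projAlong_add]
  have haΦ : SmoothNear (fun x => a (Φ x)) 0 := SmoothNear.comp (by rwa [hΦ0]) hΦ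
  have haΦd : ∀ᶠ x in 𝓝 (0 : Y), ∀ v,
      fderiv ℝ (fun x => a (Φ x)) x v = fderiv ℝ a (Φ x) (fderiv ℝ Φ x v) := by
    filter_upwards [hΦ, hΦt.eventually ha] with x h1 h2 v
    have h3 : HasFDerivAt (fun x => a (Φ x)) _ x :=
      (h2.differentiableAt (by simp)).hasFDerivAt.comp x
        (h1.differentiableAt (by simp)).hasFDerivAt
    rw [h3.fderiv]
    rfl
  have haΦe : ∀ᶠ x in 𝓝 (0 : Y), a (Φ x) = Ω x e := by
    have h1 := haΦ.eventually_eq_projAlong ξ (e := e) (by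
      filter_upwards [haΦd, hΦW, hΦt.eventually hWs] with x h1 h2 h3
      rw [h1, h2, ← neg_eq_zero, ← h3, oneFormDeriv_self])
    filter_upwards [h1, hπt.eventually hΦσ, hπt.eventually hσa] with x h1 h2 h3
    rw [h1, ← hπ, h2 (apply_projAlong hξ x), h3, hπ, projAlong_apply]
    simp [hself]
  have hlamΦ : ∀ᶠ x in 𝓝 (0 : Y), ∀ u v, oneFormDeriv (oneFormPullback Φ lam) x u v =
      oneFormDeriv lam (Φ x) (fderiv ℝ Φ x u) (fderiv ℝ Φ x v) := by
    filter_upwards [hΦt.eventually hlam, hΦ.eventually] with x h1 h2 u v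
    exact oneFormDeriv_pullback (h1.differentiableAt (by simp)) h2 u v
  obtain ⟨G, hG, hG0, hGe, hGΩ⟩ := exists_darboux_of_eq_const halt hnd hξ
    (SmoothNear.oneFormPullback (by rwa [hΦ0]) hΦ : SmoothNear (oneFormPullback Φ lam) 0)
    (fun u v => by rw [hlamΦ.self_of_nhds, hΦ0, hΦd', hΦd', h0])
    (by
      filter_upwards [hlamΦ, hΦW, hΦt.eventually hWs, haΦd, eventually_eventually_nhds.2 haΦe]
        with x h1 h2 h3 h4 h5 v
      have h6 : (fun x => a (Φ x)) =ᶠ[𝓝 x] Ω.flip e := h5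
      rw [h1, h2, h3, ← h4, h6.fderiv_eq, ContinuousLinearMap.fderiv, halt e v]
      rfl)
  have hGt := hG.tendsto_zero hG0
  refine ⟨fun x => Φ (G x), SmoothNear.comp (by rwa [hG0]) hG, by simp only [hG0, hΦ0], ?_, ?_⟩
  · filter_upwards [hGt.eventually haΦe, hGe] with x h1 h2
    rw [h1, h2]
  · filter_upwards [hGt.eventually hlamΦ, hGΩ, hGt.eventually hΦ, hG] with x h1 h2 h3 h4 u v
    have h5 : HasFDerivAt (fun x => Φ (G x)) _ x :=
      (h3.differentiableAt (by simp)).hasFDerivAt.comp x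
        (h4.differentiableAt (by simp)).hasFDerivAt
    rw [h5.fderiv, ← h2, h1]
    rfl

/-- Darboux's theorem relative to a function: a two-form `dλ` nondegenerate at the origin and
a submersion `a` can be brought simultaneously to a constant and a linear form. -/
theorem exists_darboux {Ω : Y →L[ℝ] Y →L[ℝ] ℝ} (halt : ∀ u v, Ω u v = -Ω v u)
    (hnd : ∀ u, (∀ v, Ω u v = 0) → u = 0) {e : Y} (he : e ≠ 0) (S : Y ≃L[ℝ] Y')
    {lam : Y' → Y' →L[ℝ] ℝ} (hlam : SmoothNear lam 0)
    (h0 : ∀ u v, oneFormDeriv lam 0 (S u) (S v) = Ω u v)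
    {a : Y' → ℝ} (ha : SmoothNear a 0) (ha0 : a 0 = 0) (hda : ∀ v, fderiv ℝ a 0 (S v) = Ω v e) :
    ∃ G : Y → Y', SmoothNear G 0 ∧ G 0 = 0 ∧ (∀ᶠ x in 𝓝 (0 : Y), a (G x) = Ω x e) ∧
      ∀ᶠ x in 𝓝 (0 : Y), ∀ u v,
        oneFormDeriv lam (G x) (fderiv ℝ G x u) (fderiv ℝ G x v) = Ω u v := by
  have hS : SmoothNear S 0 := S.contDiff.smoothNear 0
  have hS0 : S 0 = 0 := map_zero S
  have hSt := hS.tendsto_zero hS0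
  have hlamS : ∀ᶠ x in 𝓝 (0 : Y), ∀ u v, oneFormDeriv (oneFormPullback S lam) x u v =
      oneFormDeriv lam (S x) (S u) (S v) := by
    filter_upwards [hSt.eventually hlam] with x h1 u v
    rw [oneFormDeriv_pullback (h1.differentiableAt (by simp)) (S.contDiff.smoothNear x), S.fderiv]
    rfl
  obtain ⟨G, hG, hG0, hGa, hGΩ⟩ := exists_darboux_of_eq_at_zero halt hnd he
    (SmoothNear.oneFormPullback (by rwa [hS0]) hS : SmoothNear (oneFormPullback S lam) 0)
    (fun u v => by rw [hlamS.self_of_nhds, hS0, h0])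
    (a := fun x => a (S x)) (SmoothNear.comp (by rwa [hS0]) hS) (by rw [hS0, ha0])
    (fun v => by
      have h1 : HasFDerivAt (fun x => a (S x)) ((fderiv ℝ a 0).comp (S : Y →L[ℝ] Y')) 0 := by
        refine HasFDerivAt.comp (g := a) 0 ?_ S.hasFDerivAt
        rw [hS0]
        exact ha.differentiableAt.hasFDerivAt
      rw [h1.fderiv, ← hda]
      rfl)
  have hGt := hG.tendsto_zero hG0
  refine ⟨fun x => S (G x), SmoothNear.comp (by rwa [hG0]) hG, by simp only [hG0, hS0], hGa, ?_⟩
  filter_upwards [hGt.eventually hlamS, hGΩ, hG] with x h1 h2 h3 u v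
  have h5 : HasFDerivAt (fun x => S (G x)) _ x :=
    S.hasFDerivAt.comp x (h3.differentiableAt (by simp)).hasFDerivAt
  rw [h5.fderiv, ← h2, h1]
  rfl

end Darboux

section SymplecticBasis

theorem exists_symplectic_family {n : ℕ} : ∀ {V : Type} [AddCommGroup V] [Module ℝ V]
    [FiniteDimensional ℝ V] (B : V →ₗ[ℝ] V →ₗ[ℝ] ℝ), (∀ u v, B u v = -B v u) →
    (∀ u, (∀ v, B u v = 0) → u = 0) → Module.finrank ℝ V = 2 * n →
    ∀ w : V, (0 < n → w ≠ 0) → ∃ p q : Fin n → V, (∀ i j, B (p i) (p j) = 0) ∧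
      (∀ i j, B (q i) (q j) = 0) ∧ (∀ i j, B (p i) (q j) = if i = j then 1 else 0) ∧
      ∀ h : 0 < n, q ⟨0, h⟩ = w := by
  induction n with
  | zero =>
    intro V _ _ _ B _ _ _ w _
    exact ⟨Fin.elim0, Fin.elim0, fun i => i.elim0, fun i => i.elim0, fun i => i.elim0,
      fun h => absurd h (lt_irrefl 0)⟩
  | succ n ih =>
    intro V _ _ _ B halt hnd hdim w hw
    have hself : ∀ u, B u u = 0 := fun u => by linarith [halt u u]
    obtain ⟨f, hf⟩ : ∃ f, B f w = 1 := by
      obtain ⟨v, hv⟩ : ∃ v, B w v ≠ 0 := by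
        by_contra! h
        exact hw n.succ_pos (hnd w h)
      have hv' : B v w ≠ 0 := by rwa [halt, neg_ne_zero]
      exact ⟨(B v w)⁻¹ • v, by simp [hv']⟩
    have hf' : B w f = -1 := by rw [halt, hf]
    let P : V →ₗ[ℝ] ℝ × ℝ := (B f).prod (B w)
    have hP : Function.Surjective P := by
      rintro ⟨s, t⟩
      refine ⟨s • w - t • f, ?_⟩
      simp [P, hf, hf', hself]
    have hker : Module.finrank ℝ (LinearMap.ker P) = 2 * n := by
      have h1 := P.finrank_range_add_finrank_ker
      rw [LinearMap.range_eq_top.2 hP, finrank_top, hdim, Module.finrank_prod,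
        Module.finrank_self] at h1
      omega
    have hmem : ∀ u : LinearMap.ker P, B f u = 0 ∧ B w u = 0 := by
      intro u
      have h := LinearMap.mem_ker.1 u.2
      exact ⟨congrArg Prod.fst h, congrArg Prod.snd h⟩
    obtain ⟨w', hw'⟩ : ∃ w' : LinearMap.ker P, 0 < n → w' ≠ 0 := by
      by_cases hn : 0 < n
      · have := Module.nontrivial_of_finrank_pos (R := ℝ) (M := LinearMap.ker P) (by omega)
        obtain ⟨w', h⟩ := exists_ne (0 : LinearMap.ker P)
        exact ⟨w', fun _ => h⟩
      · exact ⟨0, fun h => absurd h hn⟩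
    obtain ⟨p, q, hpp, hqq, hpq, -⟩ := ih
      (B.compl₁₂ (LinearMap.ker P).subtype (LinearMap.ker P).subtype) (fun u v => halt u v)
      (by
        intro u hu
        refine Subtype.ext (hnd u fun v => ?_)
        have h1 : v - (B f v) • w + (B w v) • f ∈ LinearMap.ker P := by
          rw [LinearMap.mem_ker]
          simp [P, hf, hf', hself]
        have h2 : B u (v - (B f v) • w + (B w v) • f) = 0 := hu ⟨_, h1⟩
        have h3 : B u w = 0 := by rw [halt, (hmem u).2, neg_zero]
        have h4 : B u f = 0 := by rw [halt, (hmem u).1, neg_zero]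
        simpa [h3, h4] using h2)
      hker w' hw'
    have hr : ∀ (u : LinearMap.ker P), B u f = 0 ∧ B u w = 0 := fun u => by
      rw [halt, (hmem u).1, halt, (hmem u).2]
      simp
    refine ⟨Fin.cons f fun i => (p i : V), Fin.cons w fun i => (q i : V), ?_, ?_, ?_, fun _ => rfl⟩
    · intro i j
      refine Fin.cases ?_ (fun i => ?_) i <;> refine Fin.cases ?_ (fun j => ?_) j
      · exact hself f
      · exact (hmem _).1
      · exact (hr _).1
      · exact hpp i j
    · intro i j
      refine Fin.cases ?_ (fun i => ?_) i <;> refine Fin.cases ?_ (fun j => ?_) j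
      · exact hself w
      · exact (hmem _).2
      · exact (hr _).2
      · exact hqq i j
    · intro i j
      refine Fin.cases ?_ (fun i => ?_) i <;> refine Fin.cases ?_ (fun j => ?_) j
      · simpa using hf
      · simpa [(Fin.succ_ne_zero j).symm] using (hmem (q j)).1
      · simpa using (hr (p i)).2
      · have := hpq i j
        simpa using this

/-- The standard symplectic form on `ℝⁿ × ℝⁿ`. -/
noncomputable def stdSymplectic (n : ℕ) :
    ((Fin n → ℝ) × (Fin n → ℝ)) →L[ℝ] ((Fin n → ℝ) × (Fin n → ℝ)) →L[ℝ] ℝ :=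
  ∑ i : Fin n,
    ((((ContinuousLinearMap.proj i).comp (ContinuousLinearMap.fst ℝ _ _) :
        ((Fin n → ℝ) × (Fin n → ℝ)) →L[ℝ] ℝ)).smulRight
      ((ContinuousLinearMap.proj i).comp (ContinuousLinearMap.snd ℝ _ _) :
        ((Fin n → ℝ) × (Fin n → ℝ)) →L[ℝ] ℝ) -
    (((ContinuousLinearMap.proj i).comp (ContinuousLinearMap.snd ℝ _ _) :
        ((Fin n → ℝ) × (Fin n → ℝ)) →L[ℝ] ℝ)).smulRight
      ((ContinuousLinearMap.proj i).comp (ContinuousLinearMap.fst ℝ _ _) :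
        ((Fin n → ℝ) × (Fin n → ℝ)) →L[ℝ] ℝ))

theorem stdSymplectic_apply {n : ℕ} (u v : (Fin n → ℝ) × (Fin n → ℝ)) :
    stdSymplectic n u v = ∑ i, (u.1 i * v.2 i - u.2 i * v.1 i) := by
  simp [stdSymplectic]

theorem stdSymplectic_swap {n : ℕ} (u v : (Fin n → ℝ) × (Fin n → ℝ)) :
    stdSymplectic n u v = -stdSymplectic n v u := by
  rw [stdSymplectic_apply, stdSymplectic_apply, ← Finset.sum_neg_distrib]
  exact Finset.sum_congr rfl fun i _ => by ring

theorem stdSymplectic_single_right {n : ℕ} (u : (Fin n → ℝ) × (Fin n → ℝ)) (i : Fin n) :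
    stdSymplectic n u (0, Pi.single i 1) = u.1 i := by
  simp [stdSymplectic_apply, Pi.single_apply]

theorem stdSymplectic_single_left {n : ℕ} (u : (Fin n → ℝ) × (Fin n → ℝ)) (i : Fin n) :
    stdSymplectic n u (Pi.single i 1, 0) = -u.2 i := by
  simp [stdSymplectic_apply, Pi.single_apply]

theorem stdSymplectic_nondegenerate {n : ℕ} (u : (Fin n → ℝ) × (Fin n → ℝ))
    (h : ∀ v, stdSymplectic n u v = 0) : u = 0 := by
  refine Prod.ext (funext fun i => ?_) (funext fun i => ?_)
  · rw [← stdSymplectic_single_right, h]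
    rfl
  · have := h (Pi.single i 1, 0)
    rw [stdSymplectic_single_left] at this
    simpa using this

/-- Every nondegenerate alternating form is linearly equivalent to the standard one, and the
equivalence may be prescribed on one vector. -/
theorem exists_symplectic_equiv {n : ℕ} (hn : 0 < n) {Y : Type} [NormedAddCommGroup Y]
    [NormedSpace ℝ Y] [FiniteDimensional ℝ Y] (hdim : Module.finrank ℝ Y = 2 * n)
    (B : Y →L[ℝ] Y →L[ℝ] ℝ) (halt : ∀ u v, B u v = -B v u)
    (hnd : ∀ u, (∀ v, B u v = 0) → u = 0) {w : Y} (hw : w ≠ 0) :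
    ∃ S : ((Fin n → ℝ) × (Fin n → ℝ)) ≃L[ℝ] Y,
      (∀ u v, B (S u) (S v) = stdSymplectic n u v) ∧ S (0, Pi.single ⟨0, hn⟩ 1) = w := by
  obtain ⟨p, q, hpp, hqq, hpq, hqw⟩ := exists_symplectic_family
    (ContinuousLinearMap.coeLM ℝ ∘ₗ B.toLinearMap) halt hnd hdim w fun _ => hw
  replace hpp : ∀ i j, B (p i) (p j) = 0 := hpp
  replace hqq : ∀ i j, B (q i) (q j) = 0 := hqq
  replace hpq : ∀ i j, B (p i) (q j) = if i = j then 1 else 0 := hpq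
  have hqp : ∀ i j, B (q i) (p j) = if i = j then -1 else 0 := by
    intro i j
    rw [halt, hpq]
    by_cases h : i = j
    · simp [h]
    · simp [h, Ne.symm h]
  let T : ((Fin n → ℝ) × (Fin n → ℝ)) →ₗ[ℝ] Y :=
    (Fintype.linearCombination ℝ p).coprod (Fintype.linearCombination ℝ q)
  have hT : ∀ u, T u = ∑ i, (u.1 i • p i + u.2 i • q i) := fun u => by
    simp [T, Fintype.linearCombination_apply, Finset.sum_add_distrib]
  have hTB : ∀ u v, B (T u) (T v) = stdSymplectic n u v := by
    intro u v
    rw [hT, hT, stdSymplectic_apply]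
    simp only [map_sum, map_add, map_smul, sum_apply, add_apply, smul_apply,
      hpp, hqq, hpq, hqp, smul_eq_mul, mul_zero, zero_add, add_zero, mul_ite, mul_one, mul_neg]
    refine Finset.sum_congr rfl fun i _ => ?_
    simp
    ring
  have hinj : Function.Injective T := by
    rw [injective_iff_map_eq_zero]
    intro u hu
    refine stdSymplectic_nondegenerate u fun v => ?_
    rw [← hTB, hu, map_zero, zero_apply]
  have hfin : Module.finrank ℝ ((Fin n → ℝ) × (Fin n → ℝ)) = Module.finrank ℝ Y := by
    rw [hdim, Module.finrank_prod, Module.finrank_fin_fun]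
    ring
  refine ⟨(T.linearEquivOfInjective hinj hfin).toContinuousLinearEquiv, hTB, ?_⟩
  refine (hT _).trans ?_
  rw [← hqw hn]
  simp [Pi.single_apply]

end SymplecticBasis

section NormalForm

variable {E Y : Type} [NormedAddCommGroup E] [NormedSpace ℝ E]
  [NormedAddCommGroup Y] [NormedSpace ℝ Y]

theorem SmoothNear.fderiv_comp_flow {Φ : ℝ × Y → E} (hΦ : SmoothNear Φ 0) (hΦ0 : Φ 0 = 0)
    {Z : E → E} (hΦZ : ∀ᶠ p in 𝓝 0, fderiv ℝ Φ p (1, 0) = Z (Φ p)) {f : E → ℝ}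
    (hf : SmoothNear f 0) {g : ℝ × Y → ℝ} (hg : ∀ᶠ p in 𝓝 0, g p = f (Φ p)) :
    ∀ᶠ p in 𝓝 0, fderiv ℝ g p (1, 0) = fderiv ℝ f (Φ p) (Z (Φ p)) := by
  filter_upwards [eventually_eventually_nhds.2 hg, hΦ, (hΦ.tendsto_zero hΦ0).eventually hf, hΦZ]
    with p h1 h2 h3 h4
  have h5 : HasFDerivAt (fun q => f (Φ q)) _ p :=
    (h3.differentiableAt (by simp)).hasFDerivAt.comp p (h2.differentiableAt (by simp)).hasFDerivAt
  rw [EventuallyEq.fderiv_eq h1, h5.fderiv, ← h4]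
  rfl

/-- A one-form whose differential is annihilated by a vector field is, in flow-box coordinates
of the field, the sum of an exact form and of a form pulled back from the space of orbits. -/
theorem exists_fderiv_add_pullback_snd [FiniteDimensional ℝ E] [FiniteDimensional ℝ Y]
    {α : E → E →L[ℝ] ℝ} {Z : E → E}
    (hα : SmoothNear α 0) (hZ : SmoothNear Z 0)
    (hZα : ∀ᶠ x in 𝓝 (0 : E), ∀ v, oneFormDeriv α x (Z x) v = 0)
    (T : (ℝ × Y) ≃L[ℝ] E) (hT : T (1, 0) = Z 0) :
    ∃ (Φ : ℝ × Y → E) (h : ℝ × Y → ℝ) (lam : Y → Y →L[ℝ] ℝ), SmoothNear Φ 0 ∧ Φ 0 = 0 ∧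
      fderiv ℝ Φ 0 = T ∧ SmoothNear h 0 ∧ SmoothNear lam 0 ∧
      (∀ᶠ p in 𝓝 0, fderiv ℝ Φ p (1, 0) = Z (Φ p)) ∧
      ∀ᶠ p in 𝓝 0, ∀ u, oneFormPullback Φ α p u = fderiv ℝ h p u + lam p.2 u.2 := by
  have hξ : ContinuousLinearMap.fst ℝ ℝ Y (1, 0) = 1 := rfl
  have hpr : ∀ x : ℝ × Y, projAlong (ContinuousLinearMap.fst ℝ ℝ Y) (1, 0) x = (0, x.2) := by
    intro x
    simp [projAlong_apply, Prod.ext_iff]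
  obtain ⟨Φ, hΦ, hΦσ, hΦZ, hΦd⟩ := exists_flowBox hξ hZ (T.contDiff.smoothNear 0) (map_zero T)
  have hΦ0 : Φ 0 = 0 := by rw [hΦσ.self_of_nhds rfl, map_zero]
  have hΦt := hΦ.tendsto_zero hΦ0
  have hμ : SmoothNear (oneFormPullback Φ α) 0 := SmoothNear.oneFormPullback (by rwa [hΦ0]) hΦ
  obtain ⟨h, hh, hhμ⟩ := hμ.exists_fderiv_add_basic hξ (by
    filter_upwards [hΦt.eventually hα, hΦ.eventually, hΦZ, hΦt.eventually hZα] with x h1 h2 h3 h4 v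
    rw [oneFormDeriv_pullback (h1.differentiableAt (by simp)) h2, h3, h4])
  refine ⟨Φ, h, oneFormPullback (fun y => (0, y)) (oneFormPullback Φ α), hΦ, hΦ0, ?_,
    hh.smoothNear 0, ?_, hΦZ, ?_⟩
  · refine ContinuousLinearMap.ext fun v => ?_
    rw [hΦd, T.fderiv, hpr, ← hT]
    refine (congrArg (· + _) (map_smul T v.1 _).symm).trans ?_
    refine (map_add T _ _).symm.trans (congrArg T ?_)
    simp
  · exact SmoothNear.oneFormPullback (g := fun y : Y => ((0 : ℝ), y)) hμ
      (ContDiff.smoothNear (by fun_prop) 0)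
  · filter_upwards [hhμ] with p hp u
    have h1 : HasFDerivAt (fun y : Y => ((0 : ℝ), y)) (ContinuousLinearMap.inr ℝ ℝ Y) p.2 :=
      (ContinuousLinearMap.inr ℝ ℝ Y).hasFDerivAt
    rw [hp, hpr, hpr]
    conv_rhs => rw [oneFormPullback, h1.fderiv]
    rfl

theorem oneFormPullback_comp {F G : Type} [NormedAddCommGroup F] [NormedSpace ℝ F]
    [NormedAddCommGroup G] [NormedSpace ℝ G] {f : F → G} {g : E → F} {μ : G → G →L[ℝ] ℝ} {x : E}
    (hf : DifferentiableAt ℝ f (g x)) (hg : DifferentiableAt ℝ g x) :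
    oneFormPullback (fun y => f (g y)) μ x = oneFormPullback g (oneFormPullback f μ) x := by
  have h1 : HasFDerivAt (fun y => f (g y)) _ x := hf.hasFDerivAt.comp x hg.hasFDerivAt
  rw [oneFormPullback, h1.fderiv]
  rfl

/-- Preliminary normal form of a singular contact form at a quadratic tangency. -/
theorem exists_cubic_normalForm [FiniteDimensional ℝ E] [FiniteDimensional ℝ Y]
    {α : E → E →L[ℝ] ℝ} {Z : E → E}
    (hα : SmoothNear α 0) (hZ : SmoothNear Z 0) (hα0 : α 0 = 0)
    (hZα : ∀ᶠ x in 𝓝 (0 : E), ∀ v, oneFormDeriv α x (Z x) v = 0)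
    (hspan : ∀ u, (∀ v, oneFormDeriv α 0 u v = 0) → ∃ c : ℝ, u = c • Z 0)
    (hb : fderiv ℝ (fun x => α x (Z x)) 0 ≠ 0) (hc : fderiv ℝ (fun x => α x (Z x)) 0 (Z 0) = 0)
    (hc2 : fderiv ℝ (fun x => fderiv ℝ (fun y => α y (Z y)) x (Z x)) 0 (Z 0) ≠ 0)
    (T : (ℝ × Y) ≃L[ℝ] E) (hT : T (1, 0) = Z 0) :
    ∃ (Φ : ℝ × Y → E) (a : Y → ℝ) (lam : Y → Y →L[ℝ] ℝ) (D : (ℝ × Y) ≃L[ℝ] E),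
      SmoothNear Φ 0 ∧ Φ 0 = 0 ∧ fderiv ℝ Φ 0 = D ∧ SmoothNear a 0 ∧ a 0 = 0 ∧
      fderiv ℝ a 0 ≠ 0 ∧ SmoothNear lam 0 ∧
      (∀ u, (∀ v, oneFormDeriv lam 0 u v = 0) → u = 0) ∧
      ∀ᶠ p in 𝓝 0, ∀ u, oneFormPullback Φ α p u =
        (3 * p.1 ^ 2 - a p.2) * u.1 - p.1 * fderiv ℝ a p.2 u.2 + lam p.2 u.2 := by
  obtain ⟨Φ, h, lam, hΦ, hΦ0, hΦT, hh, hlam, hΦZ, hΦα⟩ :=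
    exists_fderiv_add_pullback_snd hα hZ hZα T hT
  have hΦt := hΦ.tendsto_zero hΦ0
  have hsnd : Tendsto (Prod.snd : ℝ × Y → Y) (𝓝 0) (𝓝 0) := continuous_snd.tendsto _
  set f : E → ℝ := fun x => α x (Z x) with hf_def
  have hf : SmoothNear f 0 := hα.clm_apply hZ
  have hh1 : ∀ᶠ p in 𝓝 0, fderiv ℝ h p (1, 0) = f (Φ p) := by
    filter_upwards [hΦα, hΦZ] with p h1 h2
    have h3 := h1 (1, 0)
    rw [map_zero, add_zero] at h3
    exact h3.symm.trans (congrArg (α (Φ p)) h2)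
  have hh2 := hΦ.fderiv_comp_flow hΦ0 hΦZ hf hh1
  have hh3 := hΦ.fderiv_comp_flow hΦ0 hΦZ (hf.fderiv_right.clm_apply hZ) hh2
  have hZ0 : Z 0 ≠ 0 := by
    intro h0
    rw [h0, map_zero] at hc2
    exact hc2 rfl
  obtain ⟨θ, a, b, hθ, ha, hb', hθ0, ha0, hhθ⟩ := exists_cubic_unfolding hh
    (by rw [hh1.self_of_nhds, hΦ0, hf_def]; simp [hα0])
    (by rw [hh2.self_of_nhds, hΦ0, hc])
    (by rwa [hh3.self_of_nhds, hΦ0])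
  obtain ⟨hθ1, ha1⟩ := cubic_unfolding_nondegenerate hθ ha hb' hθ0 ha0 hhθ (by
    intro h0
    have h1 : HasFDerivAt (fun p => f (Φ p)) ((fderiv ℝ f 0).comp (T : (ℝ × Y) →L[ℝ] E)) 0 := by
      refine HasFDerivAt.comp (g := f) 0 ?_ (hΦT ▸ hΦ.differentiableAt.hasFDerivAt)
      rw [hΦ0]
      exact hf.differentiableAt.hasFDerivAt
    rw [EventuallyEq.fderiv_eq hh1, h1.fderiv] at h0
    refine hb (ContinuousLinearMap.ext fun v => ?_)
    have := DFunLike.congr_fun h0 (T.symm v)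
    simpa using this)
  obtain ⟨g, hg, hg0, hθg, -⟩ := hθ.exists_partialInverse hθ1
  rw [hθ0] at hg hg0 hθg
  let Θ : ℝ × Y → ℝ × Y := fun p => (g p, p.2)
  have hΘ : SmoothNear Θ 0 := hg.prodMk (contDiff_snd.smoothNear 0)
  have hΘ0 : Θ 0 = 0 := Prod.ext hg0 rfl
  have hΘt := hΘ.tendsto_zero hΘ0
  have hΘi : Function.Injective (fderiv ℝ Θ 0) := by
    have h1 : SmoothNear (fun p : ℝ × Y => (θ p, p.2)) 0 :=
      hθ.prodMk (contDiff_snd.smoothNear 0)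
    have h2 : HasFDerivAt (fun q => ((θ (Θ q), (Θ q).2) : ℝ × Y)) _ 0 :=
      HasFDerivAt.comp (g := fun p : ℝ × Y => (θ p, p.2)) 0
        (by rw [hΘ0]; exact h1.differentiableAt.hasFDerivAt) hΘ.differentiableAt.hasFDerivAt
    have h3 : HasFDerivAt (fun q => ((θ (Θ q), (Θ q).2) : ℝ × Y))
        (ContinuousLinearMap.id ℝ (ℝ × Y)) 0 := by
      refine (hasFDerivAt_id 0).congr_of_eventuallyEq ?_
      filter_upwards [hθg] with q hq
      exact Prod.ext hq rfl
    have h4 := h2.unique h3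
    exact Function.LeftInverse.injective fun v => DFunLike.congr_fun h4 v
  let DΘ : (ℝ × Y) ≃L[ℝ] ℝ × Y :=
    (LinearEquiv.ofInjectiveEndo (fderiv ℝ Θ 0).toLinearMap hΘi).toContinuousLinearEquiv
  have hbd : SmoothNear (fun y => fderiv ℝ b y + lam y) 0 := hb'.fderiv_right.add hlam
  refine ⟨fun p => Φ (Θ p), a, fun y => fderiv ℝ b y + lam y, DΘ.trans T,
    SmoothNear.comp (by rwa [hΘ0]) hΘ, by simp only [hΘ0, hΦ0], ?_, ha, ha0, ha1, hbd, ?_, ?_⟩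
  · have h1 : HasFDerivAt (fun p => Φ (Θ p)) _ 0 :=
      HasFDerivAt.comp (g := Φ) 0 (by rw [hΘ0]; exact hΦ.differentiableAt.hasFDerivAt)
        hΘ.differentiableAt.hasFDerivAt
    rw [h1.fderiv, hΦT]
    rfl
  · intro u hu
    have hsm : SmoothNear (fun p : ℝ × Y => p.2) 0 := contDiff_snd.smoothNear 0
    have hpb : SmoothNear (oneFormPullback (fun p : ℝ × Y => p.2) lam) 0 :=
      SmoothNear.oneFormPullback hlam hsm
    have hsd : ∀ p v : ℝ × Y, fderiv ℝ (fun p : ℝ × Y => p.2) p v = v.2 := fun p v => by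
      rw [fderiv_snd]
      rfl
    have h1 : oneFormPullback Φ α =ᶠ[𝓝 0]
        fun p => fderiv ℝ h p + oneFormPullback (fun p : ℝ × Y => p.2) lam p := by
      filter_upwards [hΦα] with p hp
      refine ContinuousLinearMap.ext fun v => ?_
      rw [hp, add_apply, oneFormPullback, ContinuousLinearMap.comp_apply, hsd]
    have h2 : ∀ v, oneFormDeriv α 0 (T (0, u)) v = 0 := by
      intro v
      have h3 := oneFormDeriv_pullback (g := Φ) (μ := α) (x := 0)
        (by rw [hΦ0]; exact hα.differentiableAt) hΦ (0, u) (T.symm v)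
      rw [oneFormDeriv_congr h1, oneFormDeriv_add hh.fderiv_right.differentiableAt
        hpb.differentiableAt, oneFormDeriv_fderiv hh,
        oneFormDeriv_pullback (g := fun p : ℝ × Y => p.2) (x := 0) hlam.differentiableAt hsm, hsd, hsd, hΦT, hΦ0] at h3
      have h4 := hu (T.symm v).2
      rw [oneFormDeriv_add hb'.fderiv_right.differentiableAt hlam.differentiableAt,
        oneFormDeriv_fderiv hb'] at h4
      refine Eq.trans ?_ (h3.symm.trans h4)
      simp
    obtain ⟨c, hcu⟩ := hspan _ h2
    rw [← hT, ← map_smul] at hcu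
    have := congrArg Prod.snd (T.injective hcu)
    simpa using this
  · filter_upwards [hΘ, hΘt.eventually hΦ, hΘt.eventually hΦα, hΘt.eventually hh, hθg,
      eventually_eventually_nhds.2 (hΘt.eventually hhθ), eventually_eventually_nhds.2 hθg,
      hsnd.eventually ha, hsnd.eventually hb'] with p h1 h2 h3 h4 h5 h6 h7 h8 h9 u
    have h1' := h1.differentiableAt (by simp)
    rw [oneFormPullback_comp (h2.differentiableAt (by simp)) h1', oneFormPullback,
      ContinuousLinearMap.comp_apply, h3]
    have h10 : HasFDerivAt (fun q => h (Θ q)) _ p :=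
      (h4.differentiableAt (by simp)).hasFDerivAt.comp p h1'.hasFDerivAt
    have h11 : HasFDerivAt (fun p : ℝ × Y => a p.2) _ p :=
      (h8.differentiableAt (by simp)).hasFDerivAt.comp p hasFDerivAt_snd
    have h12 : HasFDerivAt (fun p : ℝ × Y => b p.2) _ p :=
      (h9.differentiableAt (by simp)).hasFDerivAt.comp p hasFDerivAt_snd
    have h13 : HasFDerivAt (fun p : ℝ × Y => p.1) (ContinuousLinearMap.fst ℝ ℝ Y) p :=
      hasFDerivAt_fst
    have h14 := ((h13.pow 3).sub (h11.mul h13)).add h12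
    have h15 : HasFDerivAt (fun q => h (Θ q)) _ p := h14.congr_of_eventuallyEq (by
      filter_upwards [h6, h7] with q h1 h2
      rw [h1, h2]
      rfl)
    have h16 := DFunLike.congr_fun (h10.unique h15) u
    have h17 : (fderiv ℝ Θ p u).2 = u.2 := by
      have h18 : HasFDerivAt (fun q : ℝ × Y => q.2) ((ContinuousLinearMap.snd ℝ ℝ Y).comp (fderiv ℝ Θ p)) p :=
        HasFDerivAt.comp (g := fun q : ℝ × Y => q.2) (f := Θ) p hasFDerivAt_snd h1'.hasFDerivAt
      have h19 : HasFDerivAt (fun q : ℝ × Y => q.2) (ContinuousLinearMap.snd ℝ ℝ Y) p := hasFDerivAt_snd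
      exact DFunLike.congr_fun (h18.unique h19) u
    rw [h17]
    have h19 : fderiv ℝ h (Θ p) (fderiv ℝ Θ p u) = _ := h16
    rw [h19]
    simp [Θ]
    ring

end NormalForm

section Prenormalization

variable {E : Type} [NormedAddCommGroup E] [NormedSpace ℝ E]

/-- Normal form of a singular contact form at a quadratic tangency, in the coordinates
`(θ, (p, q))` of `ℝ × (ℝⁿ × ℝⁿ)`. -/
theorem exists_prenormalForm [FiniteDimensional ℝ E] {n : ℕ} (hn : 0 < n)
    {α : E → E →L[ℝ] ℝ} {Z : E → E}
    (hα : SmoothNear α 0) (hZ : SmoothNear Z 0) (hα0 : α 0 = 0)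
    (hZα : ∀ᶠ x in 𝓝 (0 : E), ∀ v, oneFormDeriv α x (Z x) v = 0)
    (hspan : ∀ u, (∀ v, oneFormDeriv α 0 u v = 0) → ∃ c : ℝ, u = c • Z 0)
    (hb : fderiv ℝ (fun x => α x (Z x)) 0 ≠ 0) (hc : fderiv ℝ (fun x => α x (Z x)) 0 (Z 0) = 0)
    (hc2 : fderiv ℝ (fun x => fderiv ℝ (fun y => α y (Z y)) x (Z x)) 0 (Z 0) ≠ 0)
    (T : (ℝ × ((Fin n → ℝ) × (Fin n → ℝ))) ≃L[ℝ] E) (hT : T (1, 0) = Z 0) :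
    ∃ (Φ : ℝ × ((Fin n → ℝ) × (Fin n → ℝ)) → E)
      (μ : (Fin n → ℝ) × (Fin n → ℝ) → ((Fin n → ℝ) × (Fin n → ℝ)) →L[ℝ] ℝ)
      (D : (ℝ × ((Fin n → ℝ) × (Fin n → ℝ))) ≃L[ℝ] E),
      SmoothNear Φ 0 ∧ Φ 0 = 0 ∧ fderiv ℝ Φ 0 = D ∧ SmoothNear μ 0 ∧
      (∀ᶠ x in 𝓝 0, ∀ u v, oneFormDeriv μ x u v = stdSymplectic n u v) ∧
      ∀ᶠ p in 𝓝 0, ∀ u, oneFormPullback Φ α p u =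
        (3 * p.1 ^ 2 - p.2.1 ⟨0, hn⟩) * u.1 - p.1 * u.2.1 ⟨0, hn⟩ + μ p.2 u.2 := by
  obtain ⟨Φ, a, lam, D, hΦ, hΦ0, hΦD, ha, ha0, ha1, hlam, hnd, hΦα⟩ :=
    exists_cubic_normalForm hα hZ hα0 hZα hspan hb hc hc2 T hT
  set B := fderiv ℝ lam 0 - (fderiv ℝ lam 0).flip with hB
  have hBlam : ∀ u v, B u v = oneFormDeriv lam 0 u v := fun _ _ => rfl
  have hBalt : ∀ u v, B u v = -B v u := fun u v => oneFormDeriv_swap lam 0 u v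
  obtain ⟨B', hB'⟩ := exists_equiv_of_nondegenerate B hnd
  set w := -B'.symm (fderiv ℝ a 0) with hw_def
  have hw : ∀ v, B v w = fderiv ℝ a 0 v := by
    intro v
    rw [hBalt, ← hB', hw_def]
    simp
  have hw0 : w ≠ 0 := by
    intro h0
    refine ha1 (ContinuousLinearMap.ext fun v => ?_)
    rw [← hw, h0, map_zero, zero_apply]
  obtain ⟨S, hS, hSw⟩ := exists_symplectic_equiv hn
    (by rw [Module.finrank_prod, Module.finrank_fin_fun]; ring) B hBalt hnd hw0
  have he : ((0, Pi.single ⟨0, hn⟩ 1) : (Fin n → ℝ) × (Fin n → ℝ)) ≠ 0 := by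
    intro h0
    rw [h0, map_zero] at hSw
    exact hw0 hSw.symm
  obtain ⟨G, hG, hG0, hGa, hGω⟩ := exists_darboux stdSymplectic_swap stdSymplectic_nondegenerate
    he S hlam (fun u v => by rw [← hS, hBlam]) ha ha0 (fun v => by rw [← hS, hSw, hw])
  have hGt := hG.tendsto_zero hG0
  have hsnd : Tendsto (Prod.snd : ℝ × ((Fin n → ℝ) × (Fin n → ℝ)) → _) (𝓝 0) (𝓝 0) :=
    continuous_snd.tendsto _
  let K : ℝ × ((Fin n → ℝ) × (Fin n → ℝ)) → ℝ × ((Fin n → ℝ) × (Fin n → ℝ)) :=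
    fun p => (p.1, G p.2)
  have hGs : SmoothNear (fun p : ℝ × ((Fin n → ℝ) × (Fin n → ℝ)) => G p.2) 0 :=
    SmoothNear.comp (g := G) hG (contDiff_snd.smoothNear 0)
  have hK : SmoothNear K 0 := (contDiff_fst.smoothNear 0).prodMk hGs
  have hK0 : K 0 = 0 := Prod.ext rfl hG0
  have hKt := hK.tendsto_zero hK0
  have hKd : ∀ᶠ p in 𝓝 0, ∀ u, fderiv ℝ K p u = (u.1, fderiv ℝ G p.2 u.2) := by
    filter_upwards [hsnd.eventually hG] with p h1 u
    have h2 : HasFDerivAt (fun p : ℝ × ((Fin n → ℝ) × (Fin n → ℝ)) => G p.2) _ p :=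
      (h1.differentiableAt (by simp)).hasFDerivAt.comp p hasFDerivAt_snd
    have h3 : HasFDerivAt K _ p := hasFDerivAt_fst.prodMk h2
    rw [h3.fderiv]
    rfl
  have hKi : Function.Injective (fderiv ℝ K 0).toLinearMap := by
    rw [injective_iff_map_eq_zero]
    intro u hu
    have h1 := (hKd.self_of_nhds u).symm.trans hu
    have h2 : fderiv ℝ G 0 u.2 = 0 := congrArg Prod.snd h1
    have h3 : u.1 = 0 := congrArg Prod.fst h1
    refine Prod.ext h3 (stdSymplectic_nondegenerate _ fun v => ?_)
    rw [← hGω.self_of_nhds, h2]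
    simp [oneFormDeriv]
  let DK := (LinearEquiv.ofInjectiveEndo _ hKi).toContinuousLinearEquiv
  refine ⟨fun p => Φ (K p), oneFormPullback G lam, DK.trans D,
    SmoothNear.comp (by rwa [hK0]) hK, by simp only [hK0, hΦ0], ?_,
    SmoothNear.oneFormPullback (by rwa [hG0]) hG, ?_, ?_⟩
  · have h1 : HasFDerivAt (fun p => Φ (K p)) _ 0 :=
      HasFDerivAt.comp (g := Φ) 0 (by rw [hK0]; exact hΦ.differentiableAt.hasFDerivAt)
        hK.differentiableAt.hasFDerivAt
    rw [h1.fderiv, hΦD]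
    rfl
  · filter_upwards [hGω, hG.eventually, hGt.eventually hlam] with x h1 h2 h3 u v
    rw [oneFormDeriv_pullback (h3.differentiableAt (by simp)) h2, h1]
  · filter_upwards [hKt.eventually hΦα, hKt.eventually hΦ, hK, hKd,
      hsnd.eventually (eventually_eventually_nhds.2 hGa), hsnd.eventually hG,
      hsnd.eventually (hGt.eventually ha)] with p h1 h2 h3 h4 h5 h6 h7 u
    have h8 : fderiv ℝ a (G p.2) (fderiv ℝ G p.2 u.2) = u.2.1 ⟨0, hn⟩ := by
      have h9 : HasFDerivAt (fun x => a (G x)) _ p.2 :=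
        (h7.differentiableAt (by simp)).hasFDerivAt.comp p.2
          (h6.differentiableAt (by simp)).hasFDerivAt
      have h10 : HasFDerivAt (fun x => a (G x))
          ((stdSymplectic n).flip (0, Pi.single ⟨0, hn⟩ 1)) p.2 :=
        (ContinuousLinearMap.hasFDerivAt _).congr_of_eventuallyEq h5
      exact (DFunLike.congr_fun (h9.unique h10) u.2).trans (stdSymplectic_single_right _ _)
    have h11 : a (G p.2) = p.2.1 ⟨0, hn⟩ :=
      h5.self_of_nhds.trans (stdSymplectic_single_right _ _)
    rw [oneFormPullback_comp (h2.differentiableAt (by simp)) (h3.differentiableAt (by simp)),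
      oneFormPullback, ContinuousLinearMap.comp_apply, h1, h4, h8, h11]
    rfl

/-- The splitting of `ℝ^{2n+1}` as `ℝ × (ℝⁿ × ℝⁿ)`. -/
theorem exists_coordinateSplitting (n : ℕ) :
    ∃ R : (Fin (2 * n + 1) → ℝ) ≃L[ℝ] ℝ × ((Fin n → ℝ) × (Fin n → ℝ)),
      (∀ p, (R p).1 = p 0) ∧
      (∀ p (i : Fin n) (h : (i : ℕ) + 1 < 2 * n + 1), (R p).2.1 i = p ⟨(i : ℕ) + 1, h⟩) ∧
      ∀ p (i : Fin n) (h : n + (i : ℕ) + 1 < 2 * n + 1),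
        (R p).2.2 i = p ⟨n + (i : ℕ) + 1, h⟩ := by
  have hlt : ∀ i : Fin n, (i : ℕ) + 1 < 2 * n + 1 := fun i => by have := i.isLt; omega
  have hlt' : ∀ i : Fin n, n + (i : ℕ) + 1 < 2 * n + 1 := fun i => by have := i.isLt; omega
  let L : (Fin (2 * n + 1) → ℝ) →ₗ[ℝ] ℝ × ((Fin n → ℝ) × (Fin n → ℝ)) :=
    (LinearMap.proj 0).prod
      ((LinearMap.funLeft ℝ ℝ fun i : Fin n => ⟨(i : ℕ) + 1, hlt i⟩).prod
        (LinearMap.funLeft ℝ ℝ fun i : Fin n => ⟨n + (i : ℕ) + 1, hlt' i⟩))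
  have hL : Function.Injective L := by
    rw [injective_iff_map_eq_zero]
    intro p hp
    have h1 : p 0 = 0 := congrArg Prod.fst hp
    have h2 : ∀ i : Fin n, p ⟨(i : ℕ) + 1, hlt i⟩ = 0 := fun i =>
      congrFun (congrArg (fun z => z.2.1) hp) i
    have h3 : ∀ i : Fin n, p ⟨n + (i : ℕ) + 1, hlt' i⟩ = 0 := fun i =>
      congrFun (congrArg (fun z => z.2.2) hp) i
    ext ⟨j, hj⟩
    rcases Nat.eq_zero_or_pos j with rfl | hj0
    · exact h1
    · by_cases hjn : j ≤ n
      · have := h2 ⟨j - 1, by omega⟩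
        simpa [Nat.sub_add_cancel hj0] using this
      · have := h3 ⟨j - n - 1, by omega⟩
        have h4 : n + (j - n - 1) + 1 = j := by omega
        simpa [h4] using this
  have hfin : Module.finrank ℝ (Fin (2 * n + 1) → ℝ) =
      Module.finrank ℝ (ℝ × ((Fin n → ℝ) × (Fin n → ℝ))) := by
    simp only [Module.finrank_prod, Module.finrank_fin_fun, Module.finrank_self]
    ring
  exact ⟨(L.linearEquivOfInjective hL hfin).toContinuousLinearEquiv, fun _ => rfl,
    fun _ _ _ => rfl, fun _ _ _ => rfl⟩

/-- Two nonzero vectors can be exchanged by a linear equivalence. -/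
theorem exists_equiv_apply_eq {F : Type} [NormedAddCommGroup F] [NormedSpace ℝ F]
    [FiniteDimensional ℝ E] (R : F ≃L[ℝ] E) {x : F} {y : E} (hx : x ≠ 0) (hy : y ≠ 0) :
    ∃ T : F ≃L[ℝ] E, T x = y := by
  have hx' : R x ≠ 0 := by simpa using hx
  obtain ⟨A, hA⟩ := SeparatingDual.exists_continuousLinearEquiv_apply_eq (R := ℝ) hx' hy
  exact ⟨R.trans A, hA⟩

/-- A map with invertible derivative restricts to a diffeomorphism of small neighborhoods on
which any prescribed local property holds. -/
theorem SmoothNear.exists_diffeo {F : Type} [NormedAddCommGroup F] [NormedSpace ℝ F]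
    [CompleteSpace F] {Φ : F → E} {x : F} (hΦ : SmoothNear Φ x) (D : F ≃L[ℝ] E)
    (hD : fderiv ℝ Φ x = D) {P : F → Prop} (hP : ∀ᶠ p in 𝓝 x, P p) :
    ∃ V : Set F, IsOpen V ∧ x ∈ V ∧ ∃ Ψ : E → F, ContDiffOn ℝ ∞ Φ V ∧ Set.InjOn Φ V ∧
      IsOpen (Φ '' V) ∧ ContDiffOn ℝ ∞ Ψ (Φ '' V) ∧ (∀ p ∈ V, Ψ (Φ p) = p) ∧
      (∀ q ∈ Φ '' V, Φ (Ψ q) = q) ∧ ∀ p ∈ V, P p := by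
  obtain ⟨Ψ, hΨ, -, hΦΨ, hΨΦ, -⟩ := hΦ.exists_localInverse D hD
  obtain ⟨W, hW, hWo, hxW⟩ := eventually_nhds_iff.1 (hΨ.and hΦΨ)
  obtain ⟨V, hV, hVo, hxV⟩ := eventually_nhds_iff.1
    ((hΦ.and hΨΦ).and (hP.and (hΦ.continuousAt.eventually (hWo.mem_nhds hxW))))
  have hinv : ∀ p ∈ V, Ψ (Φ p) = p := fun p hp => (hV p hp).1.2
  have hVW : ∀ p ∈ V, Φ p ∈ W := fun p hp => (hV p hp).2.2
  have himage : Φ '' V = W ∩ Ψ ⁻¹' V := by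
    ext q
    constructor
    · rintro ⟨p, hp, rfl⟩
      exact ⟨hVW p hp, by rwa [Set.mem_preimage, hinv p hp]⟩
    · rintro ⟨h1, h2⟩
      exact ⟨Ψ q, h2, (hW q h1).2⟩
  have hΨW : ContDiffOn ℝ ∞ Ψ W := fun q hq => (hW q hq).1.contDiffWithinAt
  refine ⟨V, hVo, hxV, Ψ, fun p hp => (hV p hp).1.1.contDiffWithinAt,
    fun p hp q hq h => by rw [← hinv p hp, h, hinv q hq], ?_, ?_, hinv, ?_,
    fun p hp => (hV p hp).2.1⟩
  · rw [himage]
    exact hΨW.continuousOn.isOpen_inter_preimage hWo hVo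
  · rw [himage]
    exact hΨW.mono Set.inter_subset_left
  · rw [himage]
    exact fun q hq => (hW q hq.1).2

end Prenormalization

/-- (Pre-normalization, tangent case.) Let `α` be a smooth 1-form near `0` in
`ℝ^{2n+1}` with `α(0) = 0` such that `(dα)^n(0) ≠ 0` (the kernel of `dα` near `0` being spanned
by a nonvanishing smooth vector field `Z`), the coefficient `f = α(Z)` satisfies `df(0) ≠ 0`,
and `N = {f = 0}` is tangent to `Z` at `0` with generic order-2 tangency:
`df(0)(Z(0)) = 0` but `Z(Z(f))(0) ≠ 0`. Then in suitable local coordinates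
`(θ, x₁, …, x_{2n})` one has `α = d(θ³ − x₁θ) + γ` with `γ = ∑ gᵢ(x) dxᵢ` basic with respect to
`∂/∂θ` and `dγ = ∑_{i=1}^{n} dxᵢ ∧ dx_{n+i}`. Coordinate `0` plays the role of `θ` and
coordinate `1` the role of `x₁`. -/
theorem singular_contact_prenormalization_tangent
    (n : ℕ) (hn : 0 < n)
    (U : Set (Fin (2*n+1) → ℝ)) (hU : IsOpen U) (h0U : (0 : Fin (2*n+1) → ℝ) ∈ U)
    (α : (Fin (2*n+1) → ℝ) → (Fin (2*n+1) → ℝ) →L[ℝ] ℝ)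
    (hα : ContDiffOn ℝ (⊤ : ℕ∞) α U) (hα0 : α 0 = 0)
    -- the exterior derivative of α :
    (dα : (Fin (2*n+1) → ℝ) → (Fin (2*n+1) → ℝ) → (Fin (2*n+1) → ℝ) → ℝ)
    (hdα : ∀ x u v, dα x u v = fderiv ℝ α x u v - fderiv ℝ α x v u)
    -- (a)  (dα)^n (0) ≠ 0 :
    (ha : ∃ v : Fin (2*n) → (Fin (2*n+1) → ℝ),
      (1 / 2 ^ n : ℝ) * ∑ σ : Equiv.Perm (Fin (2*n)), ((Equiv.Perm.sign σ : ℤ) : ℝ) *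
        ∏ i : Fin n, dα 0 (v (σ ⟨2*(i : ℕ), by have := i.isLt; omega⟩))
                          (v (σ ⟨2*(i : ℕ) + 1, by have := i.isLt; omega⟩)) ≠ 0)
    -- Z is a nonvanishing smooth vector field spanning the kernel of dα near 0 :
    (Z : (Fin (2*n+1) → ℝ) → (Fin (2*n+1) → ℝ))
    (hZ : ContDiffOn ℝ (⊤ : ℕ∞) Z U)
    (hZne : ∀ x ∈ U, Z x ≠ 0)
    (hZker : ∀ x ∈ U, ∀ v, dα x (Z x) v = 0)
    (hZspan : ∀ x ∈ U, ∀ u, (∀ v, dα x u v = 0) → ∃ c : ℝ, u = c • Z x)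
    -- (b)  f = α(Z) has df(0) ≠ 0 :
    (hb : fderiv ℝ (fun x => α x (Z x)) 0 ≠ 0)
    -- (c)  N = {f = 0} is tangent to Z at 0, with generic (order 2) tangency :
    (hc : fderiv ℝ (fun x => α x (Z x)) 0 (Z 0) = 0)
    (hc2 : fderiv ℝ (fun x => fderiv ℝ (fun y => α y (Z y)) x (Z x)) 0 (Z 0) ≠ 0) :
    ∃ V : Set (Fin (2*n+1) → ℝ), IsOpen V ∧ (0 : Fin (2*n+1) → ℝ) ∈ V ∧
    ∃ Φ Ψ : (Fin (2*n+1) → ℝ) → (Fin (2*n+1) → ℝ),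
      Φ 0 = 0 ∧
      ContDiffOn ℝ (⊤ : ℕ∞) Φ V ∧
      Set.InjOn Φ V ∧ IsOpen (Φ '' V) ∧
      ContDiffOn ℝ (⊤ : ℕ∞) Ψ (Φ '' V) ∧
      (∀ p ∈ V, Ψ (Φ p) = p) ∧ (∀ q ∈ Φ '' V, Φ (Ψ q) = q) ∧
      (∀ p ∈ V, Φ p ∈ U) ∧
      ∃ γ : (Fin (2*n+1) → ℝ) → (Fin (2*n+1) → ℝ) →L[ℝ] ℝ,
        ContDiffOn ℝ (⊤ : ℕ∞) γ V ∧
        -- γ is basic with respect to ∂/∂θ : no dθ-component, coefficients independent of θ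
        (∀ p : Fin (2*n+1) → ℝ, γ p (Pi.single (0 : Fin (2*n+1)) 1) = 0) ∧
        (∀ p : Fin (2*n+1) → ℝ, γ p = γ (Function.update p (0 : Fin (2*n+1)) 0)) ∧
        -- Φ*α = d(θ³ − x₁ θ) + γ :
        (∀ p ∈ V, ∀ u : Fin (2*n+1) → ℝ,
          α (Φ p) (fderiv ℝ Φ p u) =
            (3 * (p 0) ^ 2 - p ⟨1, by omega⟩) * u 0 - p 0 * u ⟨1, by omega⟩ + γ p u) ∧
        -- dγ = ∑ dxᵢ ∧ dx_{n+i} :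
        (∀ p ∈ V, ∀ u v : Fin (2*n+1) → ℝ,
          fderiv ℝ γ p u v - fderiv ℝ γ p v u =
            ∑ i : Fin n,
              (u ⟨(i : ℕ) + 1, by have := i.isLt; omega⟩ *
                 v ⟨n + (i : ℕ) + 1, by have := i.isLt; omega⟩
               - u ⟨n + (i : ℕ) + 1, by have := i.isLt; omega⟩ *
                 v ⟨(i : ℕ) + 1, by have := i.isLt; omega⟩)) := by
  have hUn : U ∈ 𝓝 0 := hU.mem_nhds h0U
  have hα' : SmoothNear α 0 := hα.smoothNear hUn
  have hZ' : SmoothNear Z 0 := hZ.smoothNear hUn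
  have hdα' : ∀ x u v, oneFormDeriv α x u v = dα x u v := fun x u v => (hdα x u v).symm
  obtain ⟨R, hR1, hRp, hRq⟩ := exists_coordinateSplitting n
  obtain ⟨T, hT⟩ := exists_equiv_apply_eq R.symm
    (x := ((1, 0) : ℝ × ((Fin n → ℝ) × (Fin n → ℝ)))) (by simp) (hZne 0 h0U)
  obtain ⟨Φ, μ, D, hΦ, hΦ0, hΦD, hμ, hμΩ, hΦα⟩ := exists_prenormalForm hn hα' hZ' hα0
    (by
      filter_upwards [hUn] with x hx v
      rw [hdα', hZker x hx])
    (fun u hu => hZspan 0 h0U u fun v => by rw [← hdα', hu]) hb hc hc2 T hT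
  have hRs : SmoothNear R 0 := R.contDiff.smoothNear 0
  have hRt := hRs.tendsto_zero (map_zero R)
  let pr : (Fin (2 * n + 1) → ℝ) →L[ℝ] (Fin n → ℝ) × (Fin n → ℝ) :=
    (ContinuousLinearMap.snd ℝ ℝ _).comp (R : (Fin (2 * n + 1) → ℝ) →L[ℝ] _)
  have hprs : SmoothNear pr 0 := pr.contDiff.smoothNear 0
  have hprt := hprs.tendsto_zero (map_zero pr)
  have hΦR : SmoothNear (fun p => Φ (R p)) 0 := SmoothNear.comp (by rwa [map_zero]) hRs
  have hΦR0 : Φ (R 0) = 0 := by rw [map_zero, hΦ0]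
  have hΦRt := hΦR.tendsto_zero hΦR0
  have hγ : SmoothNear (oneFormPullback pr μ) 0 :=
    SmoothNear.oneFormPullback (by rwa [map_zero]) hprs
  have hprd : ∀ x, oneFormPullback pr μ x = (μ (pr x)).comp pr := fun x => by
    rw [oneFormPullback, pr.fderiv]
  have hDR : fderiv ℝ (fun p => Φ (R p)) 0 = R.trans D := by
    have h1 : HasFDerivAt (fun p => Φ (R p)) _ 0 :=
      HasFDerivAt.comp (g := Φ) 0 (by rw [map_zero]; exact hΦ.differentiableAt.hasFDerivAt)
        R.hasFDerivAt
    rw [h1.fderiv, hΦD]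
    rfl
  obtain ⟨V, hVo, h0V, Ψ, hΦV, hinj, hopen, hΨ, hΨΦ, hΦΨ, hP⟩ := hΦR.exists_diffeo (R.trans D) hDR
    ((hΦRt.eventually hUn).and (hγ.and ((hRt.eventually hΦα).and ((hRt.eventually hΦ).and
      ((hprt.eventually hμ).and (hprt.eventually hμΩ))))))
  have hprp : ∀ p (i : Fin n), (pr p).1 i = p ⟨(i : ℕ) + 1, by have := i.isLt; omega⟩ :=
    fun p i => hRp p i _
  have hprq : ∀ p (i : Fin n), (pr p).2 i = p ⟨n + (i : ℕ) + 1, by have := i.isLt; omega⟩ :=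
    fun p i => hRq p i _
  have hpr_single : pr (Pi.single 0 1) = 0 := by
    refine Prod.ext (funext fun i => ?_) (funext fun i => ?_)
    · rw [hprp]
      exact Pi.single_eq_of_ne (by simp [Fin.ext_iff]) _
    · rw [hprq]
      exact Pi.single_eq_of_ne (by simp [Fin.ext_iff]) _
  have hpr_update : ∀ p, pr (Function.update p 0 0) = pr p := by
    intro p
    refine Prod.ext (funext fun i => ?_) (funext fun i => ?_)
    · rw [hprp, hprp]
      exact Function.update_of_ne (by simp [Fin.ext_iff]) _ _
    · rw [hprq, hprq]
      exact Function.update_of_ne (by simp [Fin.ext_iff]) _ _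
  refine ⟨V, hVo, h0V, fun p => Φ (R p), Ψ, hΦR0, hΦV, hinj, hopen, hΨ, hΨΦ, hΦΨ,
    fun p hp => (hP p hp).1, oneFormPullback pr μ,
    fun p hp => (hP p hp).2.1.contDiffWithinAt, fun p => ?_, fun p => ?_, fun p hp u => ?_,
    fun p hp u v => ?_⟩
  · rw [hprd, ContinuousLinearMap.comp_apply, hpr_single, map_zero]
  · rw [hprd, hprd, hpr_update]
  · obtain ⟨-, -, h1, h2, -⟩ := hP p hp
    have h3 : HasFDerivAt (fun p => Φ (R p)) _ p :=
      HasFDerivAt.comp (g := Φ) p (h2.differentiableAt (by simp)).hasFDerivAt R.hasFDerivAt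
    rw [h3.fderiv, hprd]
    refine (h1 (R u)).trans ?_
    rw [hR1, hR1, hRp, hRp]
    rfl
  · obtain ⟨-, -, -, -, h1, h2⟩ := hP p hp
    have h3 := oneFormDeriv_pullback (g := pr) (h1.differentiableAt (by simp))
      (pr.contDiff.smoothNear p) u v
    rw [pr.fderiv, h2, stdSymplectic_apply] at h3
    refine h3.trans (Finset.sum_congr rfl fun i _ => ?_)
    rw [hprp, hprp, hprq, hprq]
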